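/- Let c be a positive integer. The equation L_n − 2^x · 3^y = c has at least three pairwise distinct solutions (n, x, y) in nonnegative integers if and only if c ∈ {1, 2, 3, 5, 9, 15, 20, 75}. -/

import Mathlib

/-- The Lucas sequence: L 0 = 2, L 1 = 1, L (n+2) = L (n+1) + L n. -/
def lucas : ℕ → ℤ
  | 0 => 2
  | 1 => 1
  | n + 2 => lucas (n + 1) + lucas n

open Polynomial in
theorem coeff_prod_sum_natDegree {ι : Type*} (s : Finset ι) (f : ι → ℝ[X]) (d : ι → ℕ)
    (h : ∀ i ∈ s, (f i).natDegree ≤ d i) :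
    (∏ i ∈ s, f i).coeff (∑ i ∈ s, d i) = ∏ i ∈ s, (f i).coeff (d i) := by
  classical
  induction s using Finset.induction_on with
  | empty => simp
  | insert a s ha ih =>
    rw [Finset.prod_insert ha, Finset.sum_insert ha, Finset.prod_insert ha,
      Polynomial.coeff_mul_add_eq_of_natDegree_le (h a (by simp)), ih]
    · exact fun i hi => h i (by simp [hi])
    · exact (natDegree_prod_le _ _).trans
        (Finset.sum_le_sum fun i hi => h i (by simp [hi]))

open Polynomial in
/-- Philippon-style zero estimate on `𝔾ₐ × 𝔾ₘ`: a nonzero polynomial `∑ Q_j(X) Y^j` cannot vanish on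
a sumset `Σ₁ + Σ₂` once `Σ₁` has enough distinct `Y`-values and `Σ₂` enough distinct `X`-values. -/
theorem zero_estimate {ι : Type*} {J K : ℕ} (Q : Fin J → ℝ[X]) (hdeg : ∀ j, (Q j).natDegree < K)
    (ξ y : Fin J → ℝ) (hy : Function.Injective y)
    (E : Finset ι) (x₀ y₀ : ι → ℝ) (hx₀ : Set.InjOn x₀ E) (hy₀ : ∀ e ∈ E, y₀ e ≠ 0)
    (hE : K * J ≤ E.card)
    (h0 : ∀ e ∈ E, ∀ i, ∑ j, (Q j).eval (x₀ e + ξ i) * (y₀ e * y i) ^ (j : ℕ) = 0) :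
    ∀ j, Q j = 0 := by
  classical
  by_contra hne
  push Not at hne
  obtain ⟨j₀, hj₀⟩ := hne
  set Q' : Fin J → ℝ[X] := fun j => if Q j = 0 then 1 else Q j with hQ'
  have hQ'0 : ∀ j, Q' j ≠ 0 := by
    intro j; simp only [hQ']; split_ifs with h
    · exact one_ne_zero
    · exact h
  have hK : 0 < K := lt_of_le_of_lt (Nat.zero_le _) (hdeg j₀)
  have hJ : 0 < J := j₀.pos
  have hQ'd : ∀ j, (Q' j).natDegree < K := by
    intro j; simp only [hQ']; split_ifs with h
    · simpa using hK
    · exact hdeg j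
  set M : Matrix (Fin J) (Fin J) ℝ[X] :=
    fun i j => (Q' j).comp (X + C (ξ i)) * C (y i ^ (j : ℕ)) with hM
  have hMd : ∀ i j, (M i j).natDegree ≤ (Q' j).natDegree := by
    intro i j
    refine (natDegree_mul_C_le _ _).trans ?_
    rw [natDegree_comp]; simp
  have hMc : ∀ i j, (M i j).coeff (Q' j).natDegree = (Q' j).leadingCoeff * y i ^ (j : ℕ) := by
    intro i j
    simp only [hM, coeff_mul_C]
    congr 1
    have h1 : ((Q' j).comp (X + C (ξ i))).natDegree = (Q' j).natDegree := by
      rw [natDegree_comp]; simp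
    rw [← h1, coeff_natDegree, leadingCoeff_comp (by simp)]
    simp
  have hcoef : M.det.coeff (∑ j, (Q' j).natDegree) =
      (∏ j, (Q' j).leadingCoeff) * (Matrix.vandermonde y).det := by
    rw [Matrix.det_apply, Matrix.det_apply, finsetSum_coeff, Finset.mul_sum]
    refine Finset.sum_congr rfl fun σ _ => ?_
    have h1 : (∏ i, M (σ i) i).coeff (∑ j, (Q' j).natDegree) =
        (∏ j, (Q' j).leadingCoeff) * ∏ i, Matrix.vandermonde y (σ i) i := by
      rw [coeff_prod_sum_natDegree _ _ _ fun i _ => hMd _ _, ← Finset.prod_mul_distrib]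
      exact Finset.prod_congr rfl fun i _ => by rw [hMc]; rfl
    rw [coeff_smul, h1, mul_smul_comm]
  have hdet0 : M.det ≠ 0 := by
    intro h
    rw [h, coeff_zero] at hcoef
    have h1 : ∏ j, (Q' j).leadingCoeff ≠ 0 :=
      Finset.prod_ne_zero_iff.2 fun j _ => leadingCoeff_ne_zero.2 (hQ'0 j)
    exact mul_ne_zero h1 (Matrix.det_vandermonde_ne_zero_iff.2 hy) hcoef.symm
  have hdetd : M.det.natDegree ≤ (K - 1) * J := by
    rw [Matrix.det_apply]
    refine natDegree_sum_le_of_forall_le _ _ fun σ _ => ?_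
    refine (natDegree_smul_le _ _).trans ((natDegree_prod_le _ _).trans ?_)
    calc ∑ i, (M (σ i) i).natDegree ≤ ∑ _i : Fin J, (K - 1) :=
          Finset.sum_le_sum fun i _ => (hMd _ _).trans (Nat.le_sub_one_of_lt (hQ'd i))
      _ = (K - 1) * J := by simp [mul_comm]
  have hroot : ∀ e ∈ E, M.det.eval (x₀ e) = 0 := by
    intro x hx
    rw [← coe_evalRingHom, RingHom.map_det]
    refine Matrix.exists_mulVec_eq_zero_iff.1
      ⟨fun j => if Q j = 0 then 0 else y₀ x ^ (j : ℕ), ?_, ?_⟩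
    · intro h
      have := congrFun h j₀
      simp [hj₀] at this
      exact hy₀ x hx this.1
    · funext i
      rw [Matrix.mulVec, dotProduct, Pi.zero_apply]
      refine Eq.trans ?_ (h0 x hx i)
      refine Finset.sum_congr rfl fun j _ => ?_
      rw [RingHom.mapMatrix_apply, Matrix.map_apply, coe_evalRingHom]
      by_cases hj : Q j = 0
      · simp [hj]
      · simp only [hM, hQ', hj, if_false, eval_mul, eval_C, eval_comp, eval_add, eval_X]
        rw [mul_pow]
        ring
  have hc : E.card ≤ M.det.natDegree := by
    rw [← Finset.card_image_of_injOn hx₀]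
    refine card_le_degree_of_subset_roots ?_
    intro x hx
    obtain ⟨e, he, rfl⟩ := Finset.mem_image.1 hx
    simp [hdet0, hroot e he]
  have : (K - 1) * J < K * J := Nat.mul_lt_mul_of_pos_right (by omega) hJ
  omega

open Polynomial in
/-- `zero_estimate` in terms of coefficients. -/
theorem zero_estimate_coeff {ι : Type*} {J K : ℕ} (p : Fin K × Fin J → ℝ)
    (ξ y : Fin J → ℝ) (hy : Function.Injective y)
    (E : Finset ι) (x₀ y₀ : ι → ℝ) (hx₀ : Set.InjOn x₀ E) (hy₀ : ∀ e ∈ E, y₀ e ≠ 0)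
    (hE : K * J ≤ E.card)
    (h0 : ∀ e ∈ E, ∀ i, ∑ kj, p kj * ((x₀ e + ξ i) ^ (kj.1 : ℕ) * (y₀ e * y i) ^ (kj.2 : ℕ)) = 0) :
    p = 0 := by
  classical
  rcases Nat.eq_zero_or_pos K with rfl | hK
  · funext kj; exact kj.1.elim0
  let Q : Fin J → ℝ[X] := fun j => ∑ k : Fin K, monomial (k : ℕ) (p (k, j))
  have hQ : ∀ j, Q j = 0 := by
    refine zero_estimate (K := K) Q (fun j => ?_) ξ y hy E x₀ y₀ hx₀ hy₀ hE fun e he i => ?_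
    · refine lt_of_le_of_lt (natDegree_sum_le_of_forall_le _ (n := K - 1) _ fun k _ => ?_)
          (by omega)
      exact (natDegree_monomial_le _).trans (by omega)
    · rw [← h0 e he i, Fintype.sum_prod_type_right]
      refine Finset.sum_congr rfl fun j _ => ?_
      simp only [Q, eval_finsetSum, eval_monomial, Finset.sum_mul]
      exact Finset.sum_congr rfl fun k _ => by ring
  funext ⟨k, j⟩
  have := congrArg (fun P => P.coeff (k : ℕ)) (hQ j)
  simpa [Q, coeff_monomial, Fin.val_inj] using this

open Real (goldenRatio goldenConj)

/-- The ring `ℤ[φ]` of integers of `ℚ(√5)`. -/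
abbrev ZPhi := QuadraticAlgebra ℤ 1 1

namespace ZPhi

open QuadraticAlgebra

/-- The element `φ` of `ℤ[φ]`. -/
def phi : ZPhi := ⟨0, 1⟩

/-- The embedding `ℤ[φ] → ℝ` sending `φ` to a root `t` of `X² - X - 1`. -/
noncomputable def embOf (t : ℝ) (ht : t ^ 2 = t + 1) : ZPhi →+* ℝ where
  toFun x := x.re + x.im * t
  map_one' := by simp
  map_zero' := by simp
  map_add' x y := by simp; ring
  map_mul' x y := by
    simp
    linear_combination (-(x.im : ℝ) * y.im) * ht

/-- The embedding `ℤ[φ] → ℝ` sending `φ` to the golden ratio. -/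
noncomputable def emb : ZPhi →+* ℝ := embOf goldenRatio Real.goldenRatio_sq

/-- The embedding `ℤ[φ] → ℝ` sending `φ` to the conjugate of the golden ratio. -/
noncomputable def embConj : ZPhi →+* ℝ := embOf goldenConj Real.goldenConj_sq

theorem emb_apply (x : ZPhi) : emb x = x.re + x.im * goldenRatio := rfl
theorem embConj_apply (x : ZPhi) : embConj x = x.re + x.im * goldenConj := rfl

@[simp] theorem emb_phi : emb phi = goldenRatio := by simp [emb_apply, phi]
@[simp] theorem embConj_phi : embConj phi = goldenConj := by simp [embConj_apply, phi]

theorem emb_mul_embConj (x : ZPhi) : emb x * embConj x = (x.norm : ℤ) := by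
  rw [emb_apply, embConj_apply, QuadraticAlgebra.norm_def]
  have h1 := Real.goldenRatio_add_goldenConj
  have h2 := Real.goldenRatio_mul_goldenConj
  push_cast
  linear_combination (x.re * x.im : ℝ) * h1 + (x.im : ℝ) ^ 2 * h2

theorem emb_injective : Function.Injective emb := by
  rw [injective_iff_map_eq_zero]
  intro x hx
  have hirr := Real.goldenRatio_irrational
  rw [emb_apply] at hx
  by_cases h : x.im = 0
  · rw [h] at hx
    ext
    · simpa using hx
    · simpa using h
  · exfalso
    apply hirr
    refine ⟨-(x.re : ℚ) / x.im, ?_⟩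
    have : (x.im : ℝ) ≠ 0 := by exact_mod_cast h
    push_cast
    rw [div_eq_iff this]
    linarith

theorem one_le_abs_mul {x : ZPhi} (hx : x ≠ 0) : 1 ≤ |emb x| * |embConj x| := by
  rw [← abs_mul, emb_mul_embConj]
  have h : x.norm ≠ 0 := by
    intro h
    have h1 : emb x * embConj x = 0 := by rw [emb_mul_embConj, h]; simp
    have h2 : emb x ≠ 0 := fun h => hx (emb_injective (by simpa using h))
    have h3 : embConj x = 0 := by simpa [h2] using h1
    rw [embConj_apply] at h3
    have hirr := Real.goldenConj_irrational
    by_cases h : x.im = 0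
    · rw [h] at h3
      apply hx
      ext
      · simpa using h3
      · simpa using h
    · apply hirr
      refine ⟨-(x.re : ℚ) / x.im, ?_⟩
      have : (x.im : ℝ) ≠ 0 := by exact_mod_cast h
      push_cast
      rw [div_eq_iff this]
      linarith
  exact_mod_cast Int.one_le_abs h

theorem pow_sq_le_of_dvd {x : ZPhi} (hx : x ≠ 0) {q : ℕ} (h : (q : ZPhi) ∣ x) :
    (q : ℝ) ^ 2 ≤ |emb x| * |embConj x| := by
  obtain ⟨y, rfl⟩ := h
  have hy : y ≠ 0 := by rintro rfl; simp at hx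
  have := one_le_abs_mul hy
  simp only [map_mul, map_natCast, abs_mul, Nat.abs_cast]
  nlinarith [sq_nonneg (q : ℝ)]

end ZPhi

theorem coe_lucas (n : ℕ) : (lucas n : ℝ) = goldenRatio ^ n + goldenConj ^ n := by
  have h1 := Real.goldenRatio_sq
  have h2 := Real.goldenConj_sq
  have : ∀ n, (lucas n : ℝ) = goldenRatio ^ n + goldenConj ^ n ∧
      (lucas (n + 1) : ℝ) = goldenRatio ^ (n + 1) + goldenConj ^ (n + 1) := by
    intro n
    induction n with
    | zero => simp [lucas, Real.goldenRatio_add_goldenConj]; norm_num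
    | succ n ih =>
      refine ⟨ih.2, ?_⟩
      rw [lucas, Int.cast_add, ih.1, ih.2]
      linear_combination -goldenRatio ^ n * h1 - goldenConj ^ n * h2
  exact (this n).1

open ZPhi in
theorem phi_pow_mul_lucas_sub (m d : ℕ) :
    phi ^ (m + d) * ((lucas (m + d) - lucas m : ℤ) : ZPhi) =
      phi ^ (2 * m + d) * (phi ^ d - 1) - (-1) ^ m * (phi ^ d - (-1) ^ d) := by
  apply emb_injective
  have h : goldenRatio * goldenConj = -1 := Real.goldenRatio_mul_goldenConj
  have hm : goldenRatio ^ m * goldenConj ^ m = (-1) ^ m := by rw [← mul_pow, h]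
  have hd : goldenRatio ^ d * goldenConj ^ d = (-1) ^ d := by rw [← mul_pow, h]
  simp only [map_mul, map_pow, map_sub, map_intCast, map_neg, map_one, emb_phi]
  push_cast
  rw [coe_lucas, coe_lucas, pow_add, pow_add, pow_add, pow_mul', pow_two]
  linear_combination (goldenRatio ^ d * goldenConj ^ d - goldenRatio ^ d) * hm + (-1) ^ m * hd

/-- The `M`-th iterated forward difference of `f` is divisible by `q ^ e`. -/
def DiffDvd {R : Type*} [CommRing R] (q : R) : ℕ → ℕ → (ℕ → R) → Prop
  | 0, e, f => ∀ z, q ^ e ∣ f z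
  | M + 1, e, f => DiffDvd q M e fun z => f (z + 1) - f z

namespace DiffDvd

variable {R : Type*} [CommRing R] {q : R}

theorem congr {M e : ℕ} {f g : ℕ → R} (hf : DiffDvd q M e f) (h : ∀ z, f z = g z) :
    DiffDvd q M e g := by
  rwa [← funext h]

theorem zero (M e : ℕ) : DiffDvd q M e fun _ => (0 : R) := by
  induction M with
  | zero => exact fun z => dvd_zero _
  | succ M ih => exact ih.congr fun z => by simp

theorem add {M e : ℕ} {f g : ℕ → R} (hf : DiffDvd q M e f) (hg : DiffDvd q M e g) :
    DiffDvd q M e fun z => f z + g z := by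
  induction M generalizing f g with
  | zero => exact fun z => dvd_add (hf z) (hg z)
  | succ M ih => exact (ih hf hg).congr fun z => by ring

theorem const_mul {M e : ℕ} {f : ℕ → R} (c : R) (hf : DiffDvd q M e f) :
    DiffDvd q M e fun z => c * f z := by
  induction M generalizing f with
  | zero => exact fun z => (hf z).mul_left c
  | succ M ih => exact (ih hf).congr fun z => by ring

theorem base_mul {M e : ℕ} {f : ℕ → R} (hf : DiffDvd q M e f) :
    DiffDvd q M (e + 1) fun z => q * f z := by
  induction M generalizing f with
  | zero => exact fun z => by rw [pow_succ']; exact mul_dvd_mul_left q (hf z)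
  | succ M ih => exact (ih hf).congr fun z => by ring

theorem mono {M e e' : ℕ} {f : ℕ → R} (hf : DiffDvd q M e f) (h : e' ≤ e) :
    DiffDvd q M e' f := by
  induction M generalizing f with
  | zero => exact fun z => (pow_dvd_pow q h).trans (hf z)
  | succ M ih => exact ih hf

theorem sum {ι : Type*} (s : Finset ι) {M e : ℕ} {f : ι → ℕ → R}
    (hf : ∀ i ∈ s, DiffDvd q M e (f i)) : DiffDvd q M e fun z => ∑ i ∈ s, f i z := by
  classical
  induction s using Finset.induction_on with
  | empty => simpa using zero M e
  | insert a s ha ih =>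
    simp only [Finset.sum_insert ha]
    exact (hf a (by simp)).add (ih fun i hi => hf i (by simp [hi]))

theorem pow_mul_pow (γ : R) (M k : ℕ) :
    DiffDvd q M (M - k) fun z => (z : R) ^ k * (1 + q * γ) ^ z := by
  induction M generalizing k with
  | zero => intro z; simp
  | succ M ih =>
    have h1 : DiffDvd q M (M + 1 - k) fun z => ∑ i ∈ Finset.range k,
        (k.choose i : R) * ((z : R) ^ i * (1 + q * γ) ^ z) :=
      sum _ fun i hi => ((ih i).const_mul _).mono (by have := Finset.mem_range.1 hi; omega)
    have h2 : DiffDvd q M (M + 1 - k) fun z => γ * ∑ i ∈ Finset.range (k + 1),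
        (k.choose i : R) * (q * ((z : R) ^ i * (1 + q * γ) ^ z)) :=
      (sum _ fun i hi => ((ih i).base_mul.const_mul _).mono
        (by have := Finset.mem_range.1 hi; omega)).const_mul _
    refine (h1.add h2).congr fun z => ?_
    have h3 : ((z + 1 : ℕ) : R) ^ k = ∑ i ∈ Finset.range (k + 1),
        (k.choose i : R) * (z : R) ^ i := by
      push_cast
      rw [add_pow]
      exact Finset.sum_congr rfl fun i _ => by rw [one_pow]; ring
    have h4 : ∑ i ∈ Finset.range k, (k.choose i : R) * (z : R) ^ i = ((z + 1 : ℕ) : R) ^ k -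
        (z : R) ^ k := by
      rw [h3, Finset.sum_range_succ]; simp
    simp only [← mul_assoc, ← Finset.sum_mul]
    rw [h4]
    have h5 : ∑ i ∈ Finset.range (k + 1), (k.choose i : R) * q * (z : R) ^ i = q *
        ((z + 1 : ℕ) : R) ^ k := by
      rw [h3, Finset.mul_sum]
      exact Finset.sum_congr rfl fun i _ => by ring
    rw [h5]
    ring

theorem dvd_of_forall_lt {M e : ℕ} {f : ℕ → R} (hf : DiffDvd q M e f)
    (h : ∀ z < M, q ^ e ∣ f z) (z : ℕ) : q ^ e ∣ f z := by
  induction M generalizing f z with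
  | zero => exact hf z
  | succ M ih =>
    have h1 := ih hf fun z hz => dvd_sub (h _ (by omega)) (h _ (by omega))
    induction z with
    | zero => exact h 0 (by omega)
    | succ z ihz => simpa using dvd_add (h1 z) ihz

end DiffDvd

theorem exists_small_combination_dvd {ι : Type*} [Fintype ι] {M Q X : ℕ} (hQ : 0 < Q)
    (w : Fin M → ι → ZPhi) (h : Q ^ (2 * M) < (X + 1) ^ Fintype.card ι) :
    ∃ p : ι → ℤ, p ≠ 0 ∧ (∀ i, |p i| ≤ X) ∧ ∀ z, (Q : ZPhi) ∣ ∑ i, (p i : ZPhi) * w z i := by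
  classical
  have : NeZero Q := ⟨hQ.ne'⟩
  let S : (ι → Fin (X + 1)) → Fin M → ZPhi := fun p z => ∑ i, ((p i : ℕ) : ZPhi) * w z i
  let g : (ι → Fin (X + 1)) → Fin M → ZMod Q × ZMod Q :=
    fun p z => (((S p z).re : ZMod Q), ((S p z).im : ZMod Q))
  have hcard : Fintype.card (Fin M → ZMod Q × ZMod Q) < Fintype.card (ι → Fin (X + 1)) := by
    simp only [Fintype.card_fun, Fintype.card_prod, ZMod.card, Fintype.card_fin]
    rwa [← pow_two, ← pow_mul]
  obtain ⟨p, p', hne, hpp⟩ := Fintype.exists_ne_map_eq_of_card_lt g hcard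
  refine ⟨fun i => (p i : ℕ) - (p' i : ℕ), ?_, ?_, ?_⟩
  · intro h0
    apply hne
    funext i
    have := congrFun h0 i
    simp only [Pi.zero_apply] at this
    apply Fin.ext
    omega
  · intro i
    have h1 := (p i).is_lt
    have h2 := (p' i).is_lt
    rw [abs_le]
    constructor <;> push_cast <;> omega
  · intro z
    have h1 := congrFun hpp z
    simp only [g, Prod.mk.injEq] at h1
    have h2 : (∑ i, (((p i : ℕ) - (p' i : ℕ) : ℤ) : ZPhi) * w z i) = S p z - S p' z := by
      simp only [S, ← Finset.sum_sub_distrib]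
      exact Finset.sum_congr rfl fun i _ => by push_cast; ring
    rw [h2]
    have h3 := (QuadraticAlgebra.algebraMap_dvd_iff (a := (1 : ℤ)) (b := 1) (r := (Q : ℤ))
      (z := S p z - S p' z)).2 ⟨?_, ?_⟩
    · simpa using h3
    · rw [QuadraticAlgebra.re_sub, ← ZMod.intCast_zmod_eq_zero_iff_dvd _ _, Int.cast_sub, h1.1,
          sub_self]
    · rw [QuadraticAlgebra.im_sub, ← ZMod.intCast_zmod_eq_zero_iff_dvd _ _, Int.cast_sub, h1.2,
          sub_self]

theorem lucas_pos_le (n : ℕ) : 0 < lucas n ∧ lucas n ≤ 2 ^ (n + 1) := by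
  have : ∀ n, (0 < lucas n ∧ lucas n ≤ 2 ^ (n + 1)) ∧
      (0 < lucas (n + 1) ∧ lucas (n + 1) ≤ 2 ^ (n + 1 + 1)) := by
    intro n
    induction n with
    | zero => simp [lucas]
    | succ n ih =>
      refine ⟨ih.2, ?_⟩
      rw [lucas]
      have h1 : (2 : ℤ) ^ (n + 1 + 1) = 2 * 2 ^ (n + 1) := by ring
      have h2 : (2 : ℤ) ^ (n + 1 + 1 + 1) = 4 * 2 ^ (n + 1) := by ring
      omega
  exact (this n).1

theorem abs_lucas_sub_le (m d : ℕ) : |lucas (m + d) - lucas m| ≤ 2 ^ (m + d + 1) := by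
  have h1 := lucas_pos_le m
  have h2 := lucas_pos_le (m + d)
  have h3 : (2 : ℤ) ^ (m + 1) ≤ 2 ^ (m + d + 1) := pow_le_pow_right₀ (by norm_num) (by omega)
  rw [abs_le]
  constructor <;> linarith

open ZPhi

theorem goldenRatio_pow_four_le : goldenRatio ^ 4 ≤ 2 ^ 3 := by
  have h := Real.goldenRatio_sq
  have h2 := Real.goldenRatio_lt_two
  have h3 : goldenRatio < 5 / 3 := by
    rw [goldenRatio, div_lt_iff₀ (by norm_num), ← lt_sub_iff_add_lt', Real.sqrt_lt' (by norm_num)]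
    norm_num
  have : goldenRatio ^ 4 = 3 * goldenRatio + 2 := by
    linear_combination (goldenRatio ^ 2 + goldenRatio + 2) * h
  rw [this]; linarith

/-- The congruence `W^{24Js} F(r + sN) ≡ V` on monomials. -/
theorem monomial_congr {q : ℕ} {m d I J j r s : ℕ} (hj : j ≤ J)
    (h : (q : ZPhi) ^ I ∣ ((lucas (m + d) - lucas m : ℤ) : ZPhi)) :
    (q : ZPhi) ^ I ∣ (phi ^ d - 1) ^ (24 * J * s) * (phi ^ (24 * j)) ^ (r + s * (2 * m + d)) -
      phi ^ (24 * j * r) * (phi ^ d - (-1) ^ d) ^ (24 * j * s) *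
          (phi ^ d - 1) ^ (24 * (J - j) * s) := by
  have h1 : (q : ZPhi) ^ I ∣ phi ^ (2 * m + d) * (phi ^ d - 1) - (-1) ^ m *
      (phi ^ d - (-1) ^ d) := by
    rw [← phi_pow_mul_lucas_sub]; exact h.mul_left _
  have h2 := h1.trans (sub_dvd_pow_sub_pow _ _ (24 * j * s))
  have h3 : ((-1 : ZPhi) ^ m * (phi ^ d - (-1) ^ d)) ^ (24 * j * s) =
      (phi ^ d - (-1) ^ d) ^ (24 * j * s) := by
    rw [mul_pow, ← pow_mul, show m * (24 * j * s) = 2 * (12 * m * j * s) by ring, pow_mul]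
    simp
  rw [h3] at h2
  have h4 := h2.mul_left (phi ^ (24 * j * r) * (phi ^ d - 1) ^ (24 * (J - j) * s))
  refine h4.trans (dvd_of_eq ?_)
  obtain ⟨i, rfl⟩ := Nat.exists_eq_add_of_le hj
  rw [Nat.add_sub_cancel_left, mul_sub]
  congr 1
  · rw [mul_pow]
    rw [show 24 * (j + i) * s = 24 * j * s + 24 * i * s by ring, pow_add _ (24 * j * s), ← pow_mul,
      ← pow_mul, show 24 * j * (r + s * (2 * m + d)) = 24 * j * r + (2 * m + d) *
          (24 * j * s) by ring,
      pow_add]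
    ring
  · ring

theorem abs_goldenConj_le_one : |goldenConj| ≤ 1 :=
  abs_le.2 ⟨Real.neg_one_lt_goldenConj.le, (Real.goldenConj_neg.trans one_pos).le⟩

theorem abs_emb_monomial_le {d J j r s : ℕ} (hj : j ≤ J) :
    |emb (phi ^ (24 * j * r) * (phi ^ d - (-1) ^ d) ^ (24 * j * s) *
      (phi ^ d - 1) ^ (24 * (J - j) * s))| ≤
      goldenRatio ^ (24 * J * r) * (goldenRatio ^ d + 1) ^ (24 * J * s) := by
  have h1 := Real.one_lt_goldenRatio.le
  have h2 : (1 : ℝ) ≤ goldenRatio ^ d := one_le_pow₀ h1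
  simp only [map_mul, map_pow, map_sub, map_neg, map_one, emb_phi, abs_mul, abs_pow]
  rw [mul_assoc, abs_of_nonneg (by linarith : (0 : ℝ) ≤ goldenRatio),
    abs_of_nonneg (by linarith : (0 : ℝ) ≤ goldenRatio ^ d - 1)]
  have h3 : |goldenRatio ^ d - (-1) ^ d| ≤ goldenRatio ^ d + 1 := by
    refine (abs_sub _ _).trans ?_
    rw [abs_pow (-1 : ℝ), abs_neg, abs_one, one_pow, abs_of_nonneg (by linarith)]
  have h4 : 24 * J * s = 24 * j * s + 24 * (J - j) * s := by
    rw [← add_mul, ← mul_add]; congr 2; omega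
  have h5 : 24 * j * r ≤ 24 * J * r := by gcongr
  rw [h4, pow_add]
  gcongr
  · linarith

theorem abs_embConj_monomial_le {d J j r s : ℕ} (hj : j ≤ J) :
    |embConj (phi ^ (24 * j * r) * (phi ^ d - (-1) ^ d) ^ (24 * j * s) *
      (phi ^ d - 1) ^ (24 * (J - j) * s))| ≤ 2 ^ (24 * J * s) := by
  have h1 := abs_goldenConj_le_one
  have h2 : |goldenConj ^ d| ≤ 1 := by rw [abs_pow]; exact pow_le_one₀ (abs_nonneg _) h1
  simp only [map_mul, map_pow, map_sub, map_neg, map_one, embConj_phi, abs_mul, abs_pow]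
  have h3 : |goldenConj ^ d - (-1) ^ d| ≤ 2 := by
    refine (abs_sub _ _).trans ?_
    rw [abs_pow (-1 : ℝ), abs_neg, abs_one, one_pow]; linarith
  have h4 : |goldenConj ^ d - 1| ≤ 2 := by
    refine (abs_sub _ _).trans ?_
    rw [abs_one]; linarith
  have h5 : 24 * J * s = 24 * j * s + 24 * (J - j) * s := by
    rw [← add_mul, ← mul_add]; congr 2; omega
  rw [h5, pow_add, mul_assoc]
  calc _ ≤ 1 * (2 ^ (24 * j * s) * 2 ^ (24 * (J - j) * s) : ℝ) := by
        gcongr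
        exact pow_le_one₀ (abs_nonneg _) h1
    _ = _ := one_mul _

theorem norm_bound {T ℓ J K D N d : ℕ} {q : ℕ} (hq : 9 ≤ q) (hℓ : 2 ≤ ℓ) (hD : D = d + 2)
    (hJ : J = 16 * ℓ) (hK : K = 2 ^ 20 * ℓ * D) (hT : T = 2 ^ 17 * D * ℓ ^ 2)
    (hZ : 2 ^ 13 * ℓ * (N + D) ≤ 2 ^ ℓ) {r s : ℕ} (hr : r ≤ 2 ^ 12 * ℓ * D + J)
        (hs : s ≤ 2 ^ 12 * ℓ) :
    ((K * J : ℕ) * ((q : ℝ) ^ (5 * T) * ((r + s * N : ℕ) ^ K *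
      (goldenRatio ^ (24 * J * r) * (goldenRatio ^ d + 1) ^ (24 * J * s))))) *
    ((K * J : ℕ) * ((q : ℝ) ^ (5 * T) * ((r + s * N : ℕ) ^ K * 2 ^ (24 * J * s)))) <
      ((q : ℝ) ^ (16 * T)) ^ 2 := by
  have hD3 : 2 ≤ D := by omega
  have hT1 : 1 ≤ T := by rw [hT]; exact Nat.one_le_iff_ne_zero.2 (by positivity)
  have hφ := Real.one_lt_goldenRatio.le
  have h1 : ((K * J : ℕ) : ℝ) ≤ 2 ^ T := by
    have h : K * J = 128 * T := by rw [hK, hJ, hT]; ring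
    rw [h]
    have h2 : T = 128 * (2 ^ 10 * D * ℓ ^ 2) := by rw [hT]; ring
    set t := 2 ^ 10 * D * ℓ ^ 2 with ht
    have h3 : 1 ≤ t := Nat.one_le_iff_ne_zero.2 (by positivity)
    have : 128 * T ≤ 2 ^ T := by
      calc 128 * T = 2 ^ 14 * t := by rw [h2]; ring
        _ ≤ 2 ^ 14 * 2 ^ t := by gcongr; exact Nat.lt_two_pow_self.le
        _ = 2 ^ (14 + t) := by ring
        _ ≤ 2 ^ T := Nat.pow_le_pow_right (by norm_num) (by omega)
    exact_mod_cast this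
  have h2 : (((r + s * N : ℕ) : ℝ)) ^ K ≤ 2 ^ (8 * T) := by
    have hz : r + s * N ≤ 2 ^ ℓ := by
      refine le_trans ?_ hZ
      calc r + s * N ≤ 2 ^ 12 * ℓ * D + 16 * ℓ + 2 ^ 12 * ℓ * N := by
            rw [hJ] at hr; gcongr
        _ ≤ 2 ^ 13 * ℓ * (N + D) := by nlinarith [Nat.zero_le (ℓ * N)]
    calc (((r + s * N : ℕ) : ℝ)) ^ K ≤ ((2 ^ ℓ : ℕ) : ℝ) ^ K := by gcongr
      _ = 2 ^ (8 * T) := by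
        push_cast; rw [← pow_mul]; congr 1; rw [hK, hT]; ring
  have h3 : goldenRatio ^ (24 * J * r) ≤ 2 ^ (10 * T) := by
    rw [show 24 * J * r = 4 * (6 * J * r) by ring, pow_mul]
    calc (goldenRatio ^ 4) ^ (6 * J * r) ≤ (2 ^ 3) ^ (6 * J * r) := by
          gcongr; exact goldenRatio_pow_four_le
      _ = 2 ^ (18 * (J * r)) := by rw [← pow_mul]; congr 1; ring
      _ ≤ 2 ^ (10 * T) := by
        refine pow_le_pow_right₀ (by norm_num) ?_
        · have : J * r ≤ 16 * ℓ * (2 ^ 12 * ℓ * D + 16 * ℓ) := by rw [hJ] at *; gcongr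
          rw [hT]
          nlinarith [Nat.zero_le (ℓ ^ 2)]
  have h4 : (goldenRatio ^ d + 1) ^ (24 * J * s) * 2 ^ (24 * J * s) ≤ (2 : ℝ) ^ (12 * T) := by
    rw [← mul_pow]
    have : (goldenRatio ^ d + 1) * 2 ≤ 2 ^ D := by
      have : goldenRatio ^ d ≤ 2 ^ d := by gcongr; exact Real.goldenRatio_lt_two.le
      have h5 : (1 : ℝ) ≤ 2 ^ d := one_le_pow₀ (by norm_num)
      rw [hD, pow_add]; linarith
    calc ((goldenRatio ^ d + 1) * 2) ^ (24 * J * s) ≤ (2 ^ D) ^ (24 * J * s) := by gcongr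
      _ = 2 ^ (24 * D * J * s) := by rw [← pow_mul]; congr 1; ring
      _ ≤ 2 ^ (12 * T) := by
        refine pow_le_pow_right₀ (by norm_num) ?_
        · calc 24 * D * J * s ≤ 24 * D * J * (2 ^ 12 * ℓ) := by gcongr
            _ = 12 * T := by rw [hJ, hT]; ring
  have hq' : (2 : ℝ) ^ 3 ≤ q := by
    have : ((8 : ℕ) : ℝ) ≤ q := by exact_mod_cast (by omega : 8 ≤ q)
    norm_num at this ⊢; exact this
  have hq0 : (0 : ℝ) < q := lt_of_lt_of_le (by norm_num) hq'
  calc _ = ((K * J : ℕ) : ℝ) ^ 2 * (((r + s * N : ℕ) : ℝ) ^ K) ^ 2 * goldenRatio ^ (24 * J * r) *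
        ((goldenRatio ^ d + 1) ^ (24 * J * s) * 2 ^ (24 * J * s)) * (q : ℝ) ^ (10 * T) := by ring
    _ ≤ (2 ^ T) ^ 2 * (2 ^ (8 * T)) ^ 2 * 2 ^ (10 * T) * 2 ^ (12 * T) * (q : ℝ) ^ (10 * T) := by
        gcongr
    _ = 2 ^ (40 * T) * (q : ℝ) ^ (10 * T) := by ring
    _ < 2 ^ (66 * T) * (q : ℝ) ^ (10 * T) := by
        gcongr
        · norm_num
        · omega
    _ = (2 ^ 3) ^ (22 * T) * (q : ℝ) ^ (10 * T) := by rw [← pow_mul]; congr 2; ring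
    _ ≤ (q : ℝ) ^ (22 * T) * (q : ℝ) ^ (10 * T) := by gcongr
    _ = _ := by ring

/-- A lower bound for a `q`-adic linear form in two logarithms. -/
theorem not_pow_dvd_lucas_sub {q m d ℓ : ℕ} (hq : (q : ZPhi) ∣ phi ^ 24 - 1) (hq9 : 9 ≤ q)
    (hd : 1 ≤ d) (hℓ : 2 ≤ ℓ) (hZ : 2 ^ 13 * ℓ * (2 * m + 2 * d + 2) ≤ 2 ^ ℓ)
    (hne : lucas (m + d) ≠ lucas m) :
    ¬ (q : ℤ) ^ (2 ^ 21 * (d + 2) * ℓ ^ 2) ∣ lucas (m + d) - lucas m := by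
  intro hdvd
  obtain ⟨D, hD⟩ : ∃ D, D = d + 2 := ⟨_, rfl⟩
  obtain ⟨T, hT⟩ : ∃ T, T = 2 ^ 17 * D * ℓ ^ 2 := ⟨_, rfl⟩
  obtain ⟨J, hJ⟩ : ∃ J, J = 16 * ℓ := ⟨_, rfl⟩
  obtain ⟨K, hK⟩ : ∃ K, K = 2 ^ 20 * ℓ * D := ⟨_, rfl⟩
  obtain ⟨N, hN⟩ : ∃ N, N = 2 * m + d := ⟨_, rfl⟩
  have hI : 2 ^ 21 * (d + 2) * ℓ ^ 2 = 16 * T := by rw [hT, hD]; ring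
  rw [hI] at hdvd
  have hT1 : 1 ≤ T := by rw [hT, hD]; exact Nat.one_le_iff_ne_zero.2 (by positivity)
  have hq2 : 2 ≤ q := by omega
  -- the trivial case
  by_cases hR : N < 2 ^ 12 * ℓ * D
  · have h1 := Int.le_of_dvd (abs_pos.2 (sub_ne_zero.2 hne)) ((dvd_abs _ _).2 hdvd)
    have h2 := abs_lucas_sub_le m d
    have h3 : (2 : ℤ) ^ (m + d + 1) ≤ 2 ^ (2 ^ 12 * ℓ * D) :=
      pow_le_pow_right₀ (by norm_num) (by omega)
    have h4 : (2 : ℤ) ^ (2 ^ 12 * ℓ * D) < 2 ^ (16 * T) := by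
      refine pow_lt_pow_right₀ (by norm_num) ?_
      rw [hT]
      have : 0 < ℓ * D := by rw [hD]; positivity
      nlinarith
    have h5 : (2 : ℤ) ^ (16 * T) ≤ (q : ℤ) ^ (16 * T) := by
      gcongr; exact_mod_cast hq2
    linarith
  push Not at hR
  have hdvd' : (q : ZPhi) ^ (16 * T) ∣ ((lucas (m + d) - lucas m : ℤ) : ZPhi) := by
    have := map_dvd (Int.castRingHom ZPhi) hdvd
    simpa using this
  -- the auxiliary function
  obtain ⟨p, hp0, hpX, hpF⟩ := exists_small_combination_dvd (ι := Fin K × Fin J)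
    (M := K + 16 * T) (Q := q ^ (16 * T)) (X := q ^ (5 * T)) (by positivity)
    (fun z kj => ((z : ℕ) : ZPhi) ^ (kj.1 : ℕ) * (phi ^ (24 * (kj.2 : ℕ))) ^ (z : ℕ)) (by
      have hK4 : K ≤ 4 * T := by
        rw [hK, hT]; nlinarith [Nat.zero_le (ℓ * D)]
      have hKJ : Fintype.card (Fin K × Fin J) = 128 * T := by
        rw [Fintype.card_prod, Fintype.card_fin, Fintype.card_fin, hK, hJ, hT]; ring
      rw [hKJ, ← pow_mul]
      calc q ^ (16 * T * (2 * (K + 16 * T))) ≤ q ^ (16 * T * (2 * (4 * T + 16 * T))) := by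
            gcongr; omega
        _ = (q ^ (5 * T)) ^ (128 * T) := by rw [← pow_mul]; congr 1; ring
        _ < (q ^ (5 * T) + 1) ^ (128 * T) := by gcongr <;> omega)
  set F : ℕ → ZPhi := fun z => ∑ kj : Fin K × Fin J,
    (p kj : ZPhi) * ((z : ZPhi) ^ (kj.1 : ℕ) * (phi ^ (24 * (kj.2 : ℕ))) ^ z) with hF
  have hFall : ∀ z, (q : ZPhi) ^ (16 * T) ∣ F z := by
    refine DiffDvd.dvd_of_forall_lt (M := K + 16 * T)
      (DiffDvd.sum _ fun kj _ => DiffDvd.const_mul _ ?_) fun z hz => ?_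
    · obtain ⟨γ, hγ⟩ : (q : ZPhi) ∣ phi ^ (24 * (kj.2 : ℕ)) - 1 := by
        refine hq.trans ?_
        rw [pow_mul]
        exact sub_one_dvd_pow_sub_one _ _
      rw [sub_eq_iff_eq_add'.1 hγ]
      exact (DiffDvd.pow_mul_pow γ _ _).mono (by have := kj.1.is_lt; omega)
    · have := hpF ⟨z, hz⟩
      simpa using this
  -- the auxiliary function vanishes on the relevant points
  set V : ℕ → ℕ → ZPhi := fun r s => ∑ kj : Fin K × Fin J,
    (p kj : ZPhi) * (((r + s * N : ℕ) : ZPhi) ^ (kj.1 : ℕ) * (phi ^ (24 * (kj.2 : ℕ) * r) *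
      (phi ^ d - (-1) ^ d) ^ (24 * (kj.2 : ℕ) * s) * (phi ^ d - 1) ^ (24 * (J - (kj.2 : ℕ)) * s)))
          with hV
  have hVdvd : ∀ r s, (q : ZPhi) ^ (16 * T) ∣ V r s := by
    intro r s
    have h1 := (hFall (r + s * N)).mul_left ((phi ^ d - 1) ^ (24 * J * s))
    refine (dvd_iff_dvd_of_dvd_sub ?_).1 h1
    simp only [hF, hV, Finset.mul_sum, ← Finset.sum_sub_distrib]
    refine Finset.dvd_sum fun kj _ => ?_
    have h2 := (monomial_congr (r := r) (s := s) kj.2.is_lt.le hdvd').mul_left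
      ((p kj : ZPhi) * ((r + s * N : ℕ) : ZPhi) ^ (kj.1 : ℕ))
    rw [← hN] at h2
    refine h2.trans (dvd_of_eq ?_)
    ring
  have hVbound : ∀ (f : ZPhi →+* ℝ) (A : ℝ) (r s : ℕ), 1 ≤ r + s * N →
      (∀ j : Fin J, |f (phi ^ (24 * (j : ℕ) * r) *
      (phi ^ d - (-1) ^ d) ^ (24 * (j : ℕ) * s) * (phi ^ d - 1) ^ (24 * (J - (j : ℕ)) * s))| ≤ A) →
      |f (V r s)| ≤ (K * J : ℕ) * ((q : ℝ) ^ (5 * T) * ((r + s * N : ℕ) ^ K * A)) := by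
    intro f A r s hz hA
    simp only [hV, map_sum]
    refine (Finset.abs_sum_le_sum_abs _ _).trans ?_
    refine (Finset.sum_le_card_nsmul _ _
      ((q : ℝ) ^ (5 * T) * ((r + s * N : ℕ) ^ K * A)) fun kj _ => ?_).trans (le_of_eq ?_)
    · rw [map_mul, map_mul, abs_mul, abs_mul, map_intCast, map_pow, map_natCast, abs_pow,
          Nat.abs_cast]
      have h1 : |(p kj : ℝ)| ≤ (q : ℝ) ^ (5 * T) := by exact_mod_cast hpX kj
      have h2 : (((r + s * N : ℕ)) : ℝ) ^ (kj.1 : ℕ) ≤ ((r + s * N : ℕ) : ℝ) ^ K :=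
        pow_le_pow_right₀ (by exact_mod_cast hz) kj.1.is_lt.le
      gcongr
      exact hA kj.2
    · rw [nsmul_eq_mul, Finset.card_univ, Fintype.card_prod, Fintype.card_fin, Fintype.card_fin]
  have hV0 : ∀ r s, r ≤ 2 ^ 12 * ℓ * D + J → s ≤ 2 ^ 12 * ℓ → 1 ≤ r + s * N → V r s = 0 := by
    intro r s hr hs hz
    by_contra hne0
    have h1 := pow_sq_le_of_dvd hne0 (q := q ^ (16 * T)) (by simpa using hVdvd r s)
    have h2 := hVbound emb _ r s hz fun j => abs_emb_monomial_le j.is_lt.le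
    have h3 := hVbound embConj _ r s hz fun j => abs_embConj_monomial_le j.is_lt.le
    have h4 := norm_bound hq9 hℓ hD hJ hK hT
      (N := N) (by rw [hN, hD]; convert hZ using 2; ring) hr hs
    have h5 := mul_le_mul h2 h3 (abs_nonneg _) ((abs_nonneg _).trans h2)
    push_cast at h1 h4 h5
    linarith
  -- the zero estimate
  have hφ0 := Real.goldenRatio_pos
  have hφ1 := Real.one_lt_goldenRatio
  have hW : 0 < goldenRatio ^ d - 1 := by
    have := one_lt_pow₀ hφ1 (by omega : d ≠ 0)
    linarith
  have hp := zero_estimate_coeff (fun kj => (p kj : ℝ)) (fun i : Fin J => ((i : ℕ) + 1 : ℝ))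
    (fun i => goldenRatio ^ (24 * ((i : ℕ) + 1)))
    (fun i i' h => by
      have := (pow_right_injective₀ hφ0 hφ1.ne' h : _)
      exact Fin.ext (by omega))
    (Finset.range (2 ^ 12 * ℓ * D) ×ˢ Finset.range (2 ^ 12 * ℓ))
    (fun e => ((e.1 + e.2 * N : ℕ) : ℝ))
    (fun e => goldenRatio ^ (24 * e.1) *
      ((goldenRatio ^ d - (-1) ^ d) / (goldenRatio ^ d - 1)) ^ (24 * e.2))
    (by
      rintro ⟨r, s⟩ h1 ⟨r', s'⟩ h2 h
      simp only [Finset.coe_product, Finset.coe_range, Set.mem_prod, Set.mem_Iio] at h1 h2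
      simp only [Nat.cast_inj] at h
      have hN0 : 0 < N := by omega
      have e1 := congrArg (· % N) h
      have e2 := congrArg (· / N) h
      simp only [Nat.add_mul_mod_self_right, Nat.add_mul_div_right _ _ hN0,
        Nat.mod_eq_of_lt (by omega : r < N), Nat.mod_eq_of_lt (by omega : r' < N),
        Nat.div_eq_of_lt (by omega : r < N), Nat.div_eq_of_lt (by omega : r' < N)] at e1 e2
      simp only [Prod.mk.injEq]; omega)
    (by
      intro e _
      have : goldenRatio ^ d - (-1) ^ d ≠ 0 := by
        rcases neg_one_pow_eq_or ℝ d with h | h <;> rw [h] <;> [exact hW.ne'; linarith]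
      positivity)
    (by
      rw [Finset.card_product, Finset.card_range, Finset.card_range, hK, hJ]
      exact le_of_eq (by ring))
    (by
      rintro ⟨r, s⟩ he i
      simp only [Finset.mem_product, Finset.mem_range] at he
      have h0 := congrArg emb (hV0 (r + (i + 1)) s (by have := i.is_lt; omega) he.2.le (by omega))
      simp only [hV, map_sum, map_zero] at h0
      have hW' : (goldenRatio ^ d - 1) ^ (24 * J * s) ≠ 0 := by positivity
      rw [← mul_right_inj' hW', mul_zero, ← h0, Finset.mul_sum]
      refine Finset.sum_congr rfl fun kj _ => ?_
      simp only [map_mul, map_pow, map_sub, map_neg, map_one, emb_phi, map_intCast, map_natCast]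
      have h4 : 24 * J * s = 24 * (kj.2 : ℕ) * s + 24 * (J - (kj.2 : ℕ)) * s := by
        rw [← add_mul, ← mul_add]; congr 2; have := kj.2.is_lt; omega
      have hW1 := hW.ne'
      generalize goldenRatio = g at *
      rw [h4, pow_add, mul_pow, mul_pow, div_pow, div_pow, ← pow_mul, ← pow_mul, ← pow_mul,
          ← pow_mul]
      rw [show 24 * s * (kj.2 : ℕ) = 24 * (kj.2 : ℕ) * s by ring]
      push_cast
      field_simp
      ring)
  apply hp0
  funext kj
  have := congrFun hp kj
  simpa using this

theorem exp_sub_sum_range_le {y t : ℝ} (hy : 0 ≤ y) (ht : 1 ≤ t) (M : ℕ) :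
    Real.exp y - ∑ i ∈ Finset.range M, y ^ i / i.factorial ≤ Real.exp (t * y) / t ^ M := by
  have h : ∀ x : ℝ, HasSum (fun n : ℕ => x ^ n / n.factorial) (Real.exp x) := fun x => by
    rw [Real.exp_eq_exp_ℝ]; exact NormedSpace.expSeries_div_hasSum_exp x
  have h1 := (h y).summable.sum_add_tsum_nat_add M
  have h2 := (h (t * y)).summable.sum_add_tsum_nat_add M
  rw [(h y).tsum_eq] at h1
  rw [(h (t * y)).tsum_eq] at h2
  have h3 : 0 ≤ ∑ i ∈ Finset.range M, (t * y) ^ i / i.factorial :=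
    Finset.sum_nonneg fun i _ => by positivity
  have s1 := (summable_nat_add_iff M).2 (h y).summable
  have s2 := (summable_nat_add_iff M).2 (h (t * y)).summable
  rw [le_div_iff₀ (by positivity), ← h1, add_sub_cancel_left, ← tsum_mul_right]
  refine le_trans (Summable.tsum_le_tsum (fun i => ?_) (s1.mul_right _) s2) (by linarith)
  rw [mul_pow, div_mul_eq_mul_div, mul_comm, pow_add t]
  have : (1 : ℝ) ≤ t ^ i := one_le_pow₀ ht
  gcongr
  have h0 : 0 ≤ t ^ M := by positivity
  nlinarith

theorem abs_exp_sub_sum_range_le {y t : ℝ} (ht : 1 ≤ t) (M : ℕ) :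
    |Real.exp y - ∑ i ∈ Finset.range M, y ^ i / i.factorial| ≤ Real.exp (t * |y|) / t ^ M := by
  have h := Complex.norm_exp_sub_sum_le_exp_norm_sub_sum y M
  rw [Complex.norm_real, Real.norm_eq_abs] at h
  refine le_trans (le_of_eq ?_) (h.trans (exp_sub_sum_range_le (abs_nonneg y) ht M))
  rw [← Real.norm_eq_abs, ← Complex.norm_real]
  push_cast
  rfl

theorem exists_small_combination {ι : Type*} [Fintype ι] {N X B : ℕ} {ε : ℝ} (hε : 0 < ε)
    (w : Fin N → ι → ℝ) (hw : ∀ n, X * ∑ i, |w n i| ≤ B * ε)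
    (h : (2 * B + 1) ^ N < (X + 1) ^ Fintype.card ι) :
    ∃ p : ι → ℤ, p ≠ 0 ∧ (∀ i, |p i| ≤ X) ∧ ∀ n, |∑ i, (p i : ℝ) * w n i| ≤ ε := by
  classical
  let S : (ι → Fin (X + 1)) → Fin N → ℝ := fun p n => ∑ i, ((p i : ℕ) : ℝ) * w n i
  let g : (ι → Fin (X + 1)) → Fin N → ℤ := fun p n => ⌊S p n / ε⌋
  have hmaps : ∀ p ∈ (Finset.univ : Finset (ι → Fin (X + 1))),
      g p ∈ Fintype.piFinset fun _ : Fin N => Finset.Icc (-B : ℤ) B := by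
    intro p _
    rw [Fintype.mem_piFinset]
    intro n
    have h1 : |S p n| ≤ B * ε := by
      refine (Finset.abs_sum_le_sum_abs _ _).trans (le_trans ?_ (hw n))
      rw [Finset.mul_sum]
      refine Finset.sum_le_sum fun i _ => ?_
      rw [abs_mul, Nat.abs_cast]
      gcongr
      exact_mod_cast (p i).is_le
    rw [abs_le] at h1
    rw [Finset.mem_Icc]
    constructor
    · rw [Int.le_floor, le_div_iff₀ hε]; push_cast; linarith
    · have : (⌊S p n / ε⌋ : ℝ) ≤ B := (Int.floor_le _).trans (by rw [div_le_iff₀ hε]; linarith)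
      exact_mod_cast this
  have hcard : (Fintype.piFinset fun _ : Fin N => Finset.Icc (-B : ℤ) B).card <
      (Finset.univ : Finset (ι → Fin (X + 1))).card := by
    rw [Fintype.card_piFinset_const, Int.card_Icc, Finset.card_univ, Fintype.card_fun,
      Fintype.card_fin]
    convert h using 2
    omega
  obtain ⟨p, -, p', -, hne, hpp⟩ := Finset.exists_ne_map_eq_of_card_lt_of_maps_to hcard hmaps
  refine ⟨fun i => (p i : ℕ) - (p' i : ℕ), ?_, ?_, ?_⟩
  · intro h0
    apply hne
    funext i
    have := congrFun h0 i
    simp only [Pi.zero_apply] at this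
    apply Fin.ext
    omega
  · intro i
    have h1 := (p i).is_lt
    have h2 := (p' i).is_lt
    rw [abs_le]
    constructor <;> push_cast <;> omega
  · intro n
    have h1 := Int.abs_sub_lt_one_of_floor_eq_floor (congrFun hpp n)
    have h2 : (∑ i, (((p i : ℕ) - (p' i : ℕ) : ℤ) : ℝ) * w n i) = S p n - S p' n := by
      simp only [S, ← Finset.sum_sub_distrib]
      exact Finset.sum_congr rfl fun i _ => by push_cast; ring
    rw [h2]
    rw [← sub_div, abs_div, abs_of_pos hε, div_lt_one hε] at h1
    exact h1.le

/-- An exponential polynomial with small coefficients at the origin and moderate size at every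
point of a large disc. -/
theorem exists_small_exp_poly {J K M X B : ℕ} {ε lam Z : ℝ} (hε : 0 < ε) (hZ : 1 ≤ Z)
    (hB : X * ((K * J : ℕ) * (Z ^ K * Real.exp (J * |lam| * Z))) ≤ B * ε)
    (h : (2 * B + 1) ^ (M + K) < (X + 1) ^ (K * J)) :
    ∃ p : Fin K × Fin J → ℤ, p ≠ 0 ∧ (∀ i, |p i| ≤ X) ∧ ∀ z : ℝ, |z| ≤ Z →
      |∑ kj, (p kj : ℝ) * (z ^ (kj.1 : ℕ) * Real.exp ((kj.2 : ℕ) * lam * z))| ≤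
        (M + K : ℕ) * ε +
          (K * J : ℕ) * (X * (Z ^ K * (Real.exp (8 * (J * |lam| * Z)) / 8 ^ M))) := by
  have hZ0 : 0 < Z := by linarith
  set w : Fin (M + K) → Fin K × Fin J → ℝ := fun m kj => ∑ i ∈ Finset.range M,
    if (kj.1 : ℕ) + i = m then ((kj.2 : ℕ) * lam) ^ i / i.factorial * Z ^ ((kj.1 : ℕ) + i) else 0
    with hw
  have hwb : ∀ m kj, |w m kj| ≤ Z ^ K * Real.exp (J * |lam| * Z) := by
    intro m kj
    calc |w m kj| ≤ ∑ i ∈ Finset.range M, Z ^ K * ((J * |lam| * Z) ^ i / i.factorial) := by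
          refine (Finset.abs_sum_le_sum_abs _ _).trans (Finset.sum_le_sum fun i _ => ?_)
          split_ifs
          · rw [abs_mul, abs_div, abs_pow, abs_mul, Nat.abs_cast, Nat.abs_cast, abs_pow,
              abs_of_pos hZ0, pow_add, mul_pow _ Z]
            have h1 : Z ^ (kj.1 : ℕ) ≤ Z ^ K := pow_le_pow_right₀ hZ kj.1.is_lt.le
            have h2 : ((kj.2 : ℕ) : ℝ) ≤ J := by exact_mod_cast kj.2.is_lt.le
            calc (((kj.2 : ℕ) : ℝ) * |lam|) ^ i / i.factorial * (Z ^ (kj.1 : ℕ) * Z ^ i)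
                ≤ (J * |lam|) ^ i / i.factorial * (Z ^ K * Z ^ i) := by gcongr
              _ = _ := by ring
          · rw [abs_zero]; positivity
      _ ≤ _ := by
          rw [← Finset.mul_sum]
          gcongr
          exact Real.sum_le_exp_of_nonneg (by positivity) _
  obtain ⟨p, hp0, hpX, hpw⟩ := exists_small_combination (ι := Fin K × Fin J) (B := B) (X := X)
    hε w (fun m => by
      refine le_trans ?_ hB
      gcongr
      refine (Finset.sum_le_card_nsmul _ _ _ fun kj _ => hwb m kj).trans (le_of_eq ?_)
      rw [nsmul_eq_mul, Finset.card_univ, Fintype.card_prod, Fintype.card_fin, Fintype.card_fin])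
    (by rwa [Fintype.card_prod, Fintype.card_fin, Fintype.card_fin])
  refine ⟨p, hp0, hpX, fun z hz => ?_⟩
  have hmain : ∑ m : Fin (M + K), (∑ kj, (p kj : ℝ) * w m kj) * (z / Z) ^ (m : ℕ) =
      ∑ kj : Fin K × Fin J, (p kj : ℝ) * (z ^ (kj.1 : ℕ) *
        ∑ i ∈ Finset.range M, ((kj.2 : ℕ) * lam * z) ^ i / i.factorial) := by
    simp only [Finset.sum_mul]
    rw [Finset.sum_comm]
    refine Finset.sum_congr rfl fun kj _ => ?_
    simp only [mul_assoc, ← Finset.mul_sum]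
    congr 1
    simp only [hw, Finset.sum_mul, Finset.mul_sum]
    rw [Finset.sum_comm]
    refine Finset.sum_congr rfl fun i hi => ?_
    have hlt : (kj.1 : ℕ) + i < M + K := by
      have := kj.1.is_lt; have := Finset.mem_range.1 hi; omega
    rw [Finset.sum_eq_single (⟨(kj.1 : ℕ) + i, hlt⟩ : Fin (M + K))]
    · rw [if_pos rfl]
      simp only []
      rw [div_pow, mul_assoc, mul_div_cancel₀ _ (by positivity), pow_add]
      ring
    · intro b _ hb
      rw [if_neg (fun h => hb (Fin.ext h.symm)), zero_mul]
    · simp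
  have hsplit : ∑ kj, (p kj : ℝ) * (z ^ (kj.1 : ℕ) * Real.exp ((kj.2 : ℕ) * lam * z)) =
      ∑ m : Fin (M + K), (∑ kj, (p kj : ℝ) * w m kj) * (z / Z) ^ (m : ℕ) +
      ∑ kj : Fin K × Fin J, (p kj : ℝ) * (z ^ (kj.1 : ℕ) * (Real.exp ((kj.2 : ℕ) * lam * z) -
        ∑ i ∈ Finset.range M, ((kj.2 : ℕ) * lam * z) ^ i / i.factorial)) := by
    rw [hmain, ← Finset.sum_add_distrib]
    exact Finset.sum_congr rfl fun kj _ => by ring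
  rw [hsplit]
  refine (abs_add_le _ _).trans (add_le_add ?_ ?_)
  · refine (Finset.abs_sum_le_sum_abs _ _).trans ?_
    refine (Finset.sum_le_card_nsmul _ _ ε fun m _ => ?_).trans (le_of_eq (by simp))
    rw [abs_mul, abs_pow, abs_div, abs_of_pos hZ0]
    have h1 : |z| / Z ≤ 1 := (div_le_one hZ0).2 hz
    calc _ ≤ ε * 1 := mul_le_mul (hpw m) (pow_le_one₀ (by positivity) h1) (by positivity) hε.le
      _ = ε := mul_one ε
  · refine (Finset.abs_sum_le_sum_abs _ _).trans ?_
    refine (Finset.sum_le_card_nsmul _ _ (X * (Z ^ K * (Real.exp (8 * (J * |lam| * Z)) / 8 ^ M)))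
      fun kj _ => ?_).trans (le_of_eq ?_)
    · rw [abs_mul, abs_mul, abs_pow]
      have h1 : |(p kj : ℝ)| ≤ X := by exact_mod_cast hpX kj
      have h2 : |z| ^ (kj.1 : ℕ) ≤ Z ^ K :=
        (pow_le_pow_left₀ (abs_nonneg _) hz _).trans (pow_le_pow_right₀ hZ kj.1.is_lt.le)
      have h3 : |((kj.2 : ℕ) : ℝ) * lam * z| ≤ J * |lam| * Z := by
        rw [abs_mul, abs_mul, Nat.abs_cast]
        have : ((kj.2 : ℕ) : ℝ) ≤ J := by exact_mod_cast kj.2.is_lt.le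
        gcongr
      have h4 := abs_exp_sub_sum_range_le (y := ((kj.2 : ℕ) : ℝ) * lam * z) (t := 8) (by norm_num) M
      have h5 := h4.trans (div_le_div_of_nonneg_right (Real.exp_le_exp.2
        (mul_le_mul_of_nonneg_left h3 (by norm_num : (0 : ℝ) ≤ 8))) (by positivity))
      gcongr
    · rw [nsmul_eq_mul, Finset.card_univ, Fintype.card_prod, Fintype.card_fin, Fintype.card_fin]

theorem abs_emb_div_bounds {f : ZPhi →+* ℝ} (hf : f = emb) {a b : ZPhi} {h : ℕ} (ha : a ≠ 0)
    (hb : b ≠ 0)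
    (ha1 : |emb a| ≤ 2 ^ h) (ha2 : |embConj a| ≤ 2 ^ h) (hb1 : |emb b| ≤ 2 ^ h)
    (hb2 : |embConj b| ≤ 2 ^ h) : |Real.log (f a / f b)| ≤ 2 * h * Real.log 2 := by
  subst hf
  have key : ∀ x : ZPhi, x ≠ 0 → |emb x| ≤ 2 ^ h → |embConj x| ≤ 2 ^ h →
      |Real.log (emb x)| ≤ h * Real.log 2 := by
    intro x hx h1 h2
    have h3 := one_le_abs_mul hx
    have h0 : 0 < |emb x| := by
      rcases (abs_nonneg (emb x)).eq_or_lt with h | h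
      · rw [← h, zero_mul] at h3; linarith
      · exact h
    rw [← Real.log_abs, abs_le]
    have h4 : (1 : ℝ) ≤ |emb x| * 2 ^ h := h3.trans (by gcongr)
    have h5 := Real.log_le_log one_pos h4
    rw [Real.log_one, Real.log_mul h0.ne' (by positivity), Real.log_pow] at h5
    have h6 := Real.log_le_log h0 h1
    rw [Real.log_pow] at h6
    exact ⟨by linarith, h6⟩
  have h1 := key a ha ha1 ha2
  have h2 := key b hb hb1 hb2
  have ha0 : emb a ≠ 0 := fun h => ha (emb_injective (by simpa using h))
  have hb0 : emb b ≠ 0 := fun h => hb (emb_injective (by simpa using h))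
  rw [Real.log_div ha0 hb0]
  refine (abs_sub _ _).trans ?_
  linarith

theorem count_bound {g K : ℕ} (hg : 2 ≤ g) (hK : K ≤ g) :
    (2 * 2 ^ (19 * g) + 1) ^ (16 * g + K) < (2 ^ (3 * g) + 1) ^ (128 * g) := by
  have e : 2 * 2 ^ (19 * g) + 1 ≤ 2 ^ (20 * g) := by
    have : 2 ^ (20 * g) = 2 ^ (19 * g) * 2 ^ g := by rw [← pow_add]; congr 1; ring
    have h4 : 2 ^ 2 ≤ 2 ^ g := Nat.pow_le_pow_right (by norm_num) hg
    have h5 : 1 ≤ 2 ^ (19 * g) := Nat.one_le_two_pow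
    nlinarith
  calc _ ≤ (2 ^ (20 * g)) ^ (16 * g + K) := Nat.pow_le_pow_left e _
    _ = 2 ^ (20 * g * (16 * g + K)) := (pow_mul _ _ _).symm
    _ ≤ 2 ^ (3 * g * (128 * g)) := Nat.pow_le_pow_right (by norm_num) (by nlinarith)
    _ = (2 ^ (3 * g)) ^ (128 * g) := pow_mul _ _ _
    _ < _ := Nat.pow_lt_pow_left (Nat.lt_succ_self _) (by omega)

set_option maxHeartbeats 2000000 in
/-- A lower bound for a linear form in two logarithms of elements of `ℚ(√5)`. -/
theorem two_log_lower_bound {a₁ b₁ a₂ b₂ : ZPhi} {h₁ h₂ ℓ R S : ℕ} {k₁ k₂ : ℤ}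
    (hh₁ : 1 ≤ h₁) (hh₂ : 1 ≤ h₂) (hℓ : 2 ≤ ℓ)
    (ha₁ : a₁ ≠ 0) (hb₁ : b₁ ≠ 0) (ha₂ : a₂ ≠ 0) (hb₂ : b₂ ≠ 0)
    (hae₁ : |emb a₁| ≤ 2 ^ h₁) (hac₁ : |embConj a₁| ≤ 2 ^ h₁)
    (hbe₁ : |emb b₁| ≤ 2 ^ h₁) (hbc₁ : |embConj b₁| ≤ 2 ^ h₁)
    (hae₂ : |emb a₂| ≤ 2 ^ h₂) (hac₂ : |embConj a₂| ≤ 2 ^ h₂)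
    (hbe₂ : |emb b₂| ≤ 2 ^ h₂) (hbc₂ : |embConj b₂| ≤ 2 ^ h₂)
    (hA₁ : 0 < emb a₁ / emb b₁) (hA₂ : 0 < emb a₂ / emb b₂) (hA : emb a₁ / emb b₁ ≠ 1)
    (hk : IsCoprime k₁ k₂) (hk₂ : k₂ ≠ 0)
    (hbig : 2 ^ 14 * ℓ * h₂ ≤ k₁.natAbs ∨ 2 ^ 14 * ℓ * h₁ ≤ k₂.natAbs)
    (hR : R = 2 ^ 14 * ℓ * h₂ + 64 * ℓ) (hS : S = 2 ^ 14 * ℓ * h₁)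
    (hZ : R * k₂.natAbs + S * k₁.natAbs ≤ 2 ^ ℓ) :
    1 / 2 ^ (20 * (2 ^ 21 * h₁ * h₂ * ℓ ^ 2)) <
      |k₁ * Real.log (emb a₁ / emb b₁) + k₂ * Real.log (emb a₂ / emb b₂)| := by
  by_contra! hΛ
  obtain ⟨g, hg⟩ : ∃ g, g = 2 ^ 21 * h₁ * h₂ * ℓ ^ 2 := ⟨_, rfl⟩
  obtain ⟨J, hJ⟩ : ∃ J, J = 64 * ℓ := ⟨_, rfl⟩
  obtain ⟨K, hK⟩ : ∃ K, K = 2 ^ 22 * ℓ * h₁ * h₂ := ⟨_, rfl⟩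
  obtain ⟨G, hG⟩ : ∃ G, G = J * (R * h₁ + S * h₂) := ⟨_, rfl⟩
  rw [← hg] at hΛ
  have hg1 : 2 ^ 21 ≤ g := by
    rw [hg, mul_assoc, mul_assoc]
    exact Nat.le_mul_of_pos_right _ (by positivity)
  have hKg : K ≤ g := by
    rw [hK, hg]
    calc 2 ^ 22 * ℓ * h₁ * h₂ = 2 ^ 21 * h₁ * h₂ * ℓ * 2 := by ring
      _ ≤ 2 ^ 21 * h₁ * h₂ * ℓ * ℓ := by gcongr
      _ = _ := by ring
  have hKJ : K * J = 128 * g := by rw [hK, hJ, hg]; ring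
  have hlK : ℓ * K = 2 * g := by rw [hK, hg]; ring
  have hGg : 2 * G + 4 ≤ 3 * g := by
    have e1 : G = g + 4096 * ℓ ^ 2 * h₁ := by rw [hG, hJ, hR, hS, hg]; ring
    have e2 : 4096 * ℓ ^ 2 * h₁ * 512 ≤ g := by
      rw [hg]
      calc 4096 * ℓ ^ 2 * h₁ * 512 = 2 ^ 21 * h₁ * 1 * ℓ ^ 2 := by ring
        _ ≤ _ := by gcongr
    omega
  have hJS : 2 * (J * S) ≤ 2 ^ g := by
    have : 2 * (J * S) ≤ 4 * g := by
      rw [hJ, hS, hg]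
      calc 2 * (64 * ℓ * (2 ^ 14 * ℓ * h₁)) = 2 ^ 21 * h₁ * 1 * ℓ ^ 2 := by ring
        _ ≤ 2 ^ 21 * h₁ * h₂ * ℓ ^ 2 := by gcongr
        _ ≤ _ := by omega
    refine this.trans ?_
    obtain ⟨t, rfl⟩ := Nat.exists_eq_add_of_le (show 3 ≤ g by omega)
    have := (Nat.lt_two_pow_self (n := t))
    have e : 2 ^ (3 + t) = 8 * 2 ^ t := by ring
    omega
  have h128 : 128 * g ≤ 2 ^ g := by
    obtain ⟨t, rfl⟩ := Nat.exists_eq_add_of_le (show 8 ≤ g by omega)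
    have := (Nat.lt_two_pow_self (n := t))
    have e : 2 ^ (8 + t) = 256 * 2 ^ t := by ring
    omega
  set A₁ := emb a₁ / emb b₁ with hA₁d
  set A₂ := emb a₂ / emb b₂ with hA₂d
  set Λ := k₁ * Real.log A₁ + k₂ * Real.log A₂ with hΛd
  have hL₁ : |Real.log A₁| ≤ 2 * h₁ * Real.log 2 :=
      abs_emb_div_bounds rfl ha₁ hb₁ hae₁ hac₁ hbe₁ hbc₁
  have hL₂ : |Real.log A₂| ≤ 2 * h₂ * Real.log 2 :=
      abs_emb_div_bounds rfl ha₂ hb₂ hae₂ hac₂ hbe₂ hbc₂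
  have hk₂R : (k₂ : ℝ) ≠ 0 := by exact_mod_cast hk₂
  have hk₂a : (1 : ℝ) ≤ |(k₂ : ℝ)| := by exact_mod_cast Int.one_le_abs hk₂
  set lam := Real.log A₁ / k₂ with hlam
  set Z : ℝ := R * |(k₂ : ℝ)| + S * |(k₁ : ℝ)| with hZd
  have hZl : Z ≤ 2 ^ ℓ := by
    have : ((R * k₂.natAbs + S * k₁.natAbs : ℕ) : ℝ) ≤ ((2 ^ ℓ : ℕ) : ℝ) := by exact_mod_cast hZ
    push_cast [Nat.cast_natAbs] at this
    exact this
  have hR1 : 1 ≤ R := by rw [hR]; exact Nat.one_le_iff_ne_zero.2 (by positivity)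
  have hZ1 : 1 ≤ Z := by
    have : (1 : ℝ) ≤ R := by exact_mod_cast hR1
    have h2 : (0 : ℝ) ≤ S * |(k₁ : ℝ)| := by positivity
    nlinarith
  have hJSΛ : 2 * (J * S) * |Λ| ≤ 1 / 2 ^ (19 * g) := by
    calc 2 * (J * S) * |Λ| ≤ 2 ^ g * (1 / 2 ^ (20 * g)) := by
          gcongr; exact_mod_cast hJS
      _ = 1 / 2 ^ (19 * g) := by
          rw [show 20 * g = g + 19 * g by ring, pow_add]; field_simp
  have hsmall : (1 : ℝ) / 2 ^ (19 * g) ≤ 1 := by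
    rw [div_le_one (by positivity)]; exact one_le_pow₀ (by norm_num)
  have hY : J * |lam| * Z ≤ 2 * G * Real.log 2 + 1 := by
    have e1 : |lam| * Z = R * |Real.log A₁| + S * (|(k₁ : ℝ) * Real.log A₁| / |(k₂ : ℝ)|) := by
      rw [hlam, hZd, abs_div, abs_mul]
      have : |(k₂ : ℝ)| ≠ 0 := by positivity
      field_simp
    have e2 : |(k₁ : ℝ) * Real.log A₁| ≤ |(k₂ : ℝ)| * |Real.log A₂| + |Λ| := by
      rw [← abs_mul, show (k₁ : ℝ) * Real.log A₁ = Λ - k₂ * Real.log A₂ by rw [hΛd]; ring]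
      refine (abs_sub _ _).trans (le_of_eq (by ring))
    have e3 : |(k₁ : ℝ) * Real.log A₁| / |(k₂ : ℝ)| ≤ |Real.log A₂| + |Λ| := by
      rw [div_le_iff₀ (by positivity)]
      nlinarith [abs_nonneg Λ]
    rw [mul_assoc, e1]
    calc J * (R * |Real.log A₁| + S * (|(k₁ : ℝ) * Real.log A₁| / |(k₂ : ℝ)|))
        ≤ J * (R * (2 * h₁ * Real.log 2) + S * (2 * h₂ * Real.log 2 + |Λ|)) := by
          gcongr; exact e3.trans (by linarith)
      _ = 2 * G * Real.log 2 + J * S * |Λ| := by rw [hG]; push_cast; ring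
      _ ≤ _ := by
        have : (0 : ℝ) ≤ J * S * |Λ| := by positivity
        linarith
  have hexpY : Real.exp (J * |lam| * Z) ≤ 2 ^ (3 * g) := by
    calc Real.exp (J * |lam| * Z) ≤ Real.exp (2 * G * Real.log 2 + 1) := Real.exp_le_exp.2 hY
      _ = 2 ^ (2 * G) * Real.exp 1 := by
        rw [Real.exp_add, show 2 * (G : ℝ) * Real.log 2 = Real.log 2 *
            ((2 * G : ℕ) : ℝ) by push_cast; ring,
          ← Real.rpow_def_of_pos (by norm_num), Real.rpow_natCast]
      _ ≤ 2 ^ (2 * G) * 2 ^ 2 := by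
        gcongr
        have := Real.exp_one_lt_d9
        norm_num; linarith
      _ = 2 ^ (2 * G + 2) := by ring
      _ ≤ 2 ^ (3 * g) := pow_le_pow_right₀ (by norm_num) (by omega)
  have hZK : Z ^ K ≤ 2 ^ (2 * g) := by
    calc Z ^ K ≤ (2 ^ ℓ) ^ K := by gcongr
      _ = 2 ^ (2 * g) := by rw [← pow_mul, hlK]
  have hKJ' : ((K * J : ℕ) : ℝ) ≤ 2 ^ g := by rw [hKJ]; exact_mod_cast h128
  -- the auxiliary function
  obtain ⟨p, hp0, hpX, hpF⟩ := exists_small_exp_poly (J := J) (K := K) (M := 16 * g)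
    (X := 2 ^ (3 * g)) (B := 2 ^ (19 * g)) (ε := 1 / 2 ^ (10 * g)) (lam := lam) (Z := Z)
    (by positivity) hZ1
    (by
      push_cast
      calc (2 : ℝ) ^ (3 * g) * (K * J * (Z ^ K * Real.exp (J * |lam| * Z)))
          ≤ 2 ^ (3 * g) * (2 ^ g * (2 ^ (2 * g) * 2 ^ (3 * g))) := by
            gcongr; exact_mod_cast hKJ'
        _ = 2 ^ (19 * g) * (1 / 2 ^ (10 * g)) := by
            rw [show 19 * g = 9 * g + 10 * g by ring, pow_add]; field_simp; ring)
    (by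
      rw [hKJ]
      exact count_bound (le_trans (by norm_num) hg1) hKg)
  have hFsmall : ∀ z : ℝ, |z| ≤ Z →
      |∑ kj, (p kj : ℝ) * (z ^ (kj.1 : ℕ) * Real.exp ((kj.2 : ℕ) * lam * z))| ≤
        2 / 2 ^ (9 * g) := by
    intro z hz
    refine (hpF z hz).trans ?_
    have e1 : ((16 * g + K : ℕ) : ℝ) ≤ 2 ^ g := by
      have : 16 * g + K ≤ 2 ^ g := by omega
      exact_mod_cast this
    have e2 : Real.exp (8 * (J * |lam| * Z)) ≤ 2 ^ (24 * g) := by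
      rw [show (8 : ℝ) * (J * |lam| * Z) = (8 : ℕ) * (J * |lam| * Z) by norm_num, Real.exp_nat_mul]
      calc _ ≤ ((2 : ℝ) ^ (3 * g)) ^ 8 := by gcongr
        _ = _ := by rw [← pow_mul]; congr 1; ring
    calc _ ≤ (2 : ℝ) ^ g * (1 / 2 ^ (10 * g)) +
          2 ^ g * (2 ^ (3 * g) * (2 ^ (2 * g) * (2 ^ (24 * g) / 8 ^ (16 * g)))) := by
          push_cast at hKJ' e1 ⊢
          gcongr
      _ = 1 / 2 ^ (9 * g) + 1 / 2 ^ (18 * g) := by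
          rw [show (8 : ℝ) = 2 ^ 3 by norm_num, ← pow_mul,
              show 3 * (16 * g) = 30 * g + 18 * g by ring,
            show 10 * g = g + 9 * g by ring, pow_add _ (30 * g), pow_add _ g]
          field_simp
          ring
      _ ≤ 1 / 2 ^ (9 * g) + 1 / 2 ^ (9 * g) := by
          gcongr
          · norm_num
          · omega
      _ = _ := by ring
  -- the algebraic values
  set W : ℕ → ℕ → ZPhi := fun r s => ∑ kj : Fin K × Fin J, (p kj : ZPhi) *
    (((r * k₂ - s * k₁ : ℤ) : ZPhi) ^ (kj.1 : ℕ) *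
        (a₁ ^ ((kj.2 : ℕ) * r) * b₁ ^ ((J - (kj.2 : ℕ)) * r) *
      (a₂ ^ ((kj.2 : ℕ) * s) * b₂ ^ ((J - (kj.2 : ℕ)) * s)))) with hW
  have hb₁0 : emb b₁ ≠ 0 := fun h => hb₁ (emb_injective (by simpa using h))
  have hb₂0 : emb b₂ ≠ 0 := fun h => hb₂ (emb_injective (by simpa using h))
  have hemb : ∀ r s, emb (W r s) = emb b₁ ^ (J * r) * emb b₂ ^ (J * s) *
      ∑ kj : Fin K × Fin J, (p kj : ℝ) *
        ((r * k₂ - s * k₁ : ℝ) ^ (kj.1 : ℕ) * (A₁ ^ r * A₂ ^ s) ^ (kj.2 : ℕ)) := by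
    intro r s
    simp only [hW, map_sum, Finset.mul_sum]
    refine Finset.sum_congr rfl fun kj _ => ?_
    obtain ⟨i, hi⟩ := Nat.exists_eq_add_of_le kj.2.is_lt.le
    have hi' : J - (kj.2 : ℕ) = i := by omega
    have hJr : J * r = (kj.2 : ℕ) * r + i * r := by rw [← add_mul, ← hi]
    have hJs : J * s = (kj.2 : ℕ) * s + i * s := by rw [← add_mul, ← hi]
    rw [hi', hJr, hJs, pow_add, pow_add]
    simp only [map_mul, map_pow, map_intCast]
    rw [hA₁d, hA₂d, mul_pow, ← pow_mul, ← pow_mul, div_pow, div_pow, mul_comm r, mul_comm s]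
    push_cast
    field_simp
  have hzb : ∀ r s : ℕ, r ≤ R → s ≤ S → |(r * k₂ - s * k₁ : ℝ)| ≤ Z := by
    intro r s hr hs
    refine (abs_sub _ _).trans ?_
    rw [abs_mul, abs_mul, Nat.abs_cast, Nat.abs_cast, hZd]
    gcongr
  have hGrs : ∀ r s : ℕ, r ≤ R → s ≤ S → h₁ * (J * r) + h₂ * (J * s) ≤ G := by
    intro r s hr hs
    rw [hG]
    calc h₁ * (J * r) + h₂ * (J * s) ≤ h₁ * (J * R) + h₂ * (J * S) := by gcongr
      _ = _ := by ring
  have hconj : ∀ r s : ℕ, r ≤ R → s ≤ S → |embConj (W r s)| ≤ 2 ^ (6 * g + G) := by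
    intro r s hr hs
    simp only [hW, map_sum]
    refine (Finset.abs_sum_le_sum_abs _ _).trans ?_
    refine (Finset.sum_le_card_nsmul _ _ ((2 : ℝ) ^ (3 * g) * (2 ^ (2 * g) * 2 ^ G)) fun kj
        _ => ?_).trans ?_
    · simp only [map_mul, map_pow, map_intCast, abs_mul, abs_pow]
      obtain ⟨i, hi⟩ := Nat.exists_eq_add_of_le kj.2.is_lt.le
      have hi' : J - (kj.2 : ℕ) = i := by omega
      have h1 : |(p kj : ℝ)| ≤ 2 ^ (3 * g) := by exact_mod_cast hpX kj
      have h2 : |((r * k₂ - s * k₁ : ℤ) : ℝ)| ^ (kj.1 : ℕ) ≤ 2 ^ (2 * g) := by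
        refine le_trans ?_ hZK
        push_cast
        exact (pow_le_pow_left₀ (abs_nonneg _) (hzb r s hr hs) _).trans
          (pow_le_pow_right₀ hZ1 kj.1.is_lt.le)
      have h3 : |embConj a₁| ^ ((kj.2 : ℕ) * r) * |embConj b₁| ^ ((J - (kj.2 : ℕ)) * r) *
          (|embConj a₂| ^ ((kj.2 : ℕ) * s) * |embConj b₂| ^ ((J - (kj.2 : ℕ)) * s)) ≤ 2 ^ G := by
        rw [hi']
        calc _ ≤ ((2 : ℝ) ^ h₁) ^ ((kj.2 : ℕ) * r) * (2 ^ h₁) ^ (i * r) *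
              ((2 ^ h₂) ^ ((kj.2 : ℕ) * s) * (2 ^ h₂) ^ (i * s)) := by gcongr
          _ = 2 ^ (h₁ * (((kj.2 : ℕ) + i) * r) + h₂ * (((kj.2 : ℕ) + i) * s)) := by
            rw [← pow_mul, ← pow_mul, ← pow_mul, ← pow_mul, ← pow_add, ← pow_add, ← pow_add]
            congr 1; ring
          _ ≤ 2 ^ G := by
            rw [← hi]
            exact pow_le_pow_right₀ (by norm_num) (hGrs r s hr hs)
      gcongr
    · rw [nsmul_eq_mul, Finset.card_univ, Fintype.card_prod, Fintype.card_fin, Fintype.card_fin]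
      calc _ ≤ (2 : ℝ) ^ g * (2 ^ (3 * g) * (2 ^ (2 * g) * 2 ^ G)) := by gcongr
        _ = _ := by ring
  have hVsmall : ∀ r s : ℕ, r ≤ R → s ≤ S → |∑ kj : Fin K × Fin J, (p kj : ℝ) *
        ((r * k₂ - s * k₁ : ℝ) ^ (kj.1 : ℕ) * (A₁ ^ r * A₂ ^ s) ^ (kj.2 : ℕ))| ≤
            4 / 2 ^ (9 * g) := by
    intro r s hr hs
    set z : ℝ := r * k₂ - s * k₁ with hz
    have hzb' := hzb r s hr hs
    have hexp : ∀ j : ℕ, (A₁ ^ r * A₂ ^ s) ^ j = Real.exp (j * lam * z) *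
        Real.exp (j * s * (Λ / k₂)) := by
      intro j
      rw [← Real.exp_log (pow_pos (mul_pos (pow_pos hA₁ r) (pow_pos hA₂ s)) j), Real.log_pow,
        Real.log_mul (pow_pos hA₁ r).ne' (pow_pos hA₂ s).ne', Real.log_pow, Real.log_pow,
        ← Real.exp_add]
      congr 1
      rw [hlam, hz, hΛd]
      field_simp
      ring
    have hsplit : ∑ kj : Fin K × Fin J, (p kj : ℝ) *
        (z ^ (kj.1 : ℕ) * (A₁ ^ r * A₂ ^ s) ^ (kj.2 : ℕ)) =
        ∑ kj : Fin K × Fin J, (p kj : ℝ) * (z ^ (kj.1 : ℕ) * Real.exp ((kj.2 : ℕ) * lam * z)) +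
        ∑ kj : Fin K × Fin J, (p kj : ℝ) * (z ^ (kj.1 : ℕ) * (Real.exp ((kj.2 : ℕ) * lam * z) *
          (Real.exp ((kj.2 : ℕ) * s * (Λ / k₂)) - 1))) := by
      rw [← Finset.sum_add_distrib]
      exact Finset.sum_congr rfl fun kj _ => by rw [hexp]; ring
    rw [hsplit]
    refine (abs_add_le _ _).trans ?_
    have e2 : |∑ kj : Fin K × Fin J, (p kj : ℝ) * (z ^ (kj.1 : ℕ) *
        (Real.exp ((kj.2 : ℕ) * lam * z) *
          (Real.exp ((kj.2 : ℕ) * s * (Λ / k₂)) - 1)))| ≤ 1 / 2 ^ (9 * g) := by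
      refine (Finset.abs_sum_le_sum_abs _ _).trans ?_
      refine (Finset.sum_le_card_nsmul _ _
        ((2 : ℝ) ^ (3 * g) * (2 ^ (2 * g) * (2 ^ (3 * g) * (1 / 2 ^ (19 * g))))) fun kj
            _ => ?_).trans ?_
      · rw [abs_mul, abs_mul, abs_mul, abs_pow, Real.abs_exp]
        have h1 : |(p kj : ℝ)| ≤ 2 ^ (3 * g) := by exact_mod_cast hpX kj
        have h2 : |z| ^ (kj.1 : ℕ) ≤ 2 ^ (2 * g) :=
          ((pow_le_pow_left₀ (abs_nonneg _) hzb' _).trans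
            (pow_le_pow_right₀ hZ1 kj.1.is_lt.le)).trans hZK
        have hj : ((kj.2 : ℕ) : ℝ) ≤ J := by exact_mod_cast kj.2.is_lt.le
        have h3 : Real.exp ((kj.2 : ℕ) * lam * z) ≤ 2 ^ (3 * g) := by
          refine (Real.exp_le_exp.2 ?_).trans hexpY
          refine (le_abs_self _).trans ?_
          rw [abs_mul, abs_mul, Nat.abs_cast]
          gcongr
        have h4 : |((kj.2 : ℕ) : ℝ) * s * (Λ / k₂)| ≤ J * S * |Λ| := by
          rw [abs_mul, abs_mul, Nat.abs_cast, Nat.abs_cast, abs_div]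
          have : |Λ| / |(k₂ : ℝ)| ≤ |Λ| := div_le_self (abs_nonneg _) hk₂a
          have hs' : (s : ℝ) ≤ S := by exact_mod_cast hs
          gcongr
        have h0 : (0 : ℝ) ≤ J * S * |Λ| := by positivity
        have h5 : |Real.exp ((kj.2 : ℕ) * s * (Λ / k₂)) - 1| ≤ 1 / 2 ^ (19 * g) := by
          refine (Real.abs_exp_sub_one_le (h4.trans (by linarith))).trans ?_
          linarith
        gcongr
      · rw [nsmul_eq_mul, Finset.card_univ, Fintype.card_prod, Fintype.card_fin, Fintype.card_fin]
        calc _ ≤ (2 : ℝ) ^ g * (2 ^ (3 * g) * (2 ^ (2 * g) *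
            (2 ^ (3 * g) * (1 / 2 ^ (19 * g))))) := by gcongr
          _ = 1 / 2 ^ (10 * g) := by
            rw [show 19 * g = 9 * g + 10 * g by ring, pow_add]; field_simp; ring
          _ ≤ 1 / 2 ^ (9 * g) := by
            gcongr
            · norm_num
            · omega
    have e1 := hFsmall z hzb'
    have e3 : (0 : ℝ) ≤ 1 / 2 ^ (9 * g) := by positivity
    have e4 : (4 : ℝ) / 2 ^ (9 * g) = 4 * (1 / 2 ^ (9 * g)) := by ring
    have e5 : (2 : ℝ) / 2 ^ (9 * g) = 2 * (1 / 2 ^ (9 * g)) := by ring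
    rw [e4]; rw [e5] at e1; linarith
  have hW0 : ∀ r s : ℕ, r ≤ R → s ≤ S → W r s = 0 := by
    intro r s hr hs
    by_contra hne
    have h1 := one_le_abs_mul hne
    have h2 := hconj r s hr hs
    have h3 : |emb (W r s)| ≤ 2 ^ G * (4 / 2 ^ (9 * g)) := by
      rw [hemb, abs_mul]
      refine mul_le_mul ?_ (hVsmall r s hr hs) (abs_nonneg _) (by positivity)
      rw [abs_mul, abs_pow, abs_pow]
      calc _ ≤ ((2 : ℝ) ^ h₁) ^ (J * r) * (2 ^ h₂) ^ (J * s) := by gcongr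
        _ = 2 ^ (h₁ * (J * r) + h₂ * (J * s)) := by rw [← pow_mul, ← pow_mul, ← pow_add]
        _ ≤ 2 ^ G := pow_le_pow_right₀ (by norm_num) (hGrs r s hr hs)
    have h4 := h1.trans (mul_le_mul h3 h2 (abs_nonneg _) (by positivity))
    have h5 : (2 : ℝ) ^ G * (4 / 2 ^ (9 * g)) * 2 ^ (6 * g + G) =
        2 ^ (2 * G + 2) / 2 ^ (3 * g) := by
      rw [show 9 * g = 3 * g + 6 * g by ring, pow_add _ (3 * g), pow_add _ (6 * g), pow_add,
          two_mul,
        pow_add]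
      field_simp
      norm_num
    rw [h5, one_le_div (by positivity)] at h4
    have h6 : (2 : ℝ) ^ (2 * G + 2) < 2 ^ (3 * g) := pow_lt_pow_right₀ (by norm_num) (by omega)
    linarith
  -- the zero estimate
  have hp := zero_estimate_coeff (fun kj => (p kj : ℝ)) (fun i : Fin J => ((i : ℕ) * k₂ : ℝ))
    (fun i => A₁ ^ (i : ℕ))
    (fun i i' h => Fin.ext (pow_right_injective₀ hA₁ hA h))
    (Finset.range (2 ^ 14 * ℓ * h₂) ×ˢ Finset.range (2 ^ 14 * ℓ * h₁))
    (fun e => (e.1 * k₂ - e.2 * k₁ : ℝ)) (fun e => A₁ ^ e.1 * A₂ ^ e.2)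
    (by
      rintro ⟨r, s⟩ e1 ⟨r', s'⟩ e2 h
      simp only [Finset.coe_product, Finset.coe_range, Set.mem_prod, Set.mem_Iio] at e1 e2
      have h' : (r : ℤ) * k₂ - s * k₁ = r' * k₂ - s' * k₁ := by
        have : ((r * k₂ - s * k₁ : ℤ) : ℝ) = ((r' * k₂ - s' * k₁ : ℤ) : ℝ) := by
          push_cast; exact h
        exact_mod_cast this
      have d1 : k₁ ∣ (r : ℤ) - r' := by
        refine hk.dvd_of_dvd_mul_right ⟨(s : ℤ) - s', ?_⟩
        linarith
      have d2 : k₂ ∣ (s : ℤ) - s' := by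
        refine hk.symm.dvd_of_dvd_mul_right ⟨(r : ℤ) - r', ?_⟩
        linarith
      have key : r = r' ∨ s = s' := by
        rcases hbig with hb | hb
        · left
          have := Int.eq_zero_of_dvd_of_natAbs_lt_natAbs d1 (by omega)
          omega
        · right
          have := Int.eq_zero_of_dvd_of_natAbs_lt_natAbs d2 (by omega)
          omega
      rcases key with rfl | rfl
      · have e3 : ((s : ℤ) - s') * k₁ = 0 := by linarith
        rcases mul_eq_zero.1 e3 with e4 | e4
        · have e5 : s = s' := by omega
          rw [e5]
        · rw [e4, isCoprime_zero_left, Int.isUnit_iff_natAbs_eq] at hk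
          have e5 : 0 < 2 ^ 14 * ℓ * h₂ := by positivity
          have e6 : 0 < ℓ * h₁ := by positivity
          rw [e4, hk, mul_assoc _ ℓ h₁] at hbig
          rcases hbig with hb | hb
          · exact absurd hb (not_le.2 e5)
          · omega
      · have e3 : ((r : ℤ) - r') * k₂ = 0 := by linarith
        rcases mul_eq_zero.1 e3 with e4 | e4
        · have e5 : r = r' := by omega
          rw [e5]
        · exact absurd e4 hk₂)
    (fun e _ => (mul_pos (pow_pos hA₁ _) (pow_pos hA₂ _)).ne')
    (by
      rw [Finset.card_product, Finset.card_range, Finset.card_range, hKJ, hg]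
      exact le_of_eq (by ring))
    (by
      rintro ⟨r, s⟩ he i
      simp only [Finset.mem_product, Finset.mem_range] at he
      have h0 := congrArg emb (hW0 (r + i) s (by have := i.is_lt; omega) (by omega))
      rw [hemb, map_zero] at h0
      have h1 := (mul_eq_zero.1 h0).resolve_left (mul_ne_zero (pow_ne_zero _ hb₁0)
          (pow_ne_zero _ hb₂0))
      rw [← h1]
      refine Finset.sum_congr rfl fun kj _ => ?_
      simp only []
      push_cast
      rw [pow_add]
      ring)
  apply hp0
  funext kj
  have := congrFun hp kj
  simpa using this

set_option maxHeartbeats 1000000 in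
/-- A short primitive integer vector orthogonal to a given one. -/
theorem exists_primitive_orthogonal {H B : ℕ} (hH : 1 ≤ H) (hHB : H ≤ 3 * B) {x y z : ℤ}
    (hx : |x| ≤ B) (hy : |y| ≤ B) (hz : H * |z| ≤ B) :
    ∃ w₁ w₂ w₃ e₁ e₂ e₃ : ℤ, w₁ * x + w₂ * y + w₃ * z = 0 ∧ w₁ * e₁ + w₂ * e₂ + w₃ * e₃ = 1 ∧
      H ^ 2 * (w₁ ^ 2 + w₂ ^ 2) + w₃ ^ 2 ≤ 9 * H * B := by
  set m := Nat.sqrt (3 * B / H) with hm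
  have hm1 : 1 ≤ m := by
    rw [hm, Nat.le_sqrt]
    simpa using (Nat.one_le_div_iff (by omega)).2 hHB
  have hmB : m * m * H ≤ 3 * B :=
    (Nat.mul_le_mul_right _ (Nat.sqrt_le _)).trans (Nat.div_mul_le_self _ _)
  have hBm : 3 * B < (m + 1) * (m + 1) * H := by
    rw [← Nat.div_lt_iff_lt_mul (by omega)]
    exact Nat.lt_succ_sqrt _
  have hεx : ∀ x : ℤ, ∃ ε : ℤ, ε ^ 2 = 1 ∧ |x| = ε * x := fun x => by
    rcases abs_cases x with h | h
    · exact ⟨1, by norm_num, by rw [h.1, one_mul]⟩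
    · exact ⟨-1, by norm_num, by rw [h.1]; ring⟩
  obtain ⟨εx, hεx1, hεx2⟩ := hεx x
  obtain ⟨εy, hεy1, hεy2⟩ := hεx y
  obtain ⟨εz, hεz1, hεz2⟩ := hεx z
  have hpig : (Finset.range (3 * B * m + 1)).card <
      (Finset.range (m + 1) ×ˢ Finset.range (m + 1) ×ˢ Finset.range (H * m + 1)).card := by
    simp only [Finset.card_product, Finset.card_range]
    nlinarith
  obtain ⟨⟨i, j, k⟩, h1, ⟨i', j', k'⟩, h2, hne, heq⟩ :=
      Finset.exists_ne_map_eq_of_card_lt_of_maps_to hpig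
    (f := fun e => e.1 * x.natAbs + e.2.1 * y.natAbs + e.2.2 * z.natAbs) (by
      rintro ⟨i, j, k⟩ h
      simp only [Finset.coe_product, Finset.coe_range, Set.mem_prod, Set.mem_Iio,
          Nat.lt_succ_iff] at h ⊢
      have hx' : x.natAbs ≤ B := by zify; exact hx
      have hy' : y.natAbs ≤ B := by zify; exact hy
      have hz' : H * z.natAbs ≤ B := by zify; exact hz
      have e1 : i * x.natAbs ≤ m * B := Nat.mul_le_mul h.1 hx'
      have e2 : j * y.natAbs ≤ m * B := Nat.mul_le_mul h.2.1 hy'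
      have e3 : k * z.natAbs ≤ m * B := by
        calc k * z.natAbs ≤ (H * m) * z.natAbs := Nat.mul_le_mul_right _ h.2.2
          _ = m * (H * z.natAbs) := by ring
          _ ≤ m * B := Nat.mul_le_mul_left _ hz'
      linarith)
  simp only [Finset.mem_product, Finset.mem_range, Nat.lt_succ_iff] at h1 h2 heq
  obtain ⟨u₁, hu₁⟩ : ∃ u : ℤ, u = (i - i') * εx := ⟨_, rfl⟩
  obtain ⟨u₂, hu₂⟩ : ∃ u : ℤ, u = (j - j') * εy := ⟨_, rfl⟩
  obtain ⟨u₃, hu₃⟩ : ∃ u : ℤ, u = (k - k') * εz := ⟨_, rfl⟩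
  have horth : u₁ * x + u₂ * y + u₃ * z = 0 := by
    have : ((i * x.natAbs + j * y.natAbs + k * z.natAbs : ℕ) : ℤ) =
        ((i' * x.natAbs + j' * y.natAbs + k' * z.natAbs : ℕ) : ℤ) := by exact_mod_cast heq
    push_cast at this
    rw [hεx2, hεy2, hεz2] at this
    rw [hu₁, hu₂, hu₃]
    linear_combination this
  have s₁ : u₁ ^ 2 = ((i : ℤ) - i') ^ 2 := by rw [hu₁, mul_pow, hεx1, mul_one]
  have s₂ : u₂ ^ 2 = ((j : ℤ) - j') ^ 2 := by rw [hu₂, mul_pow, hεy1, mul_one]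
  have s₃ : u₃ ^ 2 = ((k : ℤ) - k') ^ 2 := by rw [hu₃, mul_pow, hεz1, mul_one]
  have q₁ : u₁ ^ 2 ≤ (m : ℤ) ^ 2 := by
    rw [s₁]; exact sq_le_sq' (by omega) (by omega)
  have q₂ : u₂ ^ 2 ≤ (m : ℤ) ^ 2 := by
    rw [s₂]; exact sq_le_sq' (by omega) (by omega)
  have q₃ : u₃ ^ 2 ≤ ((H * m : ℕ) : ℤ) ^ 2 := by
    rw [s₃]; exact sq_le_sq' (by omega) (by omega)
  have hsize : (H : ℤ) ^ 2 * (u₁ ^ 2 + u₂ ^ 2) + u₃ ^ 2 ≤ 9 * H * B := by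
    have e1 : (H : ℤ) ^ 2 * (u₁ ^ 2 + u₂ ^ 2) ≤ H ^ 2 * (m ^ 2 + m ^ 2) := by gcongr
    have e2 : (m : ℤ) * m * H ≤ 3 * B := by exact_mod_cast hmB
    have e3 : (H : ℤ) * (m * m * H) ≤ H * (3 * B) := by gcongr
    push_cast at q₃
    calc _ ≤ (H : ℤ) ^ 2 * (m ^ 2 + m ^ 2) + (H * m) ^ 2 := add_le_add e1 q₃
      _ = 3 * (H * (m * m * H)) := by ring
      _ ≤ 3 * (H * (3 * B)) := by linarith
      _ = _ := by ring
  have hu0 : ¬ (u₁ = 0 ∧ u₂ = 0 ∧ u₃ = 0) := by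
    rintro ⟨z1, z2, z3⟩
    rw [z1] at s₁; rw [z2] at s₂; rw [z3] at s₃
    have t1 := pow_eq_zero_iff (two_ne_zero) |>.1 (s₁.symm.trans (by norm_num))
    have t2 := pow_eq_zero_iff (two_ne_zero) |>.1 (s₂.symm.trans (by norm_num))
    have t3 := pow_eq_zero_iff (two_ne_zero) |>.1 (s₃.symm.trans (by norm_num))
    apply hne
    simp only [Prod.mk.injEq]
    omega
  -- divide by the content
  obtain ⟨g, hg⟩ : ∃ g : ℤ, g = Int.gcd (Int.gcd u₁ u₂) u₃ := ⟨_, rfl⟩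
  have hgpos : 0 < g := by
    rw [hg]
    have : Int.gcd (Int.gcd u₁ u₂) u₃ ≠ 0 := by
      rw [Ne, Int.gcd_eq_zero_iff]
      rintro ⟨t1, t2⟩
      have t1' : Int.gcd u₁ u₂ = 0 := by exact_mod_cast t1
      rw [Int.gcd_eq_zero_iff] at t1'
      exact hu0 ⟨t1'.1, t1'.2, t2⟩
    omega
  have d12 : g ∣ (Int.gcd u₁ u₂ : ℤ) := hg ▸ Int.gcd_dvd_left _ _
  obtain ⟨w₁, hw₁⟩ := d12.trans (Int.gcd_dvd_left u₁ u₂)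
  obtain ⟨w₂, hw₂⟩ := d12.trans (Int.gcd_dvd_right u₁ u₂)
  obtain ⟨w₃, hw₃⟩ : g ∣ u₃ := hg ▸ Int.gcd_dvd_right _ _
  have b1 := Int.gcd_eq_gcd_ab (Int.gcd u₁ u₂ : ℤ) u₃
  have b2 := Int.gcd_eq_gcd_ab u₁ u₂
  rw [← hg] at b1
  generalize Int.gcdA (Int.gcd u₁ u₂ : ℤ) u₃ = r at b1
  generalize Int.gcdB (Int.gcd u₁ u₂ : ℤ) u₃ = s at b1
  generalize Int.gcdA u₁ u₂ = p at b2
  generalize Int.gcdB u₁ u₂ = q at b2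
  rw [b2] at b1
  refine ⟨w₁, w₂, w₃, p * r, q * r, s, ?_, ?_, ?_⟩
  · apply mul_left_cancel₀ hgpos.ne'
    rw [mul_zero, ← horth, hw₁, hw₂, hw₃]
    ring
  · apply mul_left_cancel₀ hgpos.ne'
    linear_combination (-(p * r)) * hw₁ - (q * r) * hw₂ - s * hw₃ - b1
  · refine le_trans ?_ hsize
    rw [hw₁, hw₂, hw₃]
    have : (1 : ℤ) ≤ g ^ 2 := one_le_pow₀ hgpos
    calc (H : ℤ) ^ 2 * (w₁ ^ 2 + w₂ ^ 2) + w₃ ^ 2 = 1 * (H ^ 2 * (w₁ ^ 2 + w₂ ^ 2) + w₃ ^ 2) :=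
        (one_mul _).symm
      _ ≤ g ^ 2 * (H ^ 2 * (w₁ ^ 2 + w₂ ^ 2) + w₃ ^ 2) := by gcongr
      _ = _ := by ring

theorem exists_cross_eq (w₁ w₂ w₃ : ℤ) : ∃ a₁ a₂ a₃ b₁ b₂ b₃ : ℤ,
    a₂ * b₃ - a₃ * b₂ = w₁ ∧ a₃ * b₁ - a₁ * b₃ = w₂ ∧ a₁ * b₂ - a₂ * b₁ = w₃ := by
  by_cases hg : Int.gcd w₁ w₂ = 0
  · rw [Int.gcd_eq_zero_iff] at hg
    exact ⟨1, 0, 0, 0, w₃, 0, by simp [hg.1], by simp [hg.2], by ring⟩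
  · obtain ⟨u, hu⟩ := Int.gcd_dvd_left w₁ w₂
    obtain ⟨v, hv⟩ := Int.gcd_dvd_right w₁ w₂
    have hb := Int.gcd_eq_gcd_ab w₁ w₂
    have hg0 : (Int.gcd w₁ w₂ : ℤ) ≠ 0 := by exact_mod_cast hg
    generalize (Int.gcd w₁ w₂ : ℤ) = g at *
    refine ⟨-v, u, 0, -(Int.gcdA w₁ w₂ * w₃), -(Int.gcdB w₁ w₂ * w₃),
        g, by linarith, by linarith, ?_⟩
    have h1 : u * Int.gcdA w₁ w₂ + v * Int.gcdB w₁ w₂ = 1 := by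
      apply mul_left_cancel₀ hg0
      calc g * (u * Int.gcdA w₁ w₂ + v * Int.gcdB w₁ w₂)
          = (g * u) * Int.gcdA w₁ w₂ + (g * v) * Int.gcdB w₁ w₂ := by ring
        _ = g * 1 := by rw [← hu, ← hv, ← hb, mul_one]
    linear_combination w₃ * h1

/-- A pair of integer vectors with prescribed cross product which is reduced for the quadratic form
`X² + Y² + H² Z²`. -/
theorem exists_reduced_cross_eq (H w₁ w₂ w₃ : ℤ) : ∃ a₁ a₂ a₃ b₁ b₂ b₃ : ℤ,
    (a₂ * b₃ - a₃ * b₂ = w₁ ∧ a₃ * b₁ - a₁ * b₃ = w₂ ∧ a₁ * b₂ - a₂ * b₁ = w₃) ∧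
    2 * |a₁ * b₁ + a₂ * b₂ + H ^ 2 * (a₃ * b₃)| ≤ a₁ ^ 2 + a₂ ^ 2 + H ^ 2 * a₃ ^ 2 ∧
    2 * |a₁ * b₁ + a₂ * b₂ + H ^ 2 * (a₃ * b₃)| ≤ b₁ ^ 2 + b₂ ^ 2 + H ^ 2 * b₃ ^ 2 := by
  classical
  have hex : ∃ n : ℕ, ∃ a₁ a₂ a₃ b₁ b₂ b₃ : ℤ,
      (a₂ * b₃ - a₃ * b₂ = w₁ ∧ a₃ * b₁ - a₁ * b₃ = w₂ ∧ a₁ * b₂ - a₂ * b₁ = w₃) ∧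
      a₁ ^ 2 + a₂ ^ 2 + H ^ 2 * a₃ ^ 2 + (b₁ ^ 2 + b₂ ^ 2 + H ^ 2 * b₃ ^ 2) = n := by
    obtain ⟨a₁, a₂, a₃, b₁, b₂, b₃, h⟩ := exists_cross_eq w₁ w₂ w₃
    exact ⟨_, a₁, a₂, a₃, b₁, b₂, b₃, h, (Int.toNat_of_nonneg (by positivity)).symm⟩
  obtain ⟨a₁, a₂, a₃, b₁, b₂, b₃, ⟨h1, h2, h3⟩, hn⟩ := Nat.find_spec hex
  have hmin : ∀ a₁' a₂' a₃' b₁' b₂' b₃' : ℤ,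
      (a₂' * b₃' - a₃' * b₂' = w₁ ∧ a₃' * b₁' - a₁' * b₃' = w₂ ∧ a₁' * b₂' - a₂' * b₁' = w₃) →
      a₁ ^ 2 + a₂ ^ 2 + H ^ 2 * a₃ ^ 2 + (b₁ ^ 2 + b₂ ^ 2 + H ^ 2 * b₃ ^ 2) ≤
      a₁' ^ 2 + a₂' ^ 2 + H ^ 2 * a₃' ^ 2 + (b₁' ^ 2 + b₂' ^ 2 + H ^ 2 * b₃' ^ 2) := by
    intro a₁' a₂' a₃' b₁' b₂' b₃' h
    rw [hn]
    have h0 : (0 : ℤ) ≤ a₁' ^ 2 + a₂' ^ 2 + H ^ 2 * a₃' ^ 2 +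
        (b₁' ^ 2 + b₂' ^ 2 + H ^ 2 * b₃' ^ 2) := by
      positivity
    have := Nat.find_min' hex ⟨a₁', a₂', a₃', b₁', b₂', b₃', h, (Int.toNat_of_nonneg h0).symm⟩
    rw [← Int.toNat_of_nonneg h0]
    exact_mod_cast this
  refine ⟨a₁, a₂, a₃, b₁, b₂, b₃, ⟨h1, h2, h3⟩, ?_, ?_⟩
  · have e1 := hmin a₁ a₂ a₃ (b₁ + a₁) (b₂ + a₂) (b₃ + a₃)
      ⟨by linear_combination h1, by linear_combination h2, by linear_combination h3⟩
    have e2 := hmin a₁ a₂ a₃ (b₁ - a₁) (b₂ - a₂) (b₃ - a₃)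
      ⟨by linear_combination h1, by linear_combination h2, by linear_combination h3⟩
    rcases abs_cases (a₁ * b₁ + a₂ * b₂ + H ^ 2 * (a₃ * b₃)) with h | h <;> rw [h.1] <;> nlinarith
  · have e1 := hmin (a₁ + b₁) (a₂ + b₂) (a₃ + b₃) b₁ b₂ b₃
      ⟨by linear_combination h1, by linear_combination h2, by linear_combination h3⟩
    have e2 := hmin (a₁ - b₁) (a₂ - b₂) (a₃ - b₃) b₁ b₂ b₃
      ⟨by linear_combination h1, by linear_combination h2, by linear_combination h3⟩
    rcases abs_cases (a₁ * b₁ + a₂ * b₂ + H ^ 2 * (a₃ * b₃)) with h | h <;> rw [h.1] <;> nlinarith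

/-- Liouville's inequality for the logarithm of a quotient in `ℚ(√5)`. -/
theorem liouville_log {P Q : ZPhi} {X : ℕ} (hQ0 : 0 < emb P / emb Q)
    (hne : Real.log (emb P / emb Q) ≠ 0)
    (hP1 : |emb P| ≤ 2 ^ X) (hP2 : |embConj P| ≤ 2 ^ X)
    (hQ1 : |emb Q| ≤ 2 ^ X) (hQ2 : |embConj Q| ≤ 2 ^ X) :
    1 / 2 ^ (2 * X + 1) ≤ |Real.log (emb P / emb Q)| := by
  have hq : emb Q ≠ 0 := fun h => by simp [h] at hQ0
  have hp : emb P ≠ 0 := fun h => by simp [h] at hQ0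
  have hPQ : P - Q ≠ 0 := fun h => hne (by rw [sub_eq_zero.1 h, div_self hq, Real.log_one])
  have h1 := one_le_abs_mul hPQ
  have h2 : |embConj (P - Q)| ≤ 2 ^ (X + 1) := by
    rw [map_sub, pow_succ]
    exact (abs_sub _ _).trans (by linarith)
  have h3 : (1 : ℝ) ≤ |emb P - emb Q| * 2 ^ (X + 1) := by
    rw [map_sub] at h1
    exact h1.trans (by gcongr)
  have key : ∀ p q : ℝ, 0 < p / q → q ≠ 0 → p ≠ 0 → |p| ≤ 2 ^ X → 1 ≤ |p - q| * 2 ^ (X + 1) → 1 ≤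
      p / q →
      1 / 2 ^ (2 * X + 1) ≤ |Real.log (p / q)| := by
    intro p q h0 hq0 hp0 hpX hpq h1
    have e1 := Real.one_sub_inv_le_log_of_pos h0
    rw [inv_div] at e1
    have e2 : 1 - q / p = |p - q| / |p| := by
      rw [← abs_div, sub_div, div_self hp0, abs_of_nonneg]
      rw [sub_nonneg, ← inv_div]
      exact inv_le_one_of_one_le₀ h1
    rw [e2] at e1
    refine le_trans ?_ (e1.trans (le_abs_self _))
    rw [div_le_div_iff₀ (by positivity) (by positivity), one_mul]
    calc |p| ≤ 2 ^ X * 1 := by rw [mul_one]; exact hpX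
      _ ≤ 2 ^ X * (|p - q| * 2 ^ (X + 1)) := by gcongr
      _ = |p - q| * 2 ^ (2 * X + 1) := by ring
  rcases le_total 1 (emb P / emb Q) with h | h
  · exact key _ _ hQ0 hq hp hP1 h3 h
  · rw [← inv_div (emb Q) (emb P), Real.log_inv, abs_neg]
    refine key _ _ (by rw [← inv_div]; exact inv_pos.2 hQ0) hp hq hQ1 (by rwa [abs_sub_comm]) ?_
    rw [← inv_div]
    exact (one_le_inv₀ hQ0).2 h

/-- The numerator of `2 ^ p * 3 ^ q * (a / b) ^ r`. -/
def monomialNum (a b : ZPhi) (p q r : ℤ) : ZPhi :=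
  2 ^ p.toNat * 3 ^ q.toNat * a ^ r.toNat * b ^ (-r).toNat

theorem pow_toNat_div_pow_toNat_neg {x : ℝ} (hx : x ≠ 0) (r : ℤ) :
    x ^ r.toNat / x ^ (-r).toNat = x ^ r := by
  rw [← zpow_natCast, ← zpow_natCast, ← zpow_sub₀ hx]
  congr 1
  omega

theorem log_monomialNum_div {a b : ZPhi} (hη : 0 < emb a / emb b) (p q r : ℤ) :
    0 < emb (monomialNum a b p q r) / emb (monomialNum a b (-p) (-q) (-r)) ∧
    Real.log (emb (monomialNum a b p q r) / emb (monomialNum a b (-p) (-q) (-r))) =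
      p * Real.log 2 + q * Real.log 3 + r * Real.log (emb a / emb b) := by
  have hb : emb b ≠ 0 := fun h => by simp [h] at hη
  have ha : emb a ≠ 0 := fun h => by simp [h] at hη
  have e : emb (monomialNum a b p q r) / emb (monomialNum a b (-p) (-q) (-r)) =
      (2 : ℝ) ^ p * 3 ^ q * (emb a / emb b) ^ r := by
    rw [← pow_toNat_div_pow_toNat_neg two_ne_zero p, ← pow_toNat_div_pow_toNat_neg three_ne_zero q,
      ← pow_toNat_div_pow_toNat_neg hη.ne' r, div_pow, div_pow]
    simp only [monomialNum, map_mul, map_pow, map_ofNat, neg_neg]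
    field_simp
  rw [e]
  refine ⟨by positivity, ?_⟩
  rw [Real.log_mul (by positivity) (by positivity), Real.log_mul (by positivity) (by positivity),
    Real.log_zpow, Real.log_zpow, Real.log_zpow]

theorem abs_monomialNum_le {f : ZPhi →+* ℝ} {a b : ZPhi} {H : ℕ} (ha : |f a| ≤ 2 ^ H)
    (hb : |f b| ≤ 2 ^ H) (p q r : ℤ) {h : ℕ} (hh : |p| + 2 * |q| + H * |r| ≤ h) :
    |f (monomialNum a b p q r)| ≤ 2 ^ h := by
  simp only [monomialNum, map_mul, map_pow, map_ofNat, abs_mul, abs_pow, Nat.abs_ofNat]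
  have hr : (r.toNat : ℤ) + (-r).toNat = |r| := by
    rcases abs_cases r with h | h <;> omega
  calc (2 : ℝ) ^ p.toNat * 3 ^ q.toNat * |f a| ^ r.toNat * |f b| ^ (-r).toNat
      ≤ 2 ^ p.toNat * (2 ^ 2) ^ q.toNat * (2 ^ H) ^ r.toNat * (2 ^ H) ^ (-r).toNat := by
        gcongr; norm_num
    _ = 2 ^ (p.toNat + 2 * q.toNat + H * (r.toNat + (-r).toNat)) := by
        rw [← pow_mul, ← pow_mul, ← pow_mul, ← pow_add, ← pow_add, ← pow_add]; congr 1; ring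
    _ ≤ 2 ^ h := by
        apply pow_le_pow_right₀ one_le_two
        zify
        rw [hr]
        have h1 : (p.toNat : ℤ) ≤ |p| := by rcases abs_cases p with h | h <;> omega
        have h2 : (q.toNat : ℤ) ≤ |q| := by rcases abs_cases q with h | h <;> omega
        linarith

/-- Expressing a vector orthogonal to `w = v₁ × v₂` in terms of `v₁` and `v₂`. -/
theorem exists_eq_combination {H B : ℕ} (hH : 1 ≤ H) (hHB : H ≤ 3 * B) {x y z : ℤ}
    (hx : |x| ≤ B) (hy : |y| ≤ B) (hz : H * |z| ≤ B) :
    ∃ a₁ a₂ a₃ b₁ b₂ b₃ s t : ℤ,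
      x = s * a₁ + t * b₁ ∧ y = s * a₂ + t * b₂ ∧ z = s * a₃ + t * b₃ ∧
      ¬ (a₁ = 0 ∧ a₂ = 0 ∧ a₃ = 0) ∧ ¬ (b₁ = 0 ∧ b₂ = 0 ∧ b₃ = 0) ∧
      (a₁ ^ 2 + a₂ ^ 2 + H ^ 2 * a₃ ^ 2) * (b₁ ^ 2 + b₂ ^ 2 + H ^ 2 * b₃ ^ 2) ≤ 12 * H * B ∧
      s ^ 2 * (a₁ ^ 2 + a₂ ^ 2 + H ^ 2 * a₃ ^ 2) ≤ 6 * B ^ 2 ∧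
      t ^ 2 * (b₁ ^ 2 + b₂ ^ 2 + H ^ 2 * b₃ ^ 2) ≤ 6 * B ^ 2 := by
  obtain ⟨w₁, w₂, w₃, e₁, e₂, e₃, hw, he, hsize⟩ := exists_primitive_orthogonal hH hHB hx hy hz
  obtain ⟨a₁, a₂, a₃, b₁, b₂, b₃, ⟨h1, h2, h3⟩, ra, rb⟩ := exists_reduced_cross_eq H w₁ w₂ w₃
  obtain ⟨s, hs⟩ : ∃ s : ℤ, s = (y * b₃ - z * b₂) * e₁ + (z * b₁ - x * b₃) * e₂ +
    (x * b₂ - y * b₁) * e₃ := ⟨_, rfl⟩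
  obtain ⟨t, ht⟩ : ∃ t : ℤ, t = (a₂ * z - a₃ * y) * e₁ + (a₃ * x - a₁ * z) * e₂ +
    (a₁ * y - a₂ * x) * e₃ := ⟨_, rfl⟩
  have f1 : x = s * a₁ + t * b₁ := by
    rw [hs, ht]; subst h1 h2 h3
    linear_combination (-x) * he + e₁ * hw
  have f2 : y = s * a₂ + t * b₂ := by
    rw [hs, ht]; subst h1 h2 h3
    linear_combination (-y) * he + e₂ * hw
  have f3 : z = s * a₃ + t * b₃ := by
    rw [hs, ht]; subst h1 h2 h3
    linear_combination (-z) * he + e₃ * hw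
  clear hs ht
  have na : ¬ (a₁ = 0 ∧ a₂ = 0 ∧ a₃ = 0) := by
    rintro ⟨rfl, rfl, rfl⟩
    simp only [zero_mul, sub_zero] at h1 h2 h3
    rw [← h1, ← h2, ← h3] at he; simp at he
  have nb : ¬ (b₁ = 0 ∧ b₂ = 0 ∧ b₃ = 0) := by
    rintro ⟨rfl, rfl, rfl⟩
    simp only [mul_zero, sub_zero] at h1 h2 h3
    rw [← h1, ← h2, ← h3] at he; simp at he
  have lag : (a₁ ^ 2 + a₂ ^ 2 + (H : ℤ) ^ 2 * a₃ ^ 2) * (b₁ ^ 2 + b₂ ^ 2 + H ^ 2 * b₃ ^ 2) -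
      (a₁ * b₁ + a₂ * b₂ + H ^ 2 * (a₃ * b₃)) ^ 2 = H ^ 2 * (w₁ ^ 2 + w₂ ^ 2) + w₃ ^ 2 := by
    rw [← h1, ← h2, ← h3]; ring
  have nrm : x ^ 2 + y ^ 2 + (H : ℤ) ^ 2 * z ^ 2 = s ^ 2 *
      (a₁ ^ 2 + a₂ ^ 2 + (H : ℤ) ^ 2 * a₃ ^ 2) +
      t ^ 2 * (b₁ ^ 2 + b₂ ^ 2 + H ^ 2 * b₃ ^ 2) + 2 * (s * t) *
          (a₁ * b₁ + a₂ * b₂ + H ^ 2 * (a₃ * b₃)) := by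
    rw [f1, f2, f3]; ring
  have nrm2 : x ^ 2 + y ^ 2 + (H : ℤ) ^ 2 * z ^ 2 ≤ 3 * B ^ 2 := by
    have q1 : x ^ 2 ≤ (B : ℤ) ^ 2 := sq_le_sq' (by linarith [neg_abs_le x])
        ((le_abs_self x).trans hx)
    have q2 : y ^ 2 ≤ (B : ℤ) ^ 2 := sq_le_sq' (by linarith [neg_abs_le y])
        ((le_abs_self y).trans hy)
    have q3 : (H * z) ^ 2 ≤ (B : ℤ) ^ 2 := by
      rw [← sq_abs, abs_mul, Nat.abs_cast]
      exact pow_le_pow_left₀ (by positivity) hz 2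
    linarith [mul_pow (H : ℤ) z 2]
  refine ⟨a₁, a₂, a₃, b₁, b₂, b₃, s, t, f1, f2, f3, na, nb, ?_⟩
  clear f1 f2 f3 na nb h1 h2 h3 he hw
  generalize a₁ * b₁ + a₂ * b₂ + (H : ℤ) ^ 2 * (a₃ * b₃) = c at *
  have n1 : 0 ≤ a₁ ^ 2 + a₂ ^ 2 + (H : ℤ) ^ 2 * a₃ ^ 2 := by positivity
  have n2 : 0 ≤ b₁ ^ 2 + b₂ ^ 2 + (H : ℤ) ^ 2 * b₃ ^ 2 := by positivity
  generalize a₁ ^ 2 + a₂ ^ 2 + (H : ℤ) ^ 2 * a₃ ^ 2 = M at *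
  generalize b₁ ^ 2 + b₂ ^ 2 + (H : ℤ) ^ 2 * b₃ ^ 2 = N at *
  have hc : 4 * c ^ 2 ≤ M * N := by
    have := mul_le_mul ra rb (by positivity) n1
    nlinarith [sq_abs c]
  have hst : - (2 * (2 * (s * t) * c)) ≤ s ^ 2 * M + t ^ 2 * N := by
    have e1 : -(2 * (s * t) * c) ≤ 2 * (|s| * |t|) * |c| := by
      calc -(2 * (s * t) * c) ≤ |-(2 * (s * t) * c)| := le_abs_self _
        _ = _ := by rw [abs_neg, abs_mul, abs_mul, abs_mul]; norm_num
    have e2 : 2 * (|s| * |t|) * (2 * |c|) ≤ s ^ 2 * M + t ^ 2 * N := by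
      have i1 : |s| ^ 2 * (2 * |c|) ≤ |s| ^ 2 * M := by gcongr
      have i2 : |t| ^ 2 * (2 * |c|) ≤ |t| ^ 2 * N := by gcongr
      rw [sq_abs] at i1 i2
      have i3 : 0 ≤ (|s| - |t|) ^ 2 * (2 * |c|) := by positivity
      have i4 : (|s| - |t|) ^ 2 = s ^ 2 + t ^ 2 - 2 * (|s| * |t|) := by
        rw [sub_sq, sq_abs, sq_abs]; ring
      rw [i4] at i3
      linarith
    linarith
  have p1 : 0 ≤ s ^ 2 * M := by positivity
  have p2 : 0 ≤ t ^ 2 * N := by positivity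
  refine ⟨by linarith, by linarith, by linarith⟩

theorem height_le {H : ℕ} {a₁ a₂ a₃ : ℤ} :
    (|a₁| + 2 * |a₂| + H * |a₃|) ^ 2 ≤ 6 * (a₁ ^ 2 + a₂ ^ 2 + H ^ 2 * a₃ ^ 2) := by
  rw [← sq_abs a₁, ← sq_abs a₂, ← sq_abs a₃]
  nlinarith [sq_nonneg (2 * |a₁| - |a₂|), sq_nonneg (|a₁| - H * |a₃|),
      sq_nonneg (|a₂| - 2 * (H * |a₃|))]

set_option maxHeartbeats 1000000 in
/-- A lower bound for `|x log 2 + y log 3 + z log η|` with `η ∈ ℚ(√5)`, obtained from lower bounds for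
linear forms in two logarithms. -/
theorem three_log_lower_bound {a b : ZPhi} {H B ℓ u : ℕ} {x y z : ℤ} (hH : 1 ≤ H) (hHB : H ≤ 3 * B)
    (hℓ : 2 ≤ ℓ) (hZ : 2 ^ 18 * ℓ * B ≤ 2 ^ ℓ)
    (hae : |emb a| ≤ 2 ^ H) (hac : |embConj a| ≤ 2 ^ H)
    (hbe : |emb b| ≤ 2 ^ H) (hbc : |embConj b| ≤ 2 ^ H) (hη : 0 < emb a / emb b)
    (hind : ∀ p q r : ℤ, p * Real.log 2 + q * Real.log 3 + r * Real.log (emb a / emb b) = 0 →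
      p = 0 ∧ q = 0 ∧ r = 0)
    (hx : |x| ≤ B) (hy : |y| ≤ B) (hz : H * |z| ≤ B) (hxyz : ¬ (x = 0 ∧ y = 0 ∧ z = 0))
    (hu : 432 * H * B ≤ u ^ 2) :
    1 / 2 ^ (20 * (2 ^ 21 * u * ℓ ^ 2)) <
      |x * Real.log 2 + y * Real.log 3 + z * Real.log (emb a / emb b)| := by
  obtain ⟨a₁, a₂, a₃, b₁, b₂, b₃, s, t, f1, f2, f3, na, nb, hN, hs, ht⟩ :=
    exists_eq_combination hH hHB hx hy hz
  obtain ⟨h₁, hh₁⟩ : ∃ h : ℕ, (h : ℤ) = |a₁| + 2 * |a₂| + H * |a₃| :=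
    ⟨_, Int.toNat_of_nonneg (by positivity)⟩
  obtain ⟨h₂, hh₂⟩ : ∃ h : ℕ, (h : ℤ) = |b₁| + 2 * |b₂| + H * |b₃| :=
    ⟨_, Int.toNat_of_nonneg (by positivity)⟩
  have pos : ∀ c₁ c₂ c₃ : ℤ, ¬ (c₁ = 0 ∧ c₂ = 0 ∧ c₃ = 0) → 0 < |c₁| + 2 * |c₂| + H * |c₃| := by
    intro c₁ c₂ c₃ hc
    by_contra! h0
    have i3 : |c₃| ≤ H * |c₃| := le_mul_of_one_le_left (abs_nonneg _) (by exact_mod_cast hH)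
    have i1 := abs_nonneg c₁
    have i2 := abs_nonneg c₂
    have i4 := abs_nonneg c₃
    exact hc ⟨abs_eq_zero.1 (by omega), abs_eq_zero.1 (by omega), abs_eq_zero.1 (by omega)⟩
  have h₁1 : 1 ≤ h₁ := by have := pos _ _ _ na; omega
  have h₂1 : 1 ≤ h₂ := by have := pos _ _ _ nb; omega
  have hq₁ : (h₁ : ℤ) ^ 2 ≤ 6 * (a₁ ^ 2 + a₂ ^ 2 + H ^ 2 * a₃ ^ 2) := hh₁ ▸ height_le
  have hq₂ : (h₂ : ℤ) ^ 2 ≤ 6 * (b₁ ^ 2 + b₂ ^ 2 + H ^ 2 * b₃ ^ 2) := hh₂ ▸ height_le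
  have hprod : h₁ * h₂ ≤ u := by
    have e1 : ((h₁ * h₂ : ℕ) : ℤ) ^ 2 ≤ (u : ℤ) ^ 2 := by
      have e2 := mul_le_mul hq₁ hq₂ (by positivity) (by positivity)
      have e3 : (432 * H * B : ℤ) ≤ u ^ 2 := by exact_mod_cast hu
      push_cast
      calc (h₁ * h₂ : ℤ) ^ 2 = h₁ ^ 2 * h₂ ^ 2 := by ring
        _ ≤ _ := e2
        _ = 36 * ((a₁ ^ 2 + a₂ ^ 2 + H ^ 2 * a₃ ^ 2) *
            (b₁ ^ 2 + b₂ ^ 2 + H ^ 2 * b₃ ^ 2)) := by ring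
        _ ≤ 36 * (12 * H * B) := by linarith
        _ ≤ _ := by linarith
    exact_mod_cast (pow_le_pow_iff_left₀ (by positivity) (by positivity) two_ne_zero).1 e1
  have hk : ∀ (k : ℤ) (h : ℕ) (N : ℤ), (h : ℤ) ^ 2 ≤ 6 * N → k ^ 2 * N ≤ 6 * B ^ 2 → k.natAbs *
      h ≤ 6 * B := by
    intro k h N e1 e2
    have e3 : ((k.natAbs * h : ℕ) : ℤ) ^ 2 ≤ ((6 * B : ℕ) : ℤ) ^ 2 := by
      push_cast
      rw [mul_pow, sq_abs]
      have := mul_le_mul_of_nonneg_left e1 (sq_nonneg k)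
      linarith
    exact_mod_cast (pow_le_pow_iff_left₀ (by positivity) (by positivity) two_ne_zero).1 e3
  have hk₁ := hk s h₁ _ hq₁ hs
  have hk₂ := hk t h₂ _ hq₂ ht
  -- make the coefficients coprime
  have hst : ¬ (s = 0 ∧ t = 0) := by
    rintro ⟨rfl, rfl⟩
    exact hxyz ⟨by simpa using f1, by simpa using f2, by simpa using f3⟩
  have hgpos : 0 < Int.gcd s t := Nat.pos_of_ne_zero fun h => hst (Int.gcd_eq_zero_iff.1 h)
  obtain ⟨k₁, k₂, hcop, e1, e2⟩ : ∃ k₁ k₂ : ℤ, IsCoprime k₁ k₂ ∧ s = Int.gcd s t * k₁ ∧ t =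
      Int.gcd s t * k₂ := by
    obtain ⟨k₁, k₂, h1, h2, h3⟩ := Int.exists_gcd_one hgpos
    exact ⟨k₁, k₂, Int.isCoprime_iff_gcd_eq_one.2 h1, by rw [mul_comm]; exact h2,
      by rw [mul_comm]; exact h3⟩
  generalize Int.gcd s t = g at hgpos e1 e2
  have hk₁' : k₁.natAbs * h₁ ≤ 6 * B := by
    refine le_trans (Nat.mul_le_mul_right _ ?_) hk₁
    rw [e1, Int.natAbs_mul]
    exact Nat.le_mul_of_pos_left _ (by simpa using hgpos)
  have hk₂' : k₂.natAbs * h₂ ≤ 6 * B := by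
    refine le_trans (Nat.mul_le_mul_right _ ?_) hk₂
    rw [e2, Int.natAbs_mul]
    exact Nat.le_mul_of_pos_left _ (by simpa using hgpos)
  obtain ⟨pA, lA⟩ := log_monomialNum_div hη a₁ a₂ a₃
  obtain ⟨pB, lB⟩ := log_monomialNum_div hη b₁ b₂ b₃
  have hΛ : x * Real.log 2 + y * Real.log 3 + z * Real.log (emb a / emb b) = g * (
      k₁ * Real.log (emb (monomialNum a b a₁ a₂ a₃) / emb (monomialNum a b (-a₁) (-a₂) (-a₃))) +
      k₂ * Real.log (emb (monomialNum a b b₁ b₂ b₃) / emb (monomialNum a b (-b₁) (-b₂) (-b₃)))) := by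
    rw [lA, lB, f1, f2, f3, e1, e2]; push_cast; ring
  have hgR : (1 : ℝ) ≤ g := by exact_mod_cast hgpos
  have hE : h₁ * h₂ * ℓ ^ 2 ≤ u * ℓ ^ 2 := Nat.mul_le_mul_right _ hprod
  rw [hΛ, abs_mul, Nat.abs_cast]
  refine lt_of_lt_of_le ?_ (le_mul_of_one_le_left (abs_nonneg _) hgR)
  have hneg : ∀ c₁ c₂ c₃ : ℤ, |-c₁| + 2 * |-c₂| + H * |-c₃| = |c₁| + 2 * |c₂| + H * |c₃| := by
    intro c₁ c₂ c₃; rw [abs_neg, abs_neg, abs_neg]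
  by_cases hbig : 2 ^ 14 * ℓ * h₂ ≤ k₁.natAbs ∨ 2 ^ 14 * ℓ * h₁ ≤ k₂.natAbs
  · have hk₂0 : k₂ ≠ 0 := by
      rintro rfl
      rw [isCoprime_zero_right, Int.isUnit_iff_natAbs_eq] at hcop
      rw [hcop] at hbig
      have e6 : 0 < ℓ * h₁ := by positivity
      have e7 : 0 < ℓ * h₂ := by positivity
      rw [mul_assoc, mul_assoc] at hbig
      simp only [Int.natAbs_zero] at hbig
      omega
    have ne0 : ∀ c : ZPhi, emb c ≠ 0 → c ≠ 0 := fun c h hc => h (by rw [hc, map_zero])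
    have nA := (div_ne_zero_iff.1 pA.ne')
    have nB := (div_ne_zero_iff.1 pB.ne')
    refine lt_of_le_of_lt ?_ (two_log_lower_bound h₁1 h₂1 hℓ (ne0 _ nA.1) (ne0 _ nA.2)
        (ne0 _ nB.1) (ne0 _ nB.2)
      (abs_monomialNum_le hae hbe _ _ _ hh₁.ge) (abs_monomialNum_le hac hbc _ _ _ hh₁.ge)
      (abs_monomialNum_le hae hbe _ _ _ ((hneg _ _ _).trans_le hh₁.ge))
      (abs_monomialNum_le hac hbc _ _ _ ((hneg _ _ _).trans_le hh₁.ge))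
      (abs_monomialNum_le hae hbe _ _ _ hh₂.ge) (abs_monomialNum_le hac hbc _ _ _ hh₂.ge)
      (abs_monomialNum_le hae hbe _ _ _ ((hneg _ _ _).trans_le hh₂.ge))
      (abs_monomialNum_le hac hbc _ _ _ ((hneg _ _ _).trans_le hh₂.ge))
      pA pB (fun h => na (hind _ _ _ (by rw [← lA, h, Real.log_one]))) hcop hk₂0 hbig rfl rfl ?_)
    · apply one_div_le_one_div_of_le (by positivity)
      apply pow_le_pow_right₀ one_le_two
      linarith
    · refine le_trans ?_ hZ
      have hB : k₂.natAbs ≤ k₂.natAbs * h₂ := Nat.le_mul_of_pos_right _ h₂1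
      calc (2 ^ 14 * ℓ * h₂ + 64 * ℓ) * k₂.natAbs + 2 ^ 14 * ℓ * h₁ * k₁.natAbs
          = 2 ^ 14 * ℓ * (k₂.natAbs * h₂) + 64 * ℓ * k₂.natAbs + 2 ^ 14 * ℓ *
              (k₁.natAbs * h₁) := by ring
        _ ≤ 2 ^ 14 * ℓ * (6 * B) + 64 * ℓ * (6 * B) + 2 ^ 14 * ℓ * (6 * B) := by
            gcongr; exact hB.trans hk₂'
        _ ≤ _ := by nlinarith [Nat.zero_le (ℓ * B)]
  · push Not at hbig
    obtain ⟨pC, lC⟩ := log_monomialNum_div hη (k₁ * a₁ + k₂ * b₁) (k₁ * a₂ + k₂ * b₂)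
        (k₁ * a₃ + k₂ * b₃)
    have hform : k₁ * Real.log (emb (monomialNum a b a₁ a₂ a₃) / emb
        (monomialNum a b (-a₁) (-a₂) (-a₃))) +
      k₂ * Real.log (emb (monomialNum a b b₁ b₂ b₃) / emb (monomialNum a b (-b₁) (-b₂) (-b₃))) =
      Real.log (emb (monomialNum a b (k₁ * a₁ + k₂ * b₁) (k₁ * a₂ + k₂ * b₂) (k₁ * a₃ + k₂ * b₃)) /
        emb (monomialNum a b (-(k₁ * a₁ + k₂ * b₁)) (-(k₁ * a₂ + k₂ * b₂))
            (-(k₁ * a₃ + k₂ * b₃)))) := by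
      rw [lA, lB, lC]; push_cast; ring
    rw [hform]
    have hX : |k₁ * a₁ + k₂ * b₁| + 2 * |k₁ * a₂ + k₂ * b₂| + H * |k₁ * a₃ + k₂ * b₃| ≤
        ((k₁.natAbs * h₁ + k₂.natAbs * h₂ : ℕ) : ℤ) := by
      push_cast
      rw [hh₁, hh₂]
      have tri : ∀ c d : ℤ, |k₁ * c + k₂ * d| ≤ |k₁| * |c| + |k₂| * |d| := fun c d => by
        rw [← abs_mul, ← abs_mul]; exact abs_add_le _ _
      have t3 := mul_le_mul_of_nonneg_left (tri a₃ b₃) (Int.natCast_nonneg H)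
      linarith [tri a₁ b₁, tri a₂ b₂]
    refine lt_of_lt_of_le ?_ (liouville_log pC (fun h => ?_) (abs_monomialNum_le hae hbe _ _ _ hX)
      (abs_monomialNum_le hac hbc _ _ _ hX)
      (abs_monomialNum_le hae hbe _ _ _ ((hneg _ _ _).trans_le hX))
      (abs_monomialNum_le hac hbc _ _ _ ((hneg _ _ _).trans_le hX)))
    · apply one_div_lt_one_div_of_lt (by positivity)
      apply pow_lt_pow_right₀ one_lt_two
      have i1 : k₁.natAbs * h₁ ≤ 2 ^ 14 * (h₁ * h₂ * ℓ) :=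
          (Nat.mul_le_mul_right _ hbig.1.le).trans_eq (by ring)
      have i2 : k₂.natAbs * h₂ ≤ 2 ^ 14 * (h₁ * h₂ * ℓ) :=
          (Nat.mul_le_mul_right _ hbig.2.le).trans_eq (by ring)
      have i3 : h₁ * h₂ * ℓ ≤ h₁ * h₂ * ℓ ^ 2 := Nat.mul_le_mul_left _
          (Nat.le_self_pow two_ne_zero ℓ)
      have i4 : 1 ≤ h₁ * h₂ * ℓ := Nat.one_le_iff_ne_zero.2 (by positivity)
      rw [mul_assoc _ u]
      omega
    · rw [lC] at h
      obtain ⟨z1, z2, z3⟩ := hind _ _ _ h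
      apply hxyz
      rw [f1, f2, f3, e1, e2]
      refine ⟨?_, ?_, ?_⟩
      · linear_combination (g : ℤ) * z1
      · linear_combination (g : ℤ) * z2
      · linear_combination (g : ℤ) * z3

/-- Three solutions of `L_n - 2 ^ x * 3 ^ y = c` with `c > 0` and `n` at least `2`. -/
structure PillaiTriple where
  (c : ℤ) (n₁ n₂ n₃ x₁ y₁ x₂ y₂ x₃ y₃ : ℕ)
  c_pos : 0 < c
  two_le : 2 ≤ n₃
  lt₃₂ : n₃ < n₂
  lt₂₁ : n₂ < n₁
  eq₁ : lucas n₁ - 2 ^ x₁ * 3 ^ y₁ = c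
  eq₂ : lucas n₂ - 2 ^ x₂ * 3 ^ y₂ = c
  eq₃ : lucas n₃ - 2 ^ x₃ * 3 ^ y₃ = c

theorem exponents_le {c : ℤ} (hc : 0 < c) {n x y : ℕ} (h : lucas n - 2 ^ x * 3 ^ y = c) :
    x ≤ n ∧ y ≤ n := by
  have h1 := (lucas_pos_le n).2
  have h2 : (1 : ℤ) ≤ 2 ^ x := one_le_pow₀ (by norm_num)
  have h3 : (1 : ℤ) ≤ 3 ^ y := one_le_pow₀ (by norm_num)
  have h4 : (2 : ℤ) ^ y ≤ 3 ^ y := pow_le_pow_left₀ (by norm_num) (by norm_num) _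
  have h5 : (2 : ℤ) ^ x < 2 ^ (n + 1) := by nlinarith
  have h6 : (2 : ℤ) ^ y < 2 ^ (n + 1) := by nlinarith
  have h7 := (pow_lt_pow_iff_right₀ (by norm_num : (1 : ℤ) < 2)).1 h5
  have h8 := (pow_lt_pow_iff_right₀ (by norm_num : (1 : ℤ) < 2)).1 h6
  omega

theorem goldenConj_sq_eq : goldenConj ^ 2 = 2 - goldenRatio := by
  have h1 := Real.goldenRatio_add_goldenConj
  have h2 := Real.goldenConj_sq
  linarith

theorem goldenRatio_bounds : 1618 / 1000 < goldenRatio ∧ goldenRatio < 1619 / 1000 := by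
  have h1 := Real.goldenRatio_sq
  have h0 := Real.goldenRatio_pos
  constructor <;> nlinarith

theorem abs_goldenConj_pow_le {k n : ℕ} (h : k ≤ n) : |goldenConj ^ n| ≤ |goldenConj| ^ k := by
  rw [abs_pow]
  exact pow_le_pow_of_le_one (abs_nonneg _) abs_goldenConj_le_one h

theorem abs_goldenConj_pow_lt {n : ℕ} (h : 2 ≤ n) : |goldenConj ^ n| < 383 / 1000 := by
  have h1 := abs_goldenConj_pow_le h
  rw [sq_abs, goldenConj_sq_eq] at h1
  linarith [goldenRatio_bounds.1]

theorem abs_goldenConj_pow_lt' {n : ℕ} (h : 3 ≤ n) : |goldenConj ^ n| < 240 / 1000 := by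
  have h1 := abs_goldenConj_pow_le h
  have h2 : |goldenConj| = goldenRatio - 1 := by
    rw [abs_of_neg Real.goldenConj_neg]; linarith [Real.goldenRatio_add_goldenConj]
  rw [pow_succ, sq_abs, goldenConj_sq_eq, h2] at h1
  have h3 := Real.goldenRatio_sq
  nlinarith [goldenRatio_bounds.1, goldenRatio_bounds.2]

theorem log_two_pow_mul_three_pow (x y : ℕ) :
    Real.log (2 ^ x * 3 ^ y) = x * Real.log 2 + y * Real.log 3 := by
  rw [Real.log_mul (by positivity) (by positivity), Real.log_pow, Real.log_pow]

/-- The form `x log 2 + y log 3 - n log φ` attached to the largest solution is small. -/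
theorem abs_log_sub_le {c : ℤ} (hc : 0 < c) {n m x y x' y' : ℕ} (hm : 2 ≤ m) (hmn : m + 2 ≤ n)
    (h : lucas n - 2 ^ x * 3 ^ y = c) (h' : lucas m - 2 ^ x' * 3 ^ y' = c) :
    0 < n * Real.log goldenRatio - (x * Real.log 2 + y * Real.log 3) ∧
    n * Real.log goldenRatio - (x * Real.log 2 + y * Real.log 3) ≤
      goldenRatio / goldenRatio ^ (n - m) := by
  have hg := Real.goldenRatio_pos
  have hgl := goldenRatio_bounds
  have hsq := Real.goldenRatio_sq
  have e1 : (lucas n : ℝ) - 2 ^ x * 3 ^ y = c := by exact_mod_cast h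
  have e2 : (lucas m : ℝ) - 2 ^ x' * 3 ^ y' = c := by exact_mod_cast h'
  have hc' : (1 : ℝ) ≤ c := by exact_mod_cast hc
  have hu' : (1 : ℝ) ≤ 2 ^ x' * 3 ^ y' := one_le_mul_of_one_le_of_one_le
    (one_le_pow₀ (by norm_num)) (one_le_pow₀ (by norm_num))
  rw [coe_lucas] at e1 e2
  have b1 := abs_lt.1 (abs_goldenConj_pow_lt hm)
  have b2 := abs_lt.1 (abs_goldenConj_pow_lt (by omega : 2 ≤ n))
  have hu : (0 : ℝ) < 2 ^ x * 3 ^ y := by positivity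
  have hpn : 0 < goldenRatio ^ n := by positivity
  have hpm : 0 < goldenRatio ^ m := by positivity
  have hnm : goldenRatio ^ n = goldenRatio ^ m * goldenRatio ^ (n - m) := by
    rw [← pow_add]; congr 1; omega
  have hD : goldenRatio ^ 2 ≤ goldenRatio ^ (n - m) :=
    pow_le_pow_right₀ (by linarith) (by omega)
  have key : n * Real.log goldenRatio - (x * Real.log 2 + y * Real.log 3) =
      Real.log (goldenRatio ^ n / (2 ^ x * 3 ^ y)) := by
    rw [Real.log_div hpn.ne' hu.ne', log_two_pow_mul_three_pow, Real.log_pow]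
  rw [key]
  constructor
  · apply Real.log_pos
    rw [one_lt_div hu]
    linarith
  · refine (Real.log_le_sub_one_of_pos (by positivity)).trans ?_
    generalize (2 : ℝ) ^ x * 3 ^ y = u at *
    generalize goldenRatio ^ (n - m) = T at *
    have hT : 0 < T := by nlinarith
    have h1 : goldenRatio ^ n - u ≤ goldenRatio ^ m := by linarith
    have h2 : goldenRatio ^ m * (T - 1) ≤ u := by rw [hnm] at h1; linarith
    rw [div_sub_one hu.ne', div_le_div_iff₀ hu hT]
    have h3 : T ≤ goldenRatio * (T - 1) := by nlinarith
    have h4 : goldenRatio * (goldenRatio ^ m * (T - 1)) ≤ goldenRatio * u :=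
      mul_le_mul_of_nonneg_left h2 hg.le
    have h5 : (goldenRatio ^ n - u) * T ≤ goldenRatio ^ m * T :=
      mul_le_mul_of_nonneg_right h1 hT.le
    have h6 := mul_le_mul_of_nonneg_left h3 hpm.le
    linarith

/-- The form `x log 2 + y log 3 - m log φ - log (φ ^ d - 1)` attached to two solutions with indices
`m + d` and `m` is small. -/
theorem log_sub_log_le {c : ℤ} {m d x y x' y' : ℕ} (hm : 2 ≤ m) (hd : 1 ≤ d)
    (h : lucas (m + d) - 2 ^ x * 3 ^ y = c) (h' : lucas m - 2 ^ x' * 3 ^ y' = c) :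
    0 ≤ x * Real.log 2 + y * Real.log 3 - m * Real.log goldenRatio -
      Real.log (goldenRatio ^ d - 1) ∧
    x * Real.log 2 + y * Real.log 3 - m * Real.log goldenRatio -
      Real.log (goldenRatio ^ d - 1) ≤ 2 * (2 ^ x' * 3 ^ y') * goldenRatio / goldenRatio ^ m := by
  have hg := Real.goldenRatio_pos
  have hgl := goldenRatio_bounds
  have hsq := Real.goldenRatio_sq
  have e1 : (lucas (m + d) : ℝ) - 2 ^ x * 3 ^ y = c := by exact_mod_cast h
  have e2 : (lucas m : ℝ) - 2 ^ x' * 3 ^ y' = c := by exact_mod_cast h'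
  have hu' : (1 : ℝ) ≤ 2 ^ x' * 3 ^ y' := one_le_mul_of_one_le_of_one_le
    (one_le_pow₀ (by norm_num)) (one_le_pow₀ (by norm_num))
  rw [coe_lucas] at e1 e2
  have b1 := abs_lt.1 (abs_goldenConj_pow_lt hm)
  have b2 := abs_lt.1 (abs_goldenConj_pow_lt' (by omega : 3 ≤ m + d))
  have hu : (0 : ℝ) < 2 ^ x * 3 ^ y := by positivity
  have hpm : 0 < goldenRatio ^ m := by positivity
  have hD : goldenRatio ^ 1 ≤ goldenRatio ^ d := pow_le_pow_right₀ (by linarith) hd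
  rw [pow_one] at hD
  have hW : 0 < goldenRatio ^ d - 1 := by linarith
  rw [pow_add goldenRatio] at e1
  have key : x * Real.log 2 + y * Real.log 3 - m * Real.log goldenRatio -
      Real.log (goldenRatio ^ d - 1) =
      Real.log ((2 ^ x * 3 ^ y) / (goldenRatio ^ m * (goldenRatio ^ d - 1))) := by
    rw [Real.log_div hu.ne' (by positivity), log_two_pow_mul_three_pow,
      Real.log_mul hpm.ne' hW.ne', Real.log_pow]
    ring
  rw [key]
  have hP : 0 < goldenRatio ^ m * (goldenRatio ^ d - 1) := by positivity
  constructor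
  · apply Real.log_nonneg
    rw [one_le_div hP]
    linarith
  · refine (Real.log_le_sub_one_of_pos (by positivity)).trans ?_
    rw [div_sub_one hP.ne', div_le_div_iff₀ hP hpm]
    have h1 : (2 ^ x * 3 ^ y : ℝ) - goldenRatio ^ m * (goldenRatio ^ d - 1) ≤
        2 * (2 ^ x' * 3 ^ y') := by linarith
    have h2 : 1 ≤ goldenRatio * (goldenRatio ^ d - 1) := by nlinarith
    calc _ ≤ 2 * (2 ^ x' * 3 ^ y') * goldenRatio ^ m := mul_le_mul_of_nonneg_right h1 hpm.le
      _ ≤ 2 * (2 ^ x' * 3 ^ y') * goldenRatio ^ m * (goldenRatio * (goldenRatio ^ d - 1)) :=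
        le_mul_of_one_le_right (by positivity) h2
      _ = _ := by ring

theorem eq_zero_of_log_two_log_three {p q : ℤ} (h : p * Real.log 2 + q * Real.log 3 = 0) :
    p = 0 ∧ q = 0 := by
  have h2 : 0 < Real.log 2 := Real.log_pos (by norm_num)
  have h3 : 0 < Real.log 3 := Real.log_pos (by norm_num)
  have e : (p.natAbs : ℝ) * Real.log 2 = q.natAbs * Real.log 3 := by
    have h' : (p : ℝ) * Real.log 2 = -(q * Real.log 3) := by linarith
    have := congrArg abs h'
    rw [abs_neg, abs_mul, abs_mul, abs_of_pos h2, abs_of_pos h3] at this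
    rw [Nat.cast_natAbs, Nat.cast_natAbs]
    push_cast
    exact this
  rw [← Real.log_pow, ← Real.log_pow] at e
  have e' := Real.log_injOn_pos (Set.mem_Ioi.2 (by positivity)) (Set.mem_Ioi.2 (by positivity)) e
  have e3 : 2 ^ p.natAbs = 3 ^ q.natAbs := by exact_mod_cast e'
  have hp : p = 0 := by
    by_contra hp
    have : 2 ∣ 3 ^ q.natAbs := e3 ▸ dvd_pow_self 2 (by omega)
    have := Nat.prime_two.dvd_of_dvd_pow this
    omega
  subst hp
  have : q = 0 ∨ Real.log 3 = 0 := by simpa using h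
  exact ⟨rfl, this.resolve_right h3.ne'⟩

theorem log_abs_map_monomialNum (f : ZPhi →+* ℝ) {a b : ZPhi} (ha : f a ≠ 0) (hb : f b ≠ 0)
    (p q r : ℤ) : Real.log |f (monomialNum a b p q r)| =
      p.toNat * Real.log 2 + q.toNat * Real.log 3 + r.toNat * Real.log |f a| +
        (-r).toNat * Real.log |f b| := by
  have ha' := abs_pos.2 ha
  have hb' := abs_pos.2 hb
  have e2 : f 2 = 2 := map_ofNat f 2
  have e3 : f 3 = 3 := map_ofNat f 3
  simp only [monomialNum, map_mul, map_pow, abs_mul, abs_pow, e2, e3]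
  rw [Real.log_mul (by positivity) (by positivity), Real.log_mul (by positivity) (by positivity),
    Real.log_mul (by positivity) (by positivity), Real.log_pow, Real.log_pow, Real.log_pow,
    Real.log_pow, abs_of_pos (by norm_num : (0 : ℝ) < 2), abs_of_pos (by norm_num : (0 : ℝ) < 3)]

theorem embConj_ne_zero {x : ZPhi} (hx : emb x ≠ 0) : embConj x ≠ 0 := by
  have h0 : x ≠ 0 := fun h => hx (by simp [h])
  intro h
  have := one_le_abs_mul h0
  rw [h] at this
  norm_num at this

theorem multiplicatively_independent {a b : ZPhi} (hη : 0 < emb a / emb b)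
    (hne : |emb a * embConj b| ≠ |embConj a * emb b|) (p q r : ℤ)
    (h : p * Real.log 2 + q * Real.log 3 + r * Real.log (emb a / emb b) = 0) :
    p = 0 ∧ q = 0 ∧ r = 0 := by
  have hb : emb b ≠ 0 := fun h => by simp [h] at hη
  have ha : emb a ≠ 0 := fun h => by simp [h] at hη
  have ha' := embConj_ne_zero ha
  have hb' := embConj_ne_zero hb
  obtain ⟨h1, h2⟩ := log_monomialNum_div hη p q r
  rw [h] at h2
  have h3 := Real.eq_one_of_pos_of_log_eq_zero h1 h2
  have h4 : emb (monomialNum a b (-p) (-q) (-r)) ≠ 0 := fun h => by simp [h] at h3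
  rw [div_eq_one_iff_eq h4] at h3
  have h5 := emb_injective h3
  have key : ∀ f : ZPhi →+* ℝ, f a ≠ 0 → f b ≠ 0 →
      p * Real.log 2 + q * Real.log 3 + r * (Real.log |f a| - Real.log |f b|) = 0 := by
    intro f fa fb
    have e1 := log_abs_map_monomialNum f fa fb p q r
    have e2 := log_abs_map_monomialNum f fa fb (-p) (-q) (-r)
    rw [h5, e2] at e1
    have cast : ∀ t : ℤ, (t : ℝ) = t.toNat - (-t).toNat := fun t => by
      exact_mod_cast (show t = t.toNat - ((-t).toNat : ℤ) by omega)
    rw [cast p, cast q, cast r]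
    simp only [neg_neg] at e1
    linarith
  have k1 := key emb ha hb
  have k2 := key embConj ha' hb'
  have hr : r = 0 := by
    by_contra hr
    have hr' : (r : ℝ) ≠ 0 := by exact_mod_cast hr
    have k3 : (r : ℝ) * ((Real.log |emb a| - Real.log |emb b|) -
      (Real.log |embConj a| - Real.log |embConj b|)) = 0 := by linarith
    have k4 := (mul_eq_zero.1 k3).resolve_left hr'
    apply hne
    rw [abs_mul, abs_mul]
    have p1 := abs_pos.2 ha
    have p2 := abs_pos.2 hb
    have p3 := abs_pos.2 ha'
    have p4 := abs_pos.2 hb'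
    apply Real.log_injOn_pos (Set.mem_Ioi.2 (by positivity)) (Set.mem_Ioi.2 (by positivity))
    rw [Real.log_mul p1.ne' p4.ne', Real.log_mul p3.ne' p2.ne']
    linarith
  subst hr
  obtain ⟨hp, hq⟩ := eq_zero_of_log_two_log_three (p := p) (q := q) (by simpa using h)
  exact ⟨hp, hq, rfl⟩

theorem goldenRatio_independent (p q r : ℤ)
    (h : p * Real.log 2 + q * Real.log 3 + r * Real.log goldenRatio = 0) :
    p = 0 ∧ q = 0 ∧ r = 0 := by
  have hg := goldenRatio_bounds
  apply multiplicatively_independent (a := phi) (b := 1)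
  · simp only [emb_phi, map_one, div_one]; linarith
  · simp only [emb_phi, map_one, embConj_phi, mul_one]
    rw [abs_of_pos (by linarith)]
    exact (lt_of_le_of_lt abs_goldenConj_le_one (by linarith)).ne'
  · simpa using h

/-- The two embeddings of `(φ ^ d - 1) / (φ ^ e - 1)` differ in absolute value unless
`(d, e) = (3, 2)`. -/
theorem abs_pow_sub_one_mul_ne {d e : ℕ} (he : 1 ≤ e) (hed : e < d) (hne : ¬ (d = 3 ∧ e = 2)) :
    |emb (phi ^ d - 1) * embConj (phi ^ e - 1)| ≠ |embConj (phi ^ d - 1) * emb (phi ^ e - 1)| := by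
  obtain ⟨s, rfl⟩ : ∃ s, d = e + s := ⟨d - e, by omega⟩
  have hs : 1 ≤ s := by omega
  have hmul : goldenRatio ^ e * goldenConj ^ e = (-1) ^ e := by
    rw [← mul_pow, Real.goldenRatio_mul_goldenConj]
  simp only [map_sub, map_pow, emb_phi, embConj_phi, map_one]
  intro h
  rw [abs_eq_abs, pow_add, pow_add] at h
  rcases h with h | h
  · have hF : ∀ k, goldenRatio ^ k - goldenConj ^ k = √5 * Nat.fib k := fun k => by
      rw [Real.coe_fib_eq]; field_simp
    have h1 : √5 * ((-1) ^ e * Nat.fib s + Nat.fib e) = √5 * Nat.fib (e + s) := by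
      rw [mul_add, mul_left_comm, ← hF, ← hF, ← hF, pow_add, pow_add]
      linear_combination h - (goldenRatio ^ s - goldenConj ^ s) * hmul
    have h2 := mul_left_cancel₀ (by positivity) h1
    have h3 : Nat.fib (e + s) = Nat.fib (e - 1) * Nat.fib s + Nat.fib e * Nat.fib (s + 1) := by
      have := Nat.fib_add (e - 1) s
      rwa [show e - 1 + s + 1 = e + s by omega, show e - 1 + 1 = e by omega] at this
    have f1 : 1 ≤ Nat.fib e := Nat.fib_pos.2 he
    have f2 : 1 ≤ Nat.fib s := Nat.fib_pos.2 hs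
    have f3 : 1 ≤ Nat.fib (s + 1) := Nat.fib_pos.2 (by omega)
    rcases Nat.even_or_odd e with ev | od
    · have he2 : 2 ≤ e := by obtain ⟨k, hk⟩ := ev; omega
      have f4 : 1 ≤ Nat.fib (e - 1) := Nat.fib_pos.2 (by omega)
      rw [ev.neg_one_pow, one_mul] at h2
      have h4 : Nat.fib s + Nat.fib e = Nat.fib (e + s) := by exact_mod_cast h2
      have g1 : Nat.fib (s + 1) < 2 := by nlinarith
      have g2 : Nat.fib (e - 1) < 2 := by nlinarith
      have s1 : s + 1 < 3 := by
        by_contra! hh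
        have := Nat.fib_mono hh
        simp [Nat.fib_add_two] at this g1
        omega
      have s2 : e - 1 < 3 := by
        by_contra! hh
        have := Nat.fib_mono hh
        simp [Nat.fib_add_two] at this g2
        omega
      have : e ≠ 3 := by rintro rfl; exact absurd ev (by decide)
      omega
    · rw [od.neg_one_pow] at h2
      have h4 : (Nat.fib e : ℝ) = Nat.fib (e + s) + Nat.fib s := by linarith
      have h5 : Nat.fib e = Nat.fib (e + s) + Nat.fib s := by exact_mod_cast h4
      have := Nat.fib_mono (Nat.le_add_right e s)
      omega
  · have h1 : (-1 : ℝ) ^ e * lucas s + 2 = lucas (e + s) + lucas e := by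
      rw [coe_lucas, coe_lucas, coe_lucas, pow_add, pow_add]
      linear_combination h - (goldenRatio ^ s + goldenConj ^ s) * hmul
    have l1 := (lucas_pos_le e).1
    have l2 := (lucas_pos_le s).1
    have hmono : ∀ k j, 1 ≤ k → lucas k + j ≤ lucas (k + j) := by
      intro k j hk
      induction j with
      | zero => simp
      | succ j ih =>
        have e1 : lucas (k + (j + 1)) = lucas (k + j) + lucas (k + j - 1) := by
          obtain ⟨t, ht⟩ : ∃ t, k + j = t + 1 := ⟨k + j - 1, by omega⟩
          rw [← add_assoc, ht]; rfl
        have := (lucas_pos_le (k + j - 1)).1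
        push_cast
        linarith
    rcases Nat.even_or_odd e with ev | od
    · have he2 : 2 ≤ e := by obtain ⟨k, hk⟩ := ev; omega
      rw [ev.neg_one_pow, one_mul] at h1
      have h4 : lucas s + 2 = lucas (e + s) + lucas e := by exact_mod_cast h1
      have m1 := hmono s e hs
      rw [add_comm s e] at m1
      zify at he2
      linarith
    · rw [od.neg_one_pow] at h1
      have h4 : (2 : ℝ) = lucas (e + s) + lucas e + lucas s := by linarith
      have h5 : (2 : ℤ) = lucas (e + s) + lucas e + lucas s := by exact_mod_cast h4
      have m1 := hmono e s he
      omega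

theorem le_of_lt_goldenRatio_div {E n : ℕ} {t : ℝ} (h : 1 / 2 ^ E < t)
    (ht : t ≤ goldenRatio / goldenRatio ^ n) : n ≤ 2 * E := by
  have hg := goldenRatio_bounds
  by_contra! hn
  have h1 : goldenRatio ^ (2 * E + 1) ≤ goldenRatio ^ n := pow_le_pow_right₀ (by linarith) hn
  have h2 : (2 : ℝ) ^ E ≤ goldenRatio ^ (2 * E) := by
    rw [pow_mul]
    exact pow_le_pow_left₀ (by norm_num) (by rw [Real.goldenRatio_sq]; linarith) _
  have h3 := h.trans_le ht
  rw [div_lt_div_iff₀ (by positivity) (by positivity), one_mul] at h3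
  rw [pow_succ] at h1
  nlinarith

namespace PillaiTriple

variable (T : PillaiTriple)

theorem abs_exponent_sub_le :
    |((T.x₁ : ℤ) - T.x₂)| ≤ T.n₁ ∧ |((T.y₁ : ℤ) - T.y₂)| ≤ T.n₁ := by
  have h1 := exponents_le T.c_pos T.eq₁
  have h2 := exponents_le T.c_pos T.eq₂
  have := T.lt₂₁
  simp only [abs_le]
  omega

theorem form₁ : 0 < T.n₁ * Real.log goldenRatio - (T.x₁ * Real.log 2 + T.y₁ * Real.log 3) ∧
    T.n₁ * Real.log goldenRatio - (T.x₁ * Real.log 2 + T.y₁ * Real.log 3) ≤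
      goldenRatio / goldenRatio ^ (T.n₁ - T.n₃) :=
  abs_log_sub_le T.c_pos T.two_le (by have := T.lt₃₂; have := T.lt₂₁; omega) T.eq₁ T.eq₃

theorem sub_le {ℓ u : ℕ} (hℓ : 2 ≤ ℓ) (hZ : 2 ^ 18 * ℓ * T.n₁ ≤ 2 ^ ℓ)
    (hu : 432 * T.n₁ ≤ u ^ 2) : T.n₁ - T.n₃ ≤ 2 * (20 * (2 ^ 21 * u * ℓ ^ 2)) := by
  have hg := goldenRatio_bounds
  obtain ⟨h1, h2⟩ := T.form₁
  obtain ⟨hx, hy⟩ := exponents_le T.c_pos T.eq₁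
  have hn : 1 ≤ T.n₁ := by have := T.lt₂₁; omega
  refine le_of_lt_goldenRatio_div ?_ h2
  have key := three_log_lower_bound (a := phi) (b := 1) (H := 1) (B := T.n₁) (x := T.x₁)
    (y := T.y₁) (z := -T.n₁) le_rfl (by omega) hℓ hZ
    (by rw [emb_phi, abs_of_pos (by linarith)]; linarith)
    (by rw [embConj_phi]; linarith [abs_goldenConj_le_one])
    (by simp) (by simp) (by rw [emb_phi, map_one, div_one]; linarith)
    (fun p q r h => goldenRatio_independent p q r (by simpa using h))
    (by rw [Nat.abs_cast]; omega) (by rw [Nat.abs_cast]; omega)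
    (by rw [abs_neg, Nat.abs_cast]; simp)
    (by rintro ⟨-, -, h⟩; omega) (by simpa using hu)
  rw [abs_of_neg] at key <;> simp only [emb_phi, map_one, div_one] at * <;> push_cast at * <;>
    linarith

/-- A bound for the smallest of the three numbers `2 ^ x * 3 ^ y`. -/
theorem two_pow_mul_three_pow_le {V W : ℕ}
    (hV : ∀ m d, 1 ≤ d → m + d ≤ T.n₁ → d ≤ T.n₁ - T.n₃ → lucas (m + d) ≠ lucas m →
      ¬ (2 : ℤ) ^ V ∣ lucas (m + d) - lucas m)
    (hW : ∀ m d, 1 ≤ d → m + d ≤ T.n₁ → d ≤ T.n₁ - T.n₃ → lucas (m + d) ≠ lucas m →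
      ¬ (3 : ℤ) ^ W ∣ lucas (m + d) - lucas m) :
    (2 : ℤ) ^ T.x₃ * 3 ^ T.y₃ ≤ 2 ^ V * 3 ^ W := by
  have hmono : ∀ k j, 1 ≤ k → 1 ≤ j → lucas k < lucas (k + j) := by
    intro k j hk hj
    induction j, hj using Nat.le_induction with
    | base =>
      obtain ⟨t, rfl⟩ : ∃ t, k = t + 1 := ⟨k - 1, by omega⟩
      have := (lucas_pos_le t).1
      show lucas (t + 1) < lucas (t + 1) + lucas t
      linarith
    | succ j hj ih =>
      obtain ⟨t, ht⟩ : ∃ t, k + j = t + 1 := ⟨k + j - 1, by omega⟩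
      have := (lucas_pos_le t).1
      have e : lucas (k + (j + 1)) = lucas (t + 1) + lucas t := by rw [← add_assoc, ht]; rfl
      rw [e, ← ht]; linarith
  have h1 := T.two_le
  have h2 := T.lt₃₂
  have h3 := T.lt₂₁
  have key : ∀ n n' x y x' y', 1 ≤ n' → T.n₃ ≤ n' → n' < n → n ≤ T.n₁ →
      lucas n - 2 ^ x * 3 ^ y = T.c → lucas n' - 2 ^ x' * 3 ^ y' = T.c →
      (2 : ℤ) ^ x' * 3 ^ y' < 2 ^ x * 3 ^ y ∧ (x < V ∨ x' < V) ∧ (y < W ∨ y' < W) := by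
    intro n n' x y x' y' hn' h3' hnn hn e e'
    obtain ⟨d, rfl⟩ : ∃ d, n = n' + d := ⟨n - n', by omega⟩
    have hl := hmono n' d hn' (by omega)
    have heq : lucas (n' + d) - lucas n' = 2 ^ x * 3 ^ y - 2 ^ x' * 3 ^ y' := by linarith
    refine ⟨by linarith, ?_, ?_⟩
    · by_contra! hc
      refine hV n' d (by omega) hn (by omega) hl.ne' (heq ▸ dvd_sub ?_ ?_)
      · exact (pow_dvd_pow 2 hc.1).trans (dvd_mul_right _ _)
      · exact (pow_dvd_pow 2 hc.2).trans (dvd_mul_right _ _)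
    · by_contra! hc
      refine hW n' d (by omega) hn (by omega) hl.ne' (heq ▸ dvd_sub ?_ ?_)
      · exact (pow_dvd_pow 3 hc.1).trans (dvd_mul_left _ _)
      · exact (pow_dvd_pow 3 hc.2).trans (dvd_mul_left _ _)
  obtain ⟨a1, a2, a3⟩ := key _ _ _ _ _ _ (by omega) (by omega) h3 le_rfl T.eq₁ T.eq₂
  obtain ⟨b1, b2, b3⟩ := key _ _ _ _ _ _ (by omega) (by omega) (by omega) le_rfl T.eq₁ T.eq₃
  obtain ⟨c1, c2, c3⟩ := key _ _ _ _ _ _ (by omega) (by omega) h2 h3.le T.eq₂ T.eq₃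
  have fin : ∀ x y, x < V → y < W → (2 : ℤ) ^ x * 3 ^ y ≤ 2 ^ V * 3 ^ W := by
    intro x y hx hy
    exact mul_le_mul (pow_le_pow_right₀ (by norm_num) hx.le)
      (pow_le_pow_right₀ (by norm_num) hy.le) (by positivity) (by positivity)
  by_cases hx3 : T.x₃ < V <;> by_cases hy3 : T.y₃ < W
  · exact fin _ _ hx3 hy3
  · have := fin T.x₁ T.y₁
    have := fin T.x₂ T.y₂
    by_cases hx1 : T.x₁ < V
    · exact b1.le.trans (fin _ _ hx1 (by omega))
    · exact c1.le.trans (fin _ _ (by omega) (by omega))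
  · by_cases hy1 : T.y₁ < W
    · exact b1.le.trans (fin _ _ (by omega) hy1)
    · exact c1.le.trans (fin _ _ (by omega) (by omega))
  · exact b1.le.trans (fin _ _ (by omega) (by omega))

theorem two_pow_mul_three_pow_le_two_pow {ℓ : ℕ} (hℓ : 2 ≤ ℓ)
    (hZ : 2 ^ 18 * ℓ * T.n₁ ≤ 2 ^ ℓ) :
    (2 : ℤ) ^ T.x₃ * 3 ^ T.y₃ ≤ 2 ^ (8 * (2 ^ 21 * (T.n₁ - T.n₃ + 2) * ℓ ^ 2)) := by
  set V := 2 ^ 21 * (T.n₁ - T.n₃ + 2) * ℓ ^ 2 with hVdef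
  have aux : ∀ q : ℕ, 9 ≤ q → (q : ZPhi) ∣ phi ^ 24 - 1 →
      ∀ m d, 1 ≤ d → m + d ≤ T.n₁ → d ≤ T.n₁ - T.n₃ → lucas (m + d) ≠ lucas m →
      ¬ (q : ℤ) ^ V ∣ lucas (m + d) - lucas m := by
    intro q hq9 hq m d hd hmd hdD hne hdvd
    have hb : 2 * m + 2 * d + 2 ≤ 32 * T.n₁ := by omega
    refine not_pow_dvd_lucas_sub hq hq9 hd hℓ ?_ hne ((pow_dvd_pow _ ?_).trans hdvd)
    · calc _ ≤ 2 ^ 13 * ℓ * (32 * T.n₁) := Nat.mul_le_mul_left _ hb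
        _ = 2 ^ 18 * ℓ * T.n₁ := by ring
        _ ≤ _ := hZ
    · rw [hVdef]; gcongr
  have h24 : phi ^ 24 - 1 = ((144 : ℕ) : ZPhi) * ⟨199, 322⟩ := by
    have h4 : phi ^ 4 = ⟨2, 3⟩ := by ext <;> simp [phi, pow_succ]
    rw [show phi ^ 24 = ((phi ^ 4) ^ 2) ^ 3 by rw [← pow_mul, ← pow_mul], h4,
      show ((144 : ℕ) : ZPhi) = ⟨144, 0⟩ from rfl, show (1 : ZPhi) = ⟨1, 0⟩ from rfl]
    ext <;> simp [pow_succ]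
  have h16 : ((16 : ℕ) : ZPhi) ∣ phi ^ 24 - 1 :=
    h24 ▸ (Nat.cast_dvd_cast (by norm_num)).mul_right _
  have h9 : ((9 : ℕ) : ZPhi) ∣ phi ^ 24 - 1 :=
    h24 ▸ (Nat.cast_dvd_cast (by norm_num)).mul_right _
  have h := T.two_pow_mul_three_pow_le (V := 4 * V) (W := 2 * V)
    (fun m d h1 h2 h3 h4 => by
      rw [pow_mul]; exact_mod_cast aux 16 (by norm_num) h16 m d h1 h2 h3 h4)
    (fun m d h1 h2 h3 h4 => by rw [pow_mul]; exact_mod_cast aux 9 (by norm_num) h9 m d h1 h2 h3 h4)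
  refine h.trans ?_
  have e : (3 : ℤ) ^ (2 * V) ≤ 2 ^ (4 * V) := by
    rw [pow_mul 3 2 V, pow_mul 2 4 V]; exact pow_le_pow_left₀ (by norm_num) (by norm_num) _
  rw [show 8 * V = 4 * V + 4 * V by ring, pow_add]
  exact mul_le_mul_of_nonneg_left e (pow_nonneg (by norm_num) _)

theorem form₂ : 0 ≤ T.x₁ * Real.log 2 + T.y₁ * Real.log 3 - T.n₃ * Real.log goldenRatio -
      Real.log (goldenRatio ^ (T.n₁ - T.n₃) - 1) ∧
    T.x₁ * Real.log 2 + T.y₁ * Real.log 3 - T.n₃ * Real.log goldenRatio -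
      Real.log (goldenRatio ^ (T.n₁ - T.n₃) - 1) ≤
      2 * (2 ^ T.x₃ * 3 ^ T.y₃) * goldenRatio / goldenRatio ^ T.n₃ := by
  have h2 := T.lt₃₂
  have h3 := T.lt₂₁
  refine log_sub_log_le T.two_le (by omega) ?_ T.eq₃
  rw [show T.n₃ + (T.n₁ - T.n₃) = T.n₁ by omega]
  exact T.eq₁

theorem form₃ : 0 ≤ T.x₂ * Real.log 2 + T.y₂ * Real.log 3 - T.n₃ * Real.log goldenRatio -
      Real.log (goldenRatio ^ (T.n₂ - T.n₃) - 1) ∧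
    T.x₂ * Real.log 2 + T.y₂ * Real.log 3 - T.n₃ * Real.log goldenRatio -
      Real.log (goldenRatio ^ (T.n₂ - T.n₃) - 1) ≤
      2 * (2 ^ T.x₃ * 3 ^ T.y₃) * goldenRatio / goldenRatio ^ T.n₃ := by
  have h2 := T.lt₃₂
  refine log_sub_log_le T.two_le (by omega) ?_ T.eq₃
  rw [show T.n₃ + (T.n₂ - T.n₃) = T.n₂ by omega]
  exact T.eq₂

theorem emb_phi_pow_sub_one {d H : ℕ} (hd : 1 ≤ d) (hdH : d ≤ H) :
    0 < emb (phi ^ d - 1) ∧ |emb (phi ^ d - 1)| ≤ 2 ^ H ∧ |embConj (phi ^ d - 1)| ≤ 2 ^ H := by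
  have hg := goldenRatio_bounds
  have h1 : 1 < goldenRatio ^ d := one_lt_pow₀ (by linarith) (by omega)
  have h2 : goldenRatio ^ d ≤ 2 ^ d := pow_le_pow_left₀ (by linarith) (by linarith) _
  have h3 : (2 : ℝ) ^ d ≤ 2 ^ H := pow_le_pow_right₀ (by norm_num) hdH
  have h4 : (2 : ℝ) ^ 1 ≤ 2 ^ d := pow_le_pow_right₀ (by norm_num) hd
  have h5 := abs_le.1 ((abs_pow goldenConj d).trans_le
    (pow_le_one₀ (abs_nonneg _) abs_goldenConj_le_one))
  simp only [map_sub, map_pow, emb_phi, embConj_phi, map_one]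
  refine ⟨by linarith, ?_, ?_⟩
  · rw [abs_of_pos (by linarith)]; linarith
  · rw [abs_le]; constructor <;> linarith

theorem le_add {ℓ u W : ℕ} (hℓ : 2 ≤ ℓ) (hZ : 2 ^ 18 * ℓ * T.n₁ ≤ 2 ^ ℓ)
    (hu : 432 * (T.n₁ - T.n₃) * T.n₁ ≤ u ^ 2) (hW : (2 : ℤ) ^ T.x₃ * 3 ^ T.y₃ ≤ 2 ^ W) :
    T.n₁ ≤ T.n₁ - T.n₃ + 2 * (20 * (2 ^ 21 * u * ℓ ^ 2) + (W + 1)) := by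
  have hg := goldenRatio_bounds
  have t1 := T.two_le
  have t2 := T.lt₃₂
  have t3 := T.lt₂₁
  obtain ⟨f1, f2⟩ := T.form₂
  obtain ⟨g1, g2⟩ := T.form₃
  obtain ⟨hx, hy⟩ := T.abs_exponent_sub_le
  have hW' : (2 : ℝ) ^ T.x₃ * 3 ^ T.y₃ ≤ 2 ^ W := by exact_mod_cast hW
  have hpos : 0 < goldenRatio ^ T.n₃ := by positivity
  have hub : 2 * (2 ^ T.x₃ * 3 ^ T.y₃) * goldenRatio / goldenRatio ^ T.n₃ ≤
      2 ^ (W + 1) * (goldenRatio / goldenRatio ^ T.n₃) := by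
    rw [mul_div_assoc, pow_succ]
    exact mul_le_mul_of_nonneg_right (by linarith) (by positivity)
  suffices h : 1 / (2 : ℝ) ^ (20 * (2 ^ 21 * u * ℓ ^ 2)) <
      2 ^ (W + 1) * (goldenRatio / goldenRatio ^ T.n₃) by
    have := le_of_lt_goldenRatio_div (E := 20 * (2 ^ 21 * u * ℓ ^ 2) + (W + 1)) (n := T.n₃)
      (t := goldenRatio / goldenRatio ^ T.n₃) (by
        rw [pow_add, one_div, mul_inv, ← one_div, ← div_eq_mul_inv,
          div_lt_iff₀ (by positivity)]
        linarith) le_rfl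
    omega
  by_cases hne : T.n₁ - T.n₃ = 3 ∧ T.n₂ - T.n₃ = 2
  · have hl : ∀ n, lucas (n + 2) = lucas (n + 1) + lucas n := fun _ => rfl
    have e1 := T.eq₁
    have e2 := T.eq₂
    have e3 := T.eq₃
    rw [show T.n₁ = T.n₃ + 1 + 2 by omega, hl, hl] at e1
    rw [show T.n₂ = T.n₃ + 2 by omega, hl] at e2
    have hne2 : (2 : ℤ) ^ T.x₁ * 3 ^ T.y₁ ≠ 2 * (2 ^ T.x₂ * 3 ^ T.y₂) := by
      have : (0 : ℤ) < 2 ^ T.x₃ * 3 ^ T.y₃ := by positivity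
      intro h
      linarith
    have l3 : Real.log (goldenRatio ^ 3 - 1) = Real.log 2 + Real.log goldenRatio := by
      rw [← Real.log_mul (by norm_num) (by positivity)]
      congr 1
      linear_combination (goldenRatio + 1) * Real.goldenRatio_sq
    have l2 : Real.log (goldenRatio ^ 2 - 1) = Real.log goldenRatio := by
      rw [Real.goldenRatio_sq, add_sub_cancel_right]
    rw [hne.1, l3] at f1 f2
    rw [hne.2, l2] at g1 g2
    obtain ⟨hx1, -⟩ := exponents_le T.c_pos T.eq₁
    obtain ⟨hx2, -⟩ := exponents_le T.c_pos T.eq₂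
    have key := three_log_lower_bound (a := phi) (b := 1) (H := 1) (B := T.n₁)
      (x := T.x₁ - T.x₂ - 1) (y := T.y₁ - T.y₂) (z := 0) le_rfl (by omega) hℓ hZ
      (by rw [emb_phi, abs_of_pos (by linarith)]; linarith)
      (by rw [embConj_phi]; linarith [abs_goldenConj_le_one])
      (by simp) (by simp) (by rw [emb_phi, map_one, div_one]; linarith)
      (fun p q r h => goldenRatio_independent p q r (by simpa using h))
      (by rw [abs_le]; omega) hy (by simp)
      (by
        rintro ⟨h1, h2, -⟩
        apply hne2
        rw [show T.x₁ = T.x₂ + 1 by omega, show T.y₁ = T.y₂ by omega]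
        ring)
      ((by rw [hne.1]; omega : 432 * 1 * T.n₁ ≤ 432 * (T.n₁ - T.n₃) * T.n₁).trans hu)
    refine (key.trans_le ?_).trans_le hub
    push_cast
    rw [abs_le]
    constructor <;> linarith
  · have hD : 2 ≤ T.n₁ - T.n₃ := by omega
    obtain ⟨a1, a2, a3⟩ := emb_phi_pow_sub_one (by omega : 1 ≤ T.n₁ - T.n₃) le_rfl
    obtain ⟨b1, b2, b3⟩ := emb_phi_pow_sub_one (by omega : 1 ≤ T.n₂ - T.n₃)
      (by omega : T.n₂ - T.n₃ ≤ T.n₁ - T.n₃)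
    have key := three_log_lower_bound (a := phi ^ (T.n₁ - T.n₃) - 1)
      (b := phi ^ (T.n₂ - T.n₃) - 1) (H := T.n₁ - T.n₃) (B := T.n₁) (x := T.x₁ - T.x₂)
      (y := T.y₁ - T.y₂) (z := -1) (by omega) (by omega) hℓ hZ a2 a3 b2 b3
      (div_pos a1 b1)
      (multiplicatively_independent (div_pos a1 b1)
        (abs_pow_sub_one_mul_ne (by omega) (by omega) hne))
      hx hy (by rw [abs_neg, abs_one, mul_one]; omega) (by rintro ⟨-, -, h⟩; omega) hu
    rw [Real.log_div a1.ne' b1.ne'] at key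
    simp only [map_sub, map_pow, emb_phi, map_one] at key
    refine (key.trans_le ?_).trans_le hub
    push_cast
    rw [abs_le]
    constructor <;> linarith

/-- One step of the descent on the size of the indices. -/
theorem descent {ℓ u N D : ℕ} (hN : T.n₁ ≤ N) (hD : T.n₁ - T.n₃ ≤ D) (hℓ : 2 ≤ ℓ)
    (hZ : 2 ^ 18 * ℓ * N ≤ 2 ^ ℓ) (hu : 432 * D * N ≤ u ^ 2) :
    T.n₁ ≤ D + 2 * (20 * (2 ^ 21 * u * ℓ ^ 2) + (8 * (2 ^ 21 * (D + 2) * ℓ ^ 2) + 1)) := by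
  have hZ' : 2 ^ 18 * ℓ * T.n₁ ≤ 2 ^ ℓ := (Nat.mul_le_mul_left _ hN).trans hZ
  have hu' : 432 * (T.n₁ - T.n₃) * T.n₁ ≤ u ^ 2 :=
    (Nat.mul_le_mul (Nat.mul_le_mul_left _ hD) hN).trans hu
  refine (T.le_add hℓ hZ' hu' (T.two_pow_mul_three_pow_le_two_pow hℓ hZ')).trans ?_
  gcongr

set_option exponentiation.threshold 400 in
theorem lt_two_pow_320 : T.n₁ < 2 ^ 320 := by
  by_contra! hn
  obtain ⟨j, hj1, hj2⟩ : ∃ j, T.n₁ < 2 ^ (8 * j) ∧ 2 ^ (8 * (j - 1)) ≤ T.n₁ := by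
    have hex : ∃ j, T.n₁ < 2 ^ (8 * j) := ⟨T.n₁, Nat.lt_two_pow_self.trans_le
      (Nat.pow_le_pow_right (by norm_num) (by omega))⟩
    classical
    refine ⟨Nat.find hex, Nat.find_spec hex, ?_⟩
    have h0 : Nat.find hex ≠ 0 := fun h => by
      have := Nat.find_spec hex
      rw [h] at this
      have h1 : (1 : ℕ) ≤ 2 ^ 320 := Nat.one_le_two_pow
      omega
    exact not_lt.1 (Nat.find_min hex (by omega))
  have hj : 41 ≤ j := by
    by_contra! hj
    have : 2 ^ (8 * j) ≤ 2 ^ 320 := Nat.pow_le_pow_right (by norm_num) (by omega)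
    omega
  have g1 : 2 ^ 18 * (9 * j) ≤ 2 ^ j := by
    clear hj1 hj2
    induction j, hj using Nat.le_induction with
    | base => norm_num
    | succ k hk ih => rw [pow_succ]; omega
  have g2 : 2 ^ 65 * j ^ 3 ≤ 2 ^ (2 * j) := by
    clear hj1 hj2 g1
    induction j, hj using Nat.le_induction with
    | base => norm_num
    | succ k hk ih =>
      rw [mul_add, pow_add]
      have : (k + 1) ^ 3 ≤ 4 * k ^ 3 := by
        nlinarith [Nat.mul_le_mul_right (k ^ 2) hk, Nat.mul_le_mul_right k hk]
      omega
  have hZ : 2 ^ 18 * (9 * j) * 2 ^ (8 * j) ≤ 2 ^ (9 * j) := by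
    calc _ ≤ 2 ^ j * 2 ^ (8 * j) := Nat.mul_le_mul_right _ g1
      _ = _ := by rw [← pow_add]; congr 1; ring
  have hA : ∀ i, 2 ^ (2 * i * j) = (2 ^ (2 * j)) ^ i := fun i => by
    rw [← pow_mul]; congr 1; ring
  have hA8 : 2 ^ (8 * j) = (2 ^ (2 * j)) ^ 4 := hA 4
  have hD := T.sub_le (u := 21 * (2 ^ (2 * j)) ^ 2) (by omega : 2 ≤ 9 * j)
    ((Nat.mul_le_mul_left _ hj1.le).trans hZ) (by
      rw [hA8] at hj1
      have : (21 * (2 ^ (2 * j)) ^ 2) ^ 2 = 441 * (2 ^ (2 * j)) ^ 4 := by ring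
      omega)
  have hn' := T.descent hj1.le hD (by omega) hZ (u := 2 ^ 23 * j * (2 ^ (2 * j)) ^ 3) (by
    rw [hA8]
    generalize 2 ^ (2 * j) = A
    calc _ = 864 * 20 * 21 * 81 * 2 ^ 21 * (j ^ 2 * A ^ 6) := by ring
      _ ≤ 2 ^ 46 * (j ^ 2 * A ^ 6) := Nat.mul_le_mul_right _ (by norm_num)
      _ = _ := by ring)
  have hlow : 2 ^ (8 * j) = 256 * 2 ^ (8 * (j - 1)) := by
    rw [show (256 : ℕ) = 2 ^ 8 by norm_num, ← pow_add]; congr 1; omega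
  rw [hA8] at hlow
  generalize 2 ^ (2 * j) = A at *
  have k1 : 2 ^ 65 * (A ^ 3 * j ^ 3) ≤ A ^ 4 := by
    calc _ = A ^ 3 * (2 ^ 65 * j ^ 3) := by ring
      _ ≤ A ^ 3 * A := Nat.mul_le_mul_left _ g2
      _ = _ := by ring
  have hA1 : 1 ≤ A := by
    have : 0 < j ^ 3 := Nat.pow_pos (by omega)
    omega
  have k2 : 2 ^ 130 * (A ^ 2 * j ^ 6) ≤ A ^ 4 := by
    calc _ = A ^ 2 * (2 ^ 65 * j ^ 3) ^ 2 := by ring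
      _ ≤ A ^ 2 * A ^ 2 := Nat.mul_le_mul_left _ (Nat.pow_le_pow_left g2 2)
      _ = _ := by ring
  have k3 : A ^ 2 * j ^ 2 ≤ A ^ 2 * j ^ 6 :=
    Nat.mul_le_mul_left _ (Nat.pow_le_pow_right (by omega) (by norm_num))
  have k4 : A ^ 2 * j ^ 4 ≤ A ^ 2 * j ^ 6 :=
    Nat.mul_le_mul_left _ (Nat.pow_le_pow_right (by omega) (by norm_num))
  have k5 : j ^ 2 ≤ A ^ 2 * j ^ 6 :=
    (Nat.pow_le_pow_right (by omega) (by norm_num)).trans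
      (Nat.le_mul_of_pos_left (j ^ 6) (by positivity))
  have k6 : 1 ≤ A ^ 2 * j ^ 6 := Nat.one_le_iff_ne_zero.2 (by positivity)
  have e : 2 * (20 * (2 ^ 21 * (21 * A ^ 2) * (9 * j) ^ 2)) +
      2 * (20 * (2 ^ 21 * (2 ^ 23 * j * A ^ 3) * (9 * j) ^ 2) +
      (8 * (2 ^ 21 * (2 * (20 * (2 ^ 21 * (21 * A ^ 2) * (9 * j) ^ 2)) + 2) * (9 * j) ^ 2) + 1)) =
      2 * 20 * 21 * 81 * 2 ^ 21 * (A ^ 2 * j ^ 2) + 40 * 81 * 2 ^ 44 * (A ^ 3 * j ^ 3) +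
      16 * 81 * 81 * 40 * 21 * 2 ^ 42 * (A ^ 2 * j ^ 4) + 32 * 81 * 2 ^ 21 * j ^ 2 + 2 := by ring
  rw [e] at hn'
  clear e
  generalize A ^ 2 * j ^ 6 = Y at *
  generalize A ^ 2 * j ^ 4 = Y4 at *
  generalize A ^ 2 * j ^ 2 = Y2 at *
  generalize A ^ 3 * j ^ 3 = Z at *
  generalize A ^ 4 = X at *
  generalize 2 ^ (8 * (j - 1)) = X' at *
  generalize j ^ 2 = J at *
  omega

end PillaiTriple

theorem fib_add_twelve (n : ℕ) : Nat.fib (n + 12) = 89 * Nat.fib n + 144 * Nat.fib (n + 1) := by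
  have := Nat.fib_add n 11
  rw [show n + 12 = n + 11 + 1 by ring, this]
  norm_num [Nat.fib]
  ring

theorem fib_mod_eight (n : ℕ) : Nat.fib n % 8 = Nat.fib (n % 12) % 8 := by
  induction n using Nat.strong_induction_on with
  | _ n ih =>
    rcases lt_or_ge n 12 with h | h
    · rw [Nat.mod_eq_of_lt h]
    · obtain ⟨k, rfl⟩ : ∃ k, n = k + 12 := ⟨n - 12, by omega⟩
      have := ih k (by omega)
      rw [Nat.add_mod_right, fib_add_twelve]
      omega

theorem two_mul_fib_succ_mod_eight {s : ℕ} (hs : s % 3 = 0) :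
    (2 * Nat.fib (s + 1) - Nat.fib s) % 4 = 2 ∨
      (2 * Nat.fib (s + 1) - Nat.fib s) % 8 = 4 ∧ Nat.fib s % 4 = 2 := by
  have h1 := fib_mod_eight s
  have h2 := fib_mod_eight (s + 1)
  have h3 := Nat.fib_le_fib_succ (n := s)
  have h4 : s % 12 = 0 ∨ s % 12 = 3 ∨ s % 12 = 6 ∨ s % 12 = 9 := by omega
  have f : ∀ k < 12, s % 12 = k → Nat.fib s % 8 = Nat.fib k % 8 ∧
      Nat.fib (s + 1) % 8 = Nat.fib ((k + 1) % 12) % 8 := fun k hk h ↦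
    ⟨h ▸ h1, by rw [h2, show (s + 1) % 12 = (k + 1) % 12 by omega]⟩
  rcases h4 with h | h | h | h
  · obtain ⟨h1, h2⟩ := f _ (by norm_num) h
    norm_num at h1 h2
    omega
  · obtain ⟨h1, h2⟩ := f _ (by norm_num) h
    change _ = 2 at h1; change _ = 3 at h2
    omega
  · obtain ⟨h1, h2⟩ := f _ (by norm_num) h
    change _ = 0 at h1; change _ = 5 at h2
    omega
  · obtain ⟨h1, h2⟩ := f _ (by norm_num) h
    change _ = 2 at h1; change _ = 7 at h2
    omega

/-- If `2 ^ k` divides `F_r` then it divides `4 * r`. -/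
theorem two_pow_dvd_four_mul (k r : ℕ) (h : 2 ^ k ∣ Nat.fib r) : 2 ^ k ∣ 4 * r := by
  induction r using Nat.strong_induction_on generalizing k with
  | _ r ih =>
    rcases Nat.eq_zero_or_pos r with rfl | hr
    · simp
    rcases le_or_gt k 2 with hk | hk
    · exact ((pow_dvd_pow 2 hk).trans (by norm_num : 2 ^ 2 ∣ 4)).mul_right r
    · have h8 : 8 ∣ Nat.fib r := (pow_dvd_pow 2 hk).trans h
      have h6 : r % 6 = 0 := by
        have h1 := fib_mod_eight r
        rw [Nat.mod_eq_zero_of_dvd h8] at h1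
        have h2 : r % 12 < 12 := Nat.mod_lt _ (by norm_num)
        interval_cases hh : r % 12 <;> first | omega | (norm_num [Nat.fib] at h1)
      obtain ⟨s, rfl⟩ : ∃ s, r = 2 * s := ⟨r / 2, by omega⟩
      rw [Nat.fib_two_mul] at h
      obtain ⟨j, rfl⟩ : ∃ j, k = j + 3 := ⟨k - 3, by omega⟩
      rcases two_mul_fib_succ_mod_eight (by omega : s % 3 = 0) with h2 | ⟨h4, hF⟩
      · obtain ⟨o, ho⟩ : ∃ o, 2 * Nat.fib (s + 1) - Nat.fib s = 2 * o :=
          ⟨(2 * Nat.fib (s + 1) - Nat.fib s) / 2, by omega⟩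
        have hodd : Nat.Coprime (2 ^ (j + 2)) o := by
          apply Nat.Coprime.pow_left
          rw [Nat.coprime_two_left, Nat.odd_iff]; omega
        rw [ho, show Nat.fib s * (2 * o) = 2 * (Nat.fib s * o) by ring,
          show j + 3 = (j + 2) + 1 by ring, pow_succ', Nat.mul_dvd_mul_iff_left (by norm_num)] at h
        have := ih s (by omega) (j + 2) (hodd.dvd_of_dvd_mul_right h)
        rw [show j + 3 = (j + 2) + 1 by ring, pow_succ', show 4 * (2 * s) = 2 * (4 * s) by ring]
        exact Nat.mul_dvd_mul_left 2 this
      · obtain ⟨o, ho⟩ : ∃ o, 2 * Nat.fib (s + 1) - Nat.fib s = 4 * o :=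
          ⟨(2 * Nat.fib (s + 1) - Nat.fib s) / 4, by omega⟩
        obtain ⟨o', ho'⟩ : ∃ o', Nat.fib s = 2 * o' := ⟨Nat.fib s / 2, by omega⟩
        rw [ho, ho', show 2 * o' * (4 * o) = 8 * (o' * o) by ring, pow_add, mul_comm (2 ^ j),
          show 2 ^ 3 = 8 by norm_num, Nat.mul_dvd_mul_iff_left (by norm_num)] at h
        have hodd : Nat.Coprime (2 ^ j) (o' * o) := by
          apply Nat.Coprime.pow_left
          rw [Nat.coprime_two_left]
          exact (Nat.odd_iff.2 (by omega)).mul (Nat.odd_iff.2 (by omega))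
        have h1 : 2 ^ j = 1 := Nat.Coprime.eq_one_of_dvd hodd h
        rw [pow_add, h1]
        exact ⟨s, by ring⟩

theorem fib_mod_nine (n : ℕ) : (9 ∣ Nat.fib n ↔ n % 12 = 0) ∧ (3 ∣ Nat.fib n ↔ n % 4 = 0) := by
  induction n using Nat.strong_induction_on with
  | _ n ih =>
    rcases lt_or_ge n 12 with h | h
    · interval_cases n <;> norm_num [Nat.fib]
    · obtain ⟨k, rfl⟩ : ∃ k, n = k + 12 := ⟨n - 12, by omega⟩
      have := ih k (by omega)
      rw [fib_add_twelve]
      omega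

theorem fib_three_mul (s : ℕ) (hs : s % 2 = 0) :
    Nat.fib (3 * s) = Nat.fib s * (5 * Nat.fib s ^ 2 + 3) := by
  have h5 : (0 : ℝ) < √5 := by positivity
  have h52 : √5 ^ 2 = 5 := Real.sq_sqrt (by norm_num)
  have key : (Nat.fib (3 * s) : ℝ) = Nat.fib s * (5 * Nat.fib s ^ 2 + 3) := by
    rw [Real.coe_fib_eq, Real.coe_fib_eq, pow_mul', pow_mul']
    have h : goldenRatio ^ s * goldenConj ^ s = 1 := by
      rw [← mul_pow, Real.goldenRatio_mul_goldenConj]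
      exact (Nat.even_iff.2 hs).neg_one_pow
    generalize goldenRatio ^ s = A at *
    generalize goldenConj ^ s = B at *
    field_simp
    rw [h52]
    linear_combination (15 * A - 15 * B) * h
  exact_mod_cast key

/-- If `3 ^ k` divides `F_r` then it divides `3 * r`. -/
theorem three_pow_dvd_three_mul (k r : ℕ) (h : 3 ^ k ∣ Nat.fib r) : 3 ^ k ∣ 3 * r := by
  induction r using Nat.strong_induction_on generalizing k with
  | _ r ih =>
    rcases Nat.eq_zero_or_pos r with rfl | hr
    · simp
    rcases le_or_gt k 1 with hk | hk
    · exact ((pow_dvd_pow 3 hk).trans (by norm_num : 3 ^ 1 ∣ 3)).mul_right r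
    · have h12 := (fib_mod_nine r).1.1 ((pow_dvd_pow 3 hk).trans h)
      obtain ⟨s, rfl⟩ : ∃ s, r = 3 * s := ⟨r / 3, by omega⟩
      obtain ⟨o, ho⟩ := (fib_mod_nine s).2.2 (by omega)
      obtain ⟨j, rfl⟩ : ∃ j, k = j + 1 := ⟨k - 1, by omega⟩
      rw [fib_three_mul s (by omega), show Nat.fib s * (5 * Nat.fib s ^ 2 + 3) =
        3 * (Nat.fib s * (5 * o * Nat.fib s + 1)) by rw [ho]; ring, pow_succ',
        Nat.mul_dvd_mul_iff_left (by norm_num)] at h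
      have hc : Nat.Coprime (3 ^ j) (5 * o * Nat.fib s + 1) := by
        apply Nat.Coprime.pow_left
        rw [Nat.Prime.coprime_iff_not_dvd Nat.prime_three, ho]
        have : 5 * o * (3 * o) = 3 * (5 * o * o) := by ring
        omega
      rw [pow_succ']
      exact Nat.mul_dvd_mul_left 3 (ih s (by omega) j (hc.dvd_of_dvd_mul_right h))

/-- `L_{m+d} - L_m`. -/
def lucasDiff (d m : ℕ) : ℤ := lucas (m + d) - lucas m

theorem sqrt_five_mul_fib (k : ℕ) : √5 * Nat.fib k = goldenRatio ^ k - goldenConj ^ k := by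
  rw [Real.coe_fib_eq]; field_simp

/-- The determinant identity linking two values of `lucasDiff`. -/
theorem lucasDiff_mul_sub (d m r : ℕ) :
    lucasDiff d m * (Nat.fib (m + r + d) - Nat.fib (m + r)) -
      lucasDiff d (m + r) * (Nat.fib (m + d) - Nat.fib m) =
      Nat.fib r * (2 * (-1) ^ m * ((-1) ^ d + 1 - lucas d)) := by
  have h5 : √5 ≠ 0 := by positivity
  have hm : goldenRatio ^ m * goldenConj ^ m = (-1) ^ m := by
    rw [← mul_pow, Real.goldenRatio_mul_goldenConj]
  have hd : goldenRatio ^ d * goldenConj ^ d = (-1) ^ d := by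
    rw [← mul_pow, Real.goldenRatio_mul_goldenConj]
  have key : √5 * (((lucas (m + d) : ℝ) - lucas m) * (Nat.fib (m + r + d) - Nat.fib (m + r)) -
      (lucas (m + r + d) - lucas (m + r)) * (Nat.fib (m + d) - Nat.fib m)) =
      √5 * (Nat.fib r * (2 * (-1) ^ m * ((-1) ^ d + 1 - lucas d))) := by
    have e : √5 * (((lucas (m + d) : ℝ) - lucas m) * (Nat.fib (m + r + d) - Nat.fib (m + r)) -
      (lucas (m + r + d) - lucas (m + r)) * (Nat.fib (m + d) - Nat.fib m)) =
      ((lucas (m + d) : ℝ) - lucas m) * (√5 * Nat.fib (m + r + d) - √5 * Nat.fib (m + r)) -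
      (lucas (m + r + d) - lucas (m + r)) * (√5 * Nat.fib (m + d) - √5 * Nat.fib m) := by ring
    rw [e, ← mul_assoc]
    simp only [sqrt_five_mul_fib, coe_lucas, ← hm, ← hd, pow_add]
    ring
  have := mul_left_cancel₀ h5 key
  simp only [lucasDiff]
  exact_mod_cast this

/-- If `q` divides two values of `lucasDiff d` then it divides the corresponding multiple of a
Fibonacci number. -/
theorem dvd_fib_mul {q : ℤ} {d m r : ℕ} (hd : Odd d) (h1 : q ∣ lucasDiff d m)
    (h2 : q ∣ lucasDiff d (m + r)) : q ∣ Nat.fib r * (2 * lucas d) := by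
  have h := lucasDiff_mul_sub d m r
  have h3 : q ∣ Nat.fib r * (2 * (-1) ^ m * ((-1) ^ d + 1 - lucas d)) :=
    h ▸ dvd_sub (h1.mul_right _) (h2.mul_right _)
  rw [hd.neg_one_pow] at h3
  obtain ⟨w, hw⟩ := h3
  rcases neg_one_pow_eq_or ℤ m with e | e <;> rw [e] at hw
  · exact ⟨-w, by linear_combination -hw⟩
  · exact ⟨w, by linear_combination hw⟩

theorem lucas_eq_fib (n : ℕ) : lucas n = 2 * Nat.fib (n + 1) - Nat.fib n := by
  have h5 : √5 ≠ 0 := by positivity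
  have key : √5 * (lucas n : ℝ) = √5 * (2 * Nat.fib (n + 1) - Nat.fib n) := by
    rw [mul_sub, mul_left_comm, sqrt_five_mul_fib, sqrt_five_mul_fib, coe_lucas, pow_succ, pow_succ]
    have h1 := Real.goldenRatio_sub_goldenConj
    have h2 := Real.goldenRatio_add_goldenConj
    linear_combination (-goldenRatio ^ n - goldenConj ^ n) * h1 +
        (goldenRatio ^ n - goldenConj ^ n) * h2
  exact_mod_cast mul_left_cancel₀ h5 key

theorem lucas_mod_twenty_four (n : ℕ) :
    lucas n % 16 = lucas (n % 24) % 16 ∧ lucas (n + 1) % 16 = lucas (n % 24 + 1) % 16 := by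
  induction n with
  | zero => simp
  | succ n ih =>
    have e : lucas (n + 1 + 1) = lucas (n + 1) + lucas n := rfl
    have e' : lucas (n % 24 + 1 + 1) = lucas (n % 24 + 1) + lucas (n % 24) := rfl
    rcases (by omega : (n + 1) % 24 = n % 24 + 1 ∨ n % 24 = 23 ∧ (n + 1) % 24 = 0) with h | ⟨h, h'⟩
    · rw [h, e, e']; omega
    · rw [h']
      rw [h] at ih e'
      rw [e]
      have h24 : lucas 24 % 16 = 2 := by decide +kernel
      have h25 : lucas 25 % 16 = 1 := by decide +kernel
      change _ = 2 ∧ _ = 1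
      change lucas n % 16 = _ ∧ lucas (n + 1) % 16 = lucas 24 % 16 at ih
      change lucas 25 = lucas 24 + _ at e'
      omega

theorem lucas_mod_sixteen (n : ℕ) : lucas n % 16 = lucas (n % 24) % 16 :=
  (lucas_mod_twenty_four n).1

theorem lucas_mod_three (n : ℕ) : lucas n % 3 = lucas (n % 8) % 3 := by
  have : lucas n % 3 = lucas (n % 8) % 3 ∧ lucas (n + 1) % 3 = lucas (n % 8 + 1) % 3 := by
    induction n with
    | zero => simp
    | succ n ih =>
      have e : lucas (n + 1 + 1) = lucas (n + 1) + lucas n := rfl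
      have e' : lucas (n % 8 + 1 + 1) = lucas (n % 8 + 1) + lucas (n % 8) := rfl
      rcases (by omega : (n + 1) % 8 = n % 8 + 1 ∨ n % 8 = 7 ∧ (n + 1) % 8 = 0) with h | ⟨h, h'⟩
      · rw [h, e, e']; omega
      · rw [h']
        rw [h] at ih e'
        rw [e]
        change _ = 2 ∧ _ = 1
        change _ = 2 ∧ _ = 2 at ih
        omega
  exact this.1

theorem lucas_mod_eight_ne_zero (n : ℕ) : lucas n % 2 = 1 ∨ lucas n % 8 = 4 ∨ lucas n % 4 = 2 := by
  have h := lucas_mod_sixteen n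
  have : ∀ k < 24, lucas k % 16 % 2 = 1 ∨ lucas k % 16 % 8 = 4 ∨ lucas k % 16 % 4 = 2 := by
    decide +kernel
  have := this (n % 24) (Nat.mod_lt _ (by norm_num))
  omega

theorem lucas_mod_three_ne_zero {n : ℕ} (hn : Odd n) : lucas n % 3 ≠ 0 := by
  rw [lucas_mod_three]
  have h : n % 8 % 2 = 1 := by have := Nat.odd_iff.1 hn; omega
  have : ∀ k < 8, k % 2 = 1 → lucas k % 3 ≠ 0 := by decide +kernel
  exact this _ (Nat.mod_lt _ (by norm_num)) h

theorem two_pow_dvd_mul_of_lucasDiff {V d m r : ℕ} (hd : Odd d) (h1 : (2 : ℤ) ^ V ∣ lucasDiff d m)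
    (h2 : (2 : ℤ) ^ V ∣ lucasDiff d (m + r)) : 2 ^ V ∣ 32 * r := by
  have h := dvd_fib_mul hd h1 h2
  obtain ⟨e, o, ho, he⟩ : ∃ e o : ℤ, o % 2 = 1 ∧ 2 * lucas d * e = 8 * o := by
    rcases lucas_mod_eight_ne_zero d with h | h | h
    · exact ⟨4, lucas d, h, by ring⟩
    · exact ⟨1, lucas d / 4, by omega, by omega⟩
    · exact ⟨2, lucas d / 2, by omega, by omega⟩
  have h3 : (2 : ℤ) ^ V ∣ (8 * Nat.fib r) * o := by
    have := h.mul_right e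
    rwa [show (Nat.fib r : ℤ) * (2 * lucas d) * e = Nat.fib r * (2 * lucas d * e) by ring, he,
      show (Nat.fib r : ℤ) * (8 * o) = 8 * Nat.fib r * o by ring] at this
  have hc : IsCoprime ((2 : ℤ) ^ V) o :=
    IsCoprime.pow_left ⟨-(o / 2), 1, by omega⟩
  have h4 : 2 ^ V ∣ 8 * Nat.fib r := by exact_mod_cast hc.dvd_of_dvd_mul_right h3
  rcases le_or_gt V 3 with hV | hV
  · exact (pow_dvd_pow 2 hV).trans ⟨4 * r, by ring⟩
  · obtain ⟨j, rfl⟩ : ∃ j, V = j + 3 := ⟨V - 3, by omega⟩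
    rw [pow_add, mul_comm (2 ^ j), show 2 ^ 3 = 8 by norm_num,
      Nat.mul_dvd_mul_iff_left (by norm_num)] at h4
    have := Nat.mul_dvd_mul_left 8 (two_pow_dvd_four_mul j r h4)
    rwa [pow_add, mul_comm (2 ^ j), show 32 * r = 8 * (4 * r) by ring]

theorem three_pow_dvd_mul_of_lucasDiff {V d m r : ℕ} (hd : Odd d)
    (h1 : (3 : ℤ) ^ V ∣ lucasDiff d m) (h2 : (3 : ℤ) ^ V ∣ lucasDiff d (m + r)) :
    3 ^ V ∣ 3 * r := by
  have h := dvd_fib_mul hd h1 h2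
  have hc : IsCoprime ((3 : ℤ) ^ V) (2 * lucas d) := by
    apply IsCoprime.pow_left
    rw [Prime.coprime_iff_not_dvd Int.prime_three]
    have := lucas_mod_three_ne_zero hd
    omega
  exact three_pow_dvd_three_mul V r (by exact_mod_cast hc.dvd_of_dvd_mul_right h)

/-- A zero `ν` of `lucasDiff d` modulo `q` excludes all zeros up to `N`. -/
theorem not_dvd_lucasDiff_of_modEq {q c d ν N : ℕ} (hN : c * N < c * ν % q)
    (H : ∀ m r, (q : ℤ) ∣ lucasDiff d m → (q : ℤ) ∣ lucasDiff d (m + r) → q ∣ c * r)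
    (hν : (q : ℤ) ∣ lucasDiff d ν) {m : ℕ} (hm : m ≤ N) : ¬ (q : ℤ) ∣ lucasDiff d m := by
  intro h
  have key : c * m ≡ c * ν [MOD q] := by
    rcases le_total m ν with hle | hle
    · obtain ⟨r, rfl⟩ := Nat.exists_eq_add_of_le hle
      have := (Nat.modEq_zero_iff_dvd.2 (H m r h hν)).add_left (c * m)
      rw [mul_add]; exact this.symm
    · obtain ⟨r, rfl⟩ := Nat.exists_eq_add_of_le hle
      have := (Nat.modEq_zero_iff_dvd.2 (H ν r hν h)).add_left (c * ν)
      rw [mul_add]; exact this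
  have h1 : c * m % q ≤ c * m := Nat.mod_le _ _
  have h2 : c * m ≤ c * N := Nat.mul_le_mul_left _ hm
  rw [Nat.ModEq] at key
  omega

theorem lucasDiff_two_mul (e m : ℕ) :
    lucasDiff (2 * e) m ∣ 5 * ((Nat.fib (2 * (m + e)) : ℤ) * Nat.fib (2 * e)) := by
  have he : goldenRatio ^ e * goldenConj ^ e = (-1) ^ e := by
    rw [← mul_pow, Real.goldenRatio_mul_goldenConj]
  refine ⟨lucas (m + e) * lucas e + 5 * Nat.fib (m + e) * Nat.fib e - lucasDiff (2 * e) m, ?_⟩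
  have key : (5 : ℝ) * (Nat.fib (2 * (m + e)) * Nat.fib (2 * e)) =
      ((lucas (m + 2 * e) : ℝ) - lucas m) * (lucas (m + e) * lucas e +
        5 * Nat.fib (m + e) * Nat.fib e - (lucas (m + 2 * e) - lucas m)) := by
    have a : (5 : ℝ) * (Nat.fib (2 * (m + e)) * Nat.fib (2 * e)) =
      (√5 * Nat.fib (2 * (m + e))) * (√5 * Nat.fib (2 * e)) := by
      rw [mul_mul_mul_comm, Real.mul_self_sqrt (by norm_num)]
    have b : (5 : ℝ) * Nat.fib (m + e) * Nat.fib e =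
      (√5 * Nat.fib (m + e)) * (√5 * Nat.fib e) := by
      rw [mul_mul_mul_comm, Real.mul_self_sqrt (by norm_num)]; ring
    rw [a, b]
    simp only [sqrt_five_mul_fib, coe_lucas, pow_add, mul_add, two_mul]
    have he2 : (goldenRatio ^ e * goldenConj ^ e) ^ 2 = 1 := by
      rw [he, ← pow_mul, mul_comm, pow_mul]; norm_num
    generalize goldenRatio ^ e = A at *
    generalize goldenConj ^ e = B at *
    generalize goldenRatio ^ m = x at *
    generalize goldenConj ^ m = y at *
    linear_combination -(x + y) ^ 2 * he2
  simp only [lucasDiff]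
  exact_mod_cast key

theorem Nat.Prime.pow_le_of_dvd_fib_mul_fib {p c V a b : ℕ} (hp : p.Prime) (ha : 0 < a)
    (hb : 0 < b) (hc : 0 < c) (H : ∀ k r, p ^ k ∣ Nat.fib r → p ^ k ∣ c * r)
    (h : p ^ V ∣ Nat.fib a * Nat.fib b) : p ^ V ≤ c * a * (c * b) := by
  obtain ⟨u, v, hu, hv, huv⟩ := exists_dvd_and_dvd_of_dvd_mul h
  obtain ⟨i, -, rfl⟩ := (Nat.dvd_prime_pow hp).1 ⟨v, huv⟩
  obtain ⟨j, -, rfl⟩ := (Nat.dvd_prime_pow hp).1 ⟨p ^ i, by rw [huv, mul_comm]⟩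
  rw [huv]
  exact Nat.mul_le_mul (Nat.le_of_dvd (by positivity) (H _ _ hu))
    (Nat.le_of_dvd (by positivity) (H _ _ hv))

theorem not_pow_dvd_lucasDiff_two_mul {p c V N D d m : ℕ} (hp : p.Prime) (hp5 : p ≠ 5)
    (hc : 0 < c) (H : ∀ k r, p ^ k ∣ Nat.fib r → p ^ k ∣ c * r) (hd : Even d) (hd0 : 1 ≤ d)
    (hdD : d ≤ D) (hm : m + d ≤ N) (hV : c * (2 * N) * (c * D) < p ^ V) :
    ¬ ((p ^ V : ℕ) : ℤ) ∣ lucasDiff d m := by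
  obtain ⟨e, rfl⟩ := even_iff_two_dvd.1 hd
  intro h
  have h1 := h.trans (lucasDiff_two_mul e m)
  have h2 : p ^ V ∣ 5 * (Nat.fib (2 * (m + e)) * Nat.fib (2 * e)) := by exact_mod_cast h1
  have h3 := (Nat.Coprime.pow_left V
    ((Nat.coprime_primes hp Nat.prime_five).2 hp5)).dvd_of_dvd_mul_left h2
  have h4 := hp.pow_le_of_dvd_fib_mul_fib (by omega) (by omega) hc H h3
  have h5 : c * (2 * (m + e)) * (c * (2 * e)) ≤ c * (2 * N) * (c * D) := by gcongr; omega
  omega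

theorem lucas_dvd_fib_two_mul (k : ℕ) : lucas k ∣ Nat.fib (2 * k) := by
  rw [Nat.fib_two_mul, lucas_eq_fib, Nat.cast_mul,
      Nat.cast_sub (by have := Nat.fib_le_fib_succ (n := k); omega)]
  push_cast
  exact dvd_mul_left _ _

theorem three_pow_le_of_dvd_two_mul_lucas {W k : ℕ} (hk : 0 < k) (h : (3 : ℤ) ^ W ∣ 2 * lucas k) :
    3 ^ W ≤ 3 * (2 * k) := by
  have hc : IsCoprime ((3 : ℤ) ^ W) 2 := IsCoprime.pow_left ⟨1, -1, by norm_num⟩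
  have := (hc.dvd_of_dvd_mul_left h).trans (lucas_dvd_fib_two_mul k)
  exact Nat.le_of_dvd (by positivity) (three_pow_dvd_three_mul W _ (by exact_mod_cast this))

theorem not_three_pow_dvd_lucasDiff_one {W N m : ℕ} (hm : m ≤ N) (hW : 6 * (N + 1) < 3 ^ W) :
    ¬ (3 : ℤ) ^ W ∣ lucasDiff 1 m := by
  intro h
  have hW0 : W ≠ 0 := by rintro rfl; omega
  match m, hm with
  | 0, _ => exact absurd ((dvd_pow_self 3 hW0).trans h) (by decide)
  | 1, _ => exact absurd ((dvd_pow_self 3 hW0).trans h) (by decide)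
  | m + 2, hm =>
    have e : lucasDiff 1 (m + 2) = lucas (m + 1) := by
      have : lucas (m + 2 + 1) = lucas (m + 2) + lucas (m + 1) := rfl
      simp only [lucasDiff]; omega
    have := three_pow_le_of_dvd_two_mul_lucas (Nat.succ_pos m) ((e ▸ h).mul_left 2)
    omega

theorem not_three_pow_dvd_lucasDiff_three {W N m : ℕ} (hm : m ≤ N) (hW : 6 * (N + 1) < 3 ^ W) :
    ¬ (3 : ℤ) ^ W ∣ lucasDiff 3 m := by
  intro h
  have e : lucasDiff 3 m = 2 * lucas (m + 1) := by
    have h3 : lucas (m + 3) = lucas (m + 2) + lucas (m + 1) := rfl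
    have h2 : lucas (m + 2) = lucas (m + 1) + lucas m := rfl
    simp only [lucasDiff]; omega
  have := three_pow_le_of_dvd_two_mul_lucas (Nat.succ_pos m) (e ▸ h)
  omega

theorem not_sixteen_dvd_lucasDiff {d : ℕ}
    (hd : d % 24 ∈ [1, 3, 11, 13, 21, 23]) (m : ℕ) : ¬ (16 : ℤ) ∣ lucasDiff d m := by
  have key : ∀ k ∈ [1, 3, 11, 13, 21, 23], ∀ m < 24,
      ¬ (16 : ℤ) ∣ lucas ((m + k) % 24) - lucas m := by
    decide +kernel
  have h := key _ hd (m % 24) (Nat.mod_lt _ (by norm_num))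
  have h1 := lucas_mod_sixteen (m + d)
  have h2 := lucas_mod_sixteen m
  rw [Nat.add_mod] at h1
  simp only [lucasDiff]
  omega

/-- Evaluate `k` at `a` after reducing `a` to a numeral. -/
def force {α : Type} (a : ℕ) (k : ℕ → α) : α :=
  Nat.rec (k 0) (fun n _ ↦ k n.succ) a

theorem force_eq {α : Type} (a : ℕ) (k : ℕ → α) : force a k = k a := by
  cases a <;> rfl

/-- Pass `F_n` and `F_{n+1}` modulo `q` to `k`; `j` binary digits of `n` remain to be read. -/
def withFibMod (q n : ℕ) : ℕ → ℕ → ℕ → (ℕ → ℕ → Bool) → Bool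
  | 0, a, b, k => k a b
  | j + 1, a, b, k =>
    force (a * (2 * b + (q - a)) % q) fun c ↦ force ((a * a + b * b) % q) fun e ↦
      if n / 2 ^ j % 2 = 1 then force ((c + e) % q) fun s ↦ withFibMod q n j e s k
      else withFibMod q n j c e k

theorem withFibMod_eq {q : ℕ} (hq : 0 < q) (n : ℕ) (k : ℕ → ℕ → Bool) (j : ℕ) :
    withFibMod q n j (Nat.fib (n / 2 ^ j) % q) (Nat.fib (n / 2 ^ j + 1) % q) k =
      k (Nat.fib n % q) (Nat.fib (n + 1) % q) := by
  induction j with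
  | zero => simp [withFibMod]
  | succ j ih =>
    rw [withFibMod]
    simp only [force_eq]
    set t := n / 2 ^ (j + 1) with ht
    have hdiv : n / 2 ^ j / 2 = t := by rw [Nat.div_div_eq_div_mul, ← pow_succ]
    have h1 : Nat.fib t % q * (2 * (Nat.fib (t + 1) % q) + (q - Nat.fib t % q)) % q =
        Nat.fib (2 * t) % q := by
      have hlt := Nat.mod_lt (Nat.fib t) hq
      rw [Nat.fib_two_mul]
      have hle : Nat.fib t ≤ 2 * Nat.fib (t + 1) := by
        have := Nat.fib_le_fib_succ (n := t); omega
      change _ ≡ _ [MOD q]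
      refine (Int.natCast_modEq_iff).1 ?_
      push_cast [Nat.cast_sub hle, Nat.cast_sub hlt.le]
      have a1 : ((Nat.fib t : ℤ) % q) ≡ Nat.fib t [ZMOD q] := Int.mod_modEq _ _
      have a2 : ((Nat.fib (t + 1) : ℤ) % q) ≡ Nat.fib (t + 1) [ZMOD q] := Int.mod_modEq _ _
      refine a1.mul ?_
      have a3 : (q : ℤ) ≡ 0 [ZMOD q] := by simp [Int.ModEq]
      have := (a2.mul_left 2).add (a3.sub a1)
      simpa [sub_eq_add_neg, add_comm] using this
    have h2 : (Nat.fib t % q * (Nat.fib t % q) + Nat.fib (t + 1) % q * (Nat.fib (t + 1) % q)) % q =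
        Nat.fib (2 * t + 1) % q := by
      rw [Nat.fib_two_mul_add_one]
      have a1 := Nat.mod_modEq (Nat.fib t) q
      have a2 := Nat.mod_modEq (Nat.fib (t + 1)) q
      have := (a2.mul a2).add (a1.mul a1)
      rw [add_comm, sq, sq]; exact this
    rw [h1, h2]
    split_ifs with hb
    · have e : n / 2 ^ j = 2 * t + 1 := by omega
      rw [← ih, e, ← Nat.add_mod, ← Nat.fib_add_two]
    · have e : n / 2 ^ j = 2 * t := by omega
      rw [← ih, e]

/-- Decide whether `q` divides `L_{n+d} - L_n`, for `n + d < 2 ^ j`. -/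
def lucasDiffDvd (q j d n : ℕ) : Bool :=
  withFibMod q n j 0 1 fun a b ↦ withFibMod q (n + d) j 0 1 fun a' b' ↦
    Nat.beq ((2 * b' + a) % q) ((2 * b + a') % q)

theorem dvd_of_lucasDiffDvd {q j d n : ℕ} (hq : 1 < q) (hn : n + d < 2 ^ j)
    (h : lucasDiffDvd q j d n = true) : (q : ℤ) ∣ lucasDiff d n := by
  have h0 : n / 2 ^ j = 0 := Nat.div_eq_of_lt (by omega)
  have h0' : (n + d) / 2 ^ j = 0 := Nat.div_eq_of_lt hn
  have e := fun k ↦ withFibMod_eq (by omega : 0 < q) n k j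
  have e' := fun k ↦ withFibMod_eq (by omega : 0 < q) (n + d) k j
  simp only [h0, h0', zero_add, Nat.fib_zero, Nat.fib_one, Nat.zero_mod, Nat.mod_eq_of_lt hq]
    at e e'
  rw [lucasDiffDvd, e, e'] at h
  have h1 := Nat.eq_of_beq_eq_true h
  have h2 : 2 * Nat.fib (n + 1) + Nat.fib (n + d) ≡ 2 * Nat.fib (n + d + 1) +
      Nat.fib n [MOD q] := by
    have a := Nat.mod_modEq (Nat.fib n) q
    have b := Nat.mod_modEq (Nat.fib (n + 1)) q
    have a' := Nat.mod_modEq (Nat.fib (n + d)) q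
    have b' := Nat.mod_modEq (Nat.fib (n + d + 1)) q
    exact ((b.mul_left 2).add a').symm.trans ((show _ ≡ _ [MOD q] from h1.symm).trans
      ((b'.mul_left 2).add a))
  have h3 := (Nat.modEq_iff_dvd.1 h2)
  simp only [lucasDiff, lucas_eq_fib]
  push_cast at h3
  convert h3 using 1
  ring

/-- Certificate that `L_{m+d} - L_m` is divisible neither by `2 ^ V` nor by `3 ^ W` for `m ≤ N`. -/
def checkRow (N V W d a b : ℕ) : Bool :=
  (if a = 0 then decide (d % 24 ∈ [1, 3, 11, 13, 21, 23])
    else Nat.blt (32 * N) (32 * a % 2 ^ V) && Nat.blt (a + d) (2 ^ (V + 2)) &&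
      lucasDiffDvd (2 ^ V) (V + 2) d a) &&
  (Nat.blt (3 * N) (3 * b % 3 ^ W) && Nat.blt (b + d) (2 ^ (2 * W)) &&
    lucasDiffDvd (3 ^ W) (2 * W) d b)

/-- Check the rows for `d, d + 2, d + 4, …`. -/
def checkRows (N V W : ℕ) : ℕ → List (ℕ × ℕ) → Bool
  | _, [] => true
  | d, (a, b) :: l => checkRow N V W d a b && checkRows N V W (d + 2) l

theorem not_dvd_of_checkRow {N V W d a b m : ℕ} (hV : 4 ≤ V) (hW : 0 < W) (hd : Odd d)
    (h : checkRow N V W d a b = true) (hm : m ≤ N) :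
    ¬ (2 : ℤ) ^ V ∣ lucasDiff d m ∧ ¬ (3 : ℤ) ^ W ∣ lucasDiff d m := by
  have hV1 : 1 < 2 ^ V := Nat.one_lt_two_pow (by omega)
  have hW1 : 1 < 3 ^ W := Nat.one_lt_pow (by omega) (by norm_num)
  rw [checkRow, Bool.and_eq_true] at h
  obtain ⟨h2, h3⟩ := h
  constructor
  · split_ifs at h2 with ha
    · intro h
      exact not_sixteen_dvd_lucasDiff (of_decide_eq_true h2) m
        ((pow_dvd_pow 2 hV : (2 : ℤ) ^ 4 ∣ 2 ^ V).trans h)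
    · simp only [Bool.and_eq_true, Nat.blt_eq] at h2
      have := not_dvd_lucasDiff_of_modEq h2.1.1 (fun m r x y ↦
        two_pow_dvd_mul_of_lucasDiff hd (by exact_mod_cast x) (by exact_mod_cast y))
        (dvd_of_lucasDiffDvd hV1 h2.1.2 h2.2) hm
      exact_mod_cast this
  · simp only [Bool.and_eq_true, Nat.blt_eq] at h3
    have := not_dvd_lucasDiff_of_modEq h3.1.1 (fun m r x y ↦
      three_pow_dvd_mul_of_lucasDiff hd (by exact_mod_cast x) (by exact_mod_cast y))
      (dvd_of_lucasDiffDvd hW1 h3.1.2 h3.2) hm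
    exact_mod_cast this

theorem not_dvd_of_checkRows {N V W m : ℕ} (hV : 4 ≤ V) (hW : 0 < W) (hm : m ≤ N)
    (l : List (ℕ × ℕ)) (d₀ d : ℕ) (hd₀ : Odd d₀) (hd : Odd d) (h₀ : d₀ ≤ d)
    (h : d < d₀ + 2 * l.length) (hc : checkRows N V W d₀ l = true) :
    ¬ (2 : ℤ) ^ V ∣ lucasDiff d m ∧ ¬ (3 : ℤ) ^ W ∣ lucasDiff d m := by
  induction l generalizing d₀ with
  | nil => simp at h; omega
  | cons r l ih =>
    obtain ⟨a, b⟩ := r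
    rw [checkRows, Bool.and_eq_true] at hc
    rcases h₀.eq_or_lt with rfl | hlt
    · exact not_dvd_of_checkRow hV hW hd hc.1 hm
    · have h1 := Nat.odd_iff.1 hd
      have h2 := Nat.odd_iff.1 hd₀
      refine ih (d₀ + 2) (Nat.odd_iff.2 (by omega)) (by omega) ?_ hc.2
      simp only [List.length_cons] at h; omega

namespace PillaiTriple

/-- The smallest term is bounded when the gaps are covered by a certified table. -/
theorem two_pow_mul_three_pow_le_of_checkRows (T : PillaiTriple) {N D V W : ℕ} {l : List (ℕ × ℕ)}
    (hN : T.n₁ ≤ N) (hD : T.n₁ - T.n₃ ≤ D) (hl : D < 5 + 2 * l.length)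
    (hc : checkRows N V W 5 l = true) (hV4 : 4 ≤ V) (hV : 4 * (2 * N) * (4 * D) < 2 ^ V)
    (hW : 3 * (2 * (N + 1)) * (3 * D) < 3 ^ W) :
    (2 : ℤ) ^ T.x₃ * 3 ^ T.y₃ ≤ 2 ^ V * 3 ^ W := by
  have hDpos : 1 ≤ D := by have := T.lt₃₂; have := T.lt₂₁; omega
  have hW' : 6 * (N + 1) < 3 ^ W := by nlinarith
  have hW0 : 0 < W := by rcases Nat.eq_zero_or_pos W with rfl | h <;> omega
  have key : ∀ m d, 1 ≤ d → m + d ≤ T.n₁ → d ≤ T.n₁ - T.n₃ →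
      ¬ (2 : ℤ) ^ V ∣ lucasDiff d m ∧ ¬ (3 : ℤ) ^ W ∣ lucasDiff d m := by
    intro m d hd hmd hdD
    rcases Nat.even_or_odd d with he | ho
    · constructor
      · have := not_pow_dvd_lucasDiff_two_mul Nat.prime_two (by norm_num) (by norm_num : 0 < 4)
          two_pow_dvd_four_mul he hd (hdD.trans hD) (hmd.trans hN) hV
        exact_mod_cast this
      · have := not_pow_dvd_lucasDiff_two_mul Nat.prime_three (by norm_num) (by norm_num : 0 < 3)
          three_pow_dvd_three_mul he hd (hdD.trans hD) (hmd.trans (hN.trans (Nat.le_succ N))) hW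
        exact_mod_cast this
    · have hodd := Nat.odd_iff.1 ho
      rcases (by omega : d = 1 ∨ d = 3 ∨ 5 ≤ d) with rfl | rfl | h5
      · exact ⟨fun h ↦ not_sixteen_dvd_lucasDiff (by decide) m
          ((pow_dvd_pow 2 hV4 : (2 : ℤ) ^ 4 ∣ 2 ^ V).trans h),
          not_three_pow_dvd_lucasDiff_one (by omega : m ≤ N) hW'⟩
      · exact ⟨fun h ↦ not_sixteen_dvd_lucasDiff (by decide) m
          ((pow_dvd_pow 2 hV4 : (2 : ℤ) ^ 4 ∣ 2 ^ V).trans h),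
          not_three_pow_dvd_lucasDiff_three (by omega : m ≤ N) hW'⟩
      · exact not_dvd_of_checkRows hV4 hW0 (by omega) l 5 d (by decide) ho h5 (by omega) hc
  exact T.two_pow_mul_three_pow_le (fun m d h1 h2 h3 _ ↦ (key m d h1 h2 h3).1)
    (fun m d h1 h2 h3 _ ↦ (key m d h1 h2 h3).2)

end PillaiTriple

/-- Zeros of `lucasDiff d` modulo `2 ^ 115` and `3 ^ 72` for `d = 5, 7, …, 303`. -/
def lucasDiffZeros : List (ℕ × ℕ) :=
  [(29045532873059149501390957332452801, 277631673660668686766931527041788),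
  (17432466346094460152815781149560724, 4790551480886375070045438750718680),
  (6170235873539314593761506796997389, 25770591059664994566809752617983803),
  (0, 28824187071568942099058219883427481), (0, 2927518271290171532871403625614828),
  (13684966747825801154654516129023268, 7849506471624077232503614032510916),
  (683032436219323020128550934409543, 11510249011972615780135131229283491),
  (17818389270468096908218417572507586, 23201973815205988018395327704943521),
  (0, 25018111919046676177856567472515420), (0, 26498430945323371213922965227696284),
  (0, 29234469184411185312515958613760695), (0, 26681758560440240968451184840795005),
  (2514079305768540708599275078912301, 23868209185538663969209925032967172),
  (4946522348058484623960417809104720, 22640686451207074121806064568913536),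
  (7855414691964978191633519783984855, 3597951364824485968555111732251019),
  (0, 24335507253363903594414230805522989), (0, 26129084635759672455987733256483332),
  (12721446880872440164700040080379938, 2991861633373133166783869075369188),
  (15744352867971358848074390384426099, 28916264290798414666900325220520399),
  (20984006587828298756326912914505534, 8087493587827793621037346864568693),
  (0, 10010055162998536920394624127050316), (0, 30035721543597349281697795316500724),
  (0, 27162684058926737269327087203537799), (0, 24759354462972042717437802426273041),
  (5158019420445895171495267851837977, 2492569200174086043356413521843012),
  (13480412936024232898461877617502348, 24550258504614543228144485650630164),
  (491116674949505162422394105263505, 7379335223767212634876557707075611),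
  (0, 14884905206469393889797725753567813), (0, 22022099756787727246900768388798968),
  (207368176682690286570967993222928, 28254945085710985400288266000485424),
  (13693705655530247478350228328253727, 16882990973890871175562659521690347),
  (25824150503906055455643980518370362, 5773436109331784127092099668311029),
  (0, 17533854018542270204034084862779620), (0, 5483059820343137252738277165789236),
  (0, 4617193219422917263526298302271451), (0, 22658347674012933475552096062563897),
  (24400178886999635760178640582195333, 13390434039207496335499691378620584),
  (3021266837488486202014437294764872, 29963601456782326300113453168446268),
  (2774310094125592114049927694990395, 8952332961875679487355347714060027),
  (0, 23471629897504479756878726969629445), (0, 15067617199652798579581068076698496),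
  (6193811951434363732483910571277550, 23385653316675164333625074340700684),
  (423650792019266169366150844624715, 2168508177108623926733566868022175),
  (16149736273604111881591566847024822, 6371415289669637044611874816685993),
  (0, 29504319206441229617542415103163460), (0, 4763848537870861511760390017782052),
  (0, 29173380477899083081211099089715239), (0, 5097497814974778398723038398519761),
  (20818771379282209649676708756513905, 16684548511824663776534555997885288),
  (8141106535159993772623351700129668, 14137370559975067444636847154627564),
  (2688624105396256013864476917700565, 8151350788276289204132990393247439),
  (0, 12299498912411544940998479633720681), (0, 12291458384434272216381110743868068),
  (14683617315613765048911027323452604, 18671602274218595050705331725600636),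
  (26357020141541681248143636721305335, 13525840731658323559467709624859431),
  (12695075270222726460947910670450354, 28290870257015268799947434314469369),
  (0, 7610931668203131530181010449038912), (0, 2497387084813421307243729248354540),
  (0, 14735458158869530511153815389438583), (0, 23453138554706461861754024562574253),
  (1208065298798071197046414656650717, 28430556899067446563159958829287280),
  (5588438603158983491971533849169216, 1499497635194751696765175635059976),
  (7014725320880747736029286548440415, 27583405872479217992552556734004799),
  (0, 9525473945431302816793341757308365), (0, 19281927605416697347265983723509772),
  (4025119890861078873640378236225914, 84959117612548720809620177517580),
  (18224061700236836518684424635115555, 24055041291045028214987280590466883),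
  (30407394823933909703689204349285422, 9102190676397793123288428368279921),
  (0, 29700341314889013327315577841958548), (0, 4285124212304849061464275012885676),
  (0, 14459059996130738138011478661750535), (0, 12955325267714350793790202572619205),
  (18254252416934977086477915036572873, 25066920021832739791424851077155712),
  (7157137698372785300120448584789116, 14716838127292299414340215665384988),
  (13071415132573389388748376043911641, 8683553099019843969138352895788099),
  (0, 26414044725110626647081725300152397), (0, 10976960356581471011630777556218200),
  (1469567661937342830428954624728616, 1705165542361298482564299090590560),
  (13302708790312929643236178369456847, 9050762962097421652374699404733739),
  (15631603468826162968505455751997226, 11367269716830578663919477927305753),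
  (0, 2343798688736303206245261606159716), (0, 4144310271300011124523134859784348),
  (0, 5468060627768931517668284438266711), (0, 23010808352248155740039332649372573),
  (11392223440275234864542590857009461, 1740304711150369435506110411042676),
  (6019603582743752768247001766530360, 13273316572996552821401770774117716),
  (2013715338465505183679115850244675, 18648457758650481715817312384420443),
  (0, 11708912119847651093289908976772949), (0, 10760521919812022568355340264630692),
  (8990879747824278490718679240469958, 21083393996835008257670200907697664),
  (22518179928957666702314661101840123, 27312211629679050507173689842050599),
  (9647316443249374556582600736980902, 17456020412361073080571441962416333),
  (0, 12905876849679253404507937927644548), (0, 14195864013873527567734489210009436),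
  (0, 8193117821844881925855521419201651), (0, 12996291025699031352206089981447397),
  (23945402915699235864616143021787937, 13027002738209598913333257707131800),
  (22430237217628303190853164709107572, 28331068018322236977192038147618352),
  (10301769144203551559926553140339613, 28259537040831720965041185081293647),
  (0, 7376143729108758417283543122444461), (0, 26945614997140953588555386830714372),
  (294219719372320407003547653890900, 13394924109642506027293302727082140),
  (25628578839101092010059284866970791, 27404759051725437597188062777534855),
  (19430640388055694051574571172357538, 10447004764673607400291018952987609),
  (0, 25708795633309308569811746267314052), (0, 8820789263551730902927607415260048),
  (0, 13125268618684363836067644052042771), (0, 18855376063992797193922284800845685),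
  (4645456604026434539179972688628365, 10335055354080408532848876268626420),
  (27120900364818288857065446462141232, 28861461030649961940436740083189112),
  (11254682441004210635500889217669863, 17751650389273327133774341412788591),
  (0, 28861653316619705026623240714397685), (0, 23970565421489028804117827394345124),
  (1918137465742007628412521094881746, 22063960706245764794477660714030500),
  (1485286302343327872145240612318163, 9693294092265989506232168949654835),
  (18935984351638487470129086739513630, 5368019026088090735192097237637649),
  (0, 2239223029473382397430793037960432), (0, 28462435407500868933509668538015132),
  (0, 9879845678840919103311110478056623), (0, 2821395844935077933492672732543933),
  (7634911138354710828191283652554617, 18235168463320830547201569031194348),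
  (25396207721496495340179014208145516, 9660025935706951201961724053024244),
  (1328174817496998476839382526008609, 1032245929541324490086266217570971),
  (0, 29998491876179936016650306478699065), (0, 727735771289419949858719781344768),
  (4106302959264952098253928425735232, 9693830591968497248085112677811732),
  (26502122368979799590866930908685439, 6775416471702224237408434467342907),
  (20297035703218048572680492777011738, 23749511039610970089267389148144581),
  (0, 15914361364307857254376564384250960), (0, 14766842431097139839594388952675796),
  (0, 9876703065972601415337733533249727), (0, 1639023413570863407059779952821457),
  (22980320012967964288441017073422821, 12580185561879279393906121604971164),
  (9122583025461610693597872547643176, 18678383863171604552284899841973040),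
  (2863628325656475213703803862677323, 3677927508697988483793292179029887),
  (0, 28942006075789748713829260874567045), (0, 6413594729829067048354796420876728),
  (3201861504983254455547077502918046, 21942992893865287669441838562850156),
  (4905625067962387171584524577519275, 19669135990820518905813304892494099),
  (3203612147451295521517097534077078, 24952949491413316208013602906108645),
  (0, 10469017634923871063427448053781796), (0, 12410958003747723746898604076670104),
  (0, 13213242259884717003535657800102031), (0, 14235178500960844698138927149261657),
  (30492967511571161535035630146783697, 26361668588779284692627840185956516),
  (4236520265159614511795079316160356, 16327822226313349521509264330930784),
  (6909640125109187638310155551370853, 17826484168929627957692153050422715),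
  (0, 29001548028678968424295782760948865), (0, 15476829746142298128781884402087760),
  (9436391726027371209443627615582444, 7930897570807447211959040330803456)]

theorem checkRows_lucasDiffZeros : checkRows (2 ^ 101) 115 72 5 lucasDiffZeros = true := by
  decide +kernel

/-- Zeros of `lucasDiff d` modulo `2 ^ 21` and `3 ^ 13` for `d = 5, 7, …, 39`. -/
def lucasDiffZerosSmall : List (ℕ × ℕ) :=
  [(1103297, 142296), (937876, 1232640), (232205, 2011087), (0, 949841), (0, 1882984),
  (247076, 619672), (389447, 1096027), (552898, 800669), (0, 728888), (0, 1745348), (0, 185239),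
  (0, 286613), (1411373, 1120536), (687952, 1864200), (278231, 966871), (0, 45629), (0, 1856536),
  (249890, 1662352)]

theorem checkRows_lucasDiffZerosSmall :
    checkRows (2 ^ 10) 21 13 5 lucasDiffZerosSmall = true := by
  decide +kernel

/-- Fixed-point partial sums of `-log (1 - T / E)`: the `j` terms starting with `p / k` are added
to `s`. -/
def logSum (E T : ℕ) : ℕ → ℕ → ℕ → ℕ → ℕ
  | 0, _, _, s => s
  | j + 1, k, p, s => force (k + 1) fun k' ↦ force (p * T / E) fun p' ↦ force (s + p / k) fun s' ↦
      logSum E T j k' p' s'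

/-- Fixed-point approximation with `K` terms of `-log (1 - T / E)`, in units of `1 / E`. -/
def negLogOneSub (E T K : ℕ) : ℕ := logSum E T K 1 T 0

theorem abs_natCast_div_sub_le (a : ℕ) {b : ℕ} (hb : 0 < b) :
    |((a / b : ℕ) : ℝ) - a / b| ≤ 1 := by
  have h0 : (0 : ℝ) < b := by exact_mod_cast hb
  have h1 : ((a / b : ℕ) : ℝ) ≤ a / b := Nat.cast_div_le
  have h2 : (a : ℝ) / b < (a / b : ℕ) + 1 := by
    rw [div_lt_iff₀ h0]; rw [mul_comm]; exact_mod_cast Nat.lt_mul_div_succ a hb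
  rw [abs_le]; constructor <;> linarith

theorem abs_logSum_sub_le {E T : ℕ} {t : ℝ} (hE : 100 ≤ E) (ht0 : 0 ≤ t) (ht : t ≤ 1 / 2)
    (hT : |E * t - T| ≤ 1) (j : ℕ) :
    ∀ k p s : ℕ, 1 ≤ k → |E * t ^ k - p| ≤ 4 →
      |(s : ℝ) + ∑ i ∈ Finset.range j, E * t ^ (k + i) / (k + i) - logSum E T j k p s| ≤ 5 * j := by
  have hER : (100 : ℝ) ≤ E := by exact_mod_cast hE
  induction j with
  | zero => intro k p s _ _; simp [logSum]
  | succ j ih =>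
    intro k p s hk hp
    have hkR : (1 : ℝ) ≤ k := by exact_mod_cast hk
    have hp' : |E * t ^ (k + 1) - (p * T / E : ℕ)| ≤ 4 := by
      have h1 := abs_natCast_div_sub_le (p * T) (by omega : 0 < E)
      have hT' : (T : ℝ) / E ≤ 51 / 100 := by
        rw [div_le_iff₀ (by linarith)]
        have := (abs_le.1 hT).1
        nlinarith
      have e : E * t ^ (k + 1) - (p * T : ℕ) / E = (E * t ^ k - p) * (T / E) + t ^ k *
          (E * t - T) := by
        push_cast; field_simp; ring
      have htk : t ^ k ≤ 1 / 2 := by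
        calc t ^ k ≤ t ^ 1 := pow_le_pow_of_le_one ht0 (by linarith) hk
          _ ≤ 1 / 2 := by linarith
      have h2 : |E * t ^ (k + 1) - (p * T : ℕ) / E| ≤ 4 * (51 / 100) + 1 / 2 * 1 := by
        rw [e]
        refine (abs_add_le _ _).trans (add_le_add ?_ ?_)
        · rw [abs_mul, abs_of_nonneg (by positivity : (0 : ℝ) ≤ T / E)]
          exact mul_le_mul hp hT' (by positivity) (by norm_num)
        · rw [abs_mul, abs_of_nonneg (by positivity : (0 : ℝ) ≤ t ^ k)]
          exact mul_le_mul htk hT (abs_nonneg _) (by norm_num)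
      rw [abs_le] at *
      constructor <;> linarith [h1.1, h1.2, h2.1, h2.2]
    have key := ih (k + 1) (p * T / E) (s + p / k) (by omega) hp'
    have h1 := abs_natCast_div_sub_le p (by omega : 0 < k)
    have h2 : |E * t ^ k / k - p / k| ≤ 4 := by
      rw [← sub_div, abs_div, abs_of_nonneg (by positivity : (0 : ℝ) ≤ k),
          div_le_iff₀ (by linarith)]
      nlinarith
    have e : logSum E T (j + 1) k p s = logSum E T j (k + 1) (p * T / E) (s + p / k) := by
      rw [logSum]; simp only [force_eq]
    rw [e, Finset.sum_range_succ']
    have e2 : ∑ i ∈ Finset.range j, E * t ^ (k + (i + 1)) / ((k : ℝ) + (i + 1 : ℕ)) =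
        ∑ i ∈ Finset.range j, E * t ^ (k + 1 + i) / (((k + 1 : ℕ) : ℝ) + i) := by
      refine Finset.sum_congr rfl fun i _ ↦ ?_
      push_cast
      rw [show k + (i + 1) = k + 1 + i by ring, show (k : ℝ) + (i + 1) = k + 1 + i by ring]
    rw [e2]
    push_cast at key ⊢
    simp only [add_zero, abs_le] at *
    constructor <;> linarith [key.1, key.2, h1.1, h1.2, h2.1, h2.2]

theorem abs_mul_log_one_sub_add_le {E T K : ℕ} {t : ℝ} (hE : 100 ≤ E) (ht0 : 0 ≤ t) (ht : t ≤ 1 / 2)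
    (hT : |E * t - T| ≤ 1) (hK : E * t ^ (K + 1) ≤ 1) :
    |E * Real.log (1 - t) + negLogOneSub E T K| ≤ 5 * K + 2 := by
  have h1 := abs_logSum_sub_le hE ht0 ht hT K 1 T 0 le_rfl
    (by rw [pow_one]; exact hT.trans (by norm_num))
  have h2 := Real.abs_log_sub_add_sum_range_le (x := t) (by rw [abs_of_nonneg ht0]; linarith) K
  rw [abs_of_nonneg ht0] at h2
  have h3 : |E * (∑ i ∈ Finset.range K, t ^ (i + 1) / (i + 1) + Real.log (1 - t))| ≤ 2 := by
    rw [abs_mul, Nat.abs_cast]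
    calc (E : ℝ) * _ ≤ E * (t ^ (K + 1) / (1 - t)) := by gcongr
      _ = E * t ^ (K + 1) / (1 - t) := by ring
      _ ≤ 2 := by rw [div_le_iff₀ (by linarith)]; linarith
  have e : ∑ i ∈ Finset.range K, (E : ℝ) * t ^ (1 + i) / ((1 : ℕ) + i) =
      E * ∑ i ∈ Finset.range K, t ^ (i + 1) / ((i : ℝ) + 1) := by
    rw [Finset.mul_sum]
    refine Finset.sum_congr rfl fun i _ ↦ ?_
    rw [add_comm 1 i, Nat.cast_one, add_comm (1 : ℝ)]; ring
  rw [e] at h1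
  simp only [negLogOneSub, Nat.cast_zero, zero_add] at *
  rw [abs_le] at *
  constructor <;> linarith [h1.1, h1.2, h3.1, h3.2]

theorem fib_sub_goldenRatio_pow_mul (m d : ℕ) :
    (Nat.fib (m + d) : ℝ) - goldenRatio ^ d * Nat.fib m = goldenConj ^ m * Nat.fib d := by
  have h5 : √5 ≠ 0 := by positivity
  apply mul_left_cancel₀ h5
  have e : √5 * ((Nat.fib (m + d) : ℝ) - goldenRatio ^ d * Nat.fib m) =
    √5 * Nat.fib (m + d) - goldenRatio ^ d * (√5 * Nat.fib m) := by ring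
  have e' : √5 * (goldenConj ^ m * Nat.fib d) = goldenConj ^ m * (√5 * Nat.fib d) := by ring
  simp only [e, e', sqrt_five_mul_fib]
  ring

theorem fib_le_goldenRatio_pow (d : ℕ) : (Nat.fib (d + 1) : ℝ) ≤ goldenRatio ^ d := by
  induction d using Nat.twoStepInduction with
  | zero => simp
  | one => simp [Real.one_lt_goldenRatio.le]
  | more n h1 h2 =>
    rw [Nat.fib_add_two, pow_add, Real.goldenRatio_sq, mul_add]
    push_cast
    rw [pow_succ] at h2
    linarith

theorem fib_le_goldenRatio_pow' (d : ℕ) : (Nat.fib d : ℝ) ≤ goldenRatio ^ d :=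
  (by exact_mod_cast Nat.fib_le_fib_succ : (Nat.fib d : ℝ) ≤ Nat.fib (d + 1)).trans
    (fib_le_goldenRatio_pow d)

/-- Up to an error of `1`, dividing `F_m` by `φ ^ d` lowers its index by `d`. -/
theorem abs_fib_div_pow_sub_le {m d : ℕ} (h : d ≤ m) :
    |(Nat.fib m : ℝ) * (1 / goldenRatio ^ d) - Nat.fib (m - d)| ≤ 1 := by
  obtain ⟨n, rfl⟩ := Nat.exists_eq_add_of_le' h
  have hφ : 0 < goldenRatio ^ d := pow_pos Real.goldenRatio_pos d
  have e := fib_sub_goldenRatio_pow_mul n d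
  have e2 : (Nat.fib (n + d) : ℝ) * (1 / goldenRatio ^ d) - Nat.fib (n + d - d) =
      goldenConj ^ n * (Nat.fib d / goldenRatio ^ d) := by
    rw [Nat.add_sub_cancel]; field_simp; linarith
  have hψ : |goldenConj| ≤ 1 := by
    rw [abs_le]
    exact ⟨Real.neg_one_lt_goldenConj.le, Real.goldenConj_neg.le.trans zero_le_one⟩
  rw [e2, abs_mul, abs_pow, abs_of_nonneg (by positivity : (0 : ℝ) ≤ Nat.fib d / goldenRatio ^ d)]
  calc |goldenConj| ^ n * (Nat.fib d / goldenRatio ^ d) ≤ 1 * 1 := by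
        refine mul_le_mul (pow_le_one₀ (abs_nonneg _) hψ) ?_ (by positivity) zero_le_one
        rw [div_le_one hφ]; exact fib_le_goldenRatio_pow' d
    _ = 1 := one_mul 1

/-- Fixed-point values, in units of `1 / F_m`, of the logarithms of `2`, `3` and `φ`. -/
structure IsLogApprox (m ε A₂ A₃ A : ℕ) : Prop where
  hundred_le : 100 ≤ Nat.fib m
  one_le : 1 ≤ ε
  two : |Nat.fib m * Real.log 2 - A₂| ≤ ε
  three : |Nat.fib m * Real.log 3 - A₃| ≤ ε
  phi : |Nat.fib m * Real.log goldenRatio - A| ≤ ε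

theorem abs_fib_mul_log_one_sub_add_le {m d K : ℕ} (hm : 100 ≤ Nat.fib m) (hd : 2 ≤ d)
    (hdm : d ≤ m) (hK : m ≤ d * (K + 1)) :
    |Nat.fib m * Real.log (1 - 1 / goldenRatio ^ d) + negLogOneSub (Nat.fib m) (Nat.fib (m - d)) K|
      ≤ 5 * K + 2 := by
  have hφ := goldenRatio_bounds
  have h1 : (1 : ℝ) ≤ goldenRatio := by linarith [hφ.1]
  have h2 : 2 ≤ goldenRatio ^ d :=
    calc (2 : ℝ) ≤ goldenRatio ^ 2 := by nlinarith [hφ.1]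
      _ ≤ goldenRatio ^ d := pow_le_pow_right₀ h1 hd
  refine abs_mul_log_one_sub_add_le hm (by positivity)
    (by rw [div_le_div_iff₀ (by positivity) (by norm_num)]; linarith)
    (abs_fib_div_pow_sub_le hdm) ?_
  rw [one_div, inv_pow, ← pow_mul, ← div_eq_mul_inv, div_le_one (by positivity)]
  exact (fib_le_goldenRatio_pow' m).trans (pow_le_pow_right₀ h1 hK)

theorem IsLogApprox.of_series {m ε K₂ K₃ K : ℕ} (hm : 100 ≤ Nat.fib m) (h2m : 2 ≤ m)
    (h2 : Nat.fib m ≤ 2 ^ (K₂ + 1)) (h3 : Nat.fib m ≤ 3 ^ (K₃ + 1)) (h : m ≤ 2 * (K + 1))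
    (hε : 5 * K₂ + 2 + (5 * K₃ + 2) ≤ ε) (hε' : 5 * K + 2 ≤ ε) :
    IsLogApprox m ε (negLogOneSub (Nat.fib m) (Nat.fib m / 2) K₂)
      (negLogOneSub (Nat.fib m) (Nat.fib m / 2) K₂ + negLogOneSub (Nat.fib m) (Nat.fib m / 3) K₃)
      (negLogOneSub (Nat.fib m) (Nat.fib (m - 2)) K) := by
  have key2 := abs_mul_log_one_sub_add_le (T := Nat.fib m / 2) (K := K₂) (t := 1 / 2) hm
    (by norm_num) (by norm_num)
    (by rw [abs_sub_comm, mul_one_div]; exact_mod_cast abs_natCast_div_sub_le _ two_pos)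
    (by rw [one_div, inv_pow, ← div_eq_mul_inv, div_le_one (by positivity)]; exact_mod_cast h2)
  have key3 := abs_mul_log_one_sub_add_le (T := Nat.fib m / 3) (K := K₃) (t := 1 / 3) hm
    (by norm_num) (by norm_num)
    (by rw [abs_sub_comm, mul_one_div]; exact_mod_cast abs_natCast_div_sub_le _ three_pos)
    (by rw [one_div, inv_pow, ← div_eq_mul_inv, div_le_one (by positivity)]; exact_mod_cast h3)
  have keyφ := abs_fib_mul_log_one_sub_add_le hm le_rfl h2m h
  have e2 : Real.log (1 - 1 / 2) = -Real.log 2 := by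
    rw [← Real.log_inv]; norm_num
  have e3 : Real.log (1 - 1 / 3) = Real.log 2 - Real.log 3 := by
    rw [← Real.log_div (by norm_num) (by norm_num)]; norm_num
  have eφ : Real.log (1 - 1 / goldenRatio ^ 2) = -Real.log goldenRatio := by
    rw [← Real.log_inv]
    congr 1
    have hφ := Real.goldenRatio_pos
    have hφ2 := Real.goldenRatio_sq
    generalize goldenRatio = x at hφ hφ2 ⊢
    field_simp
    linarith
  rw [e2] at key2
  rw [e3] at key3
  rw [eφ] at keyφ
  have c1 : ((5 : ℝ) * K₂ + 2 + (5 * K₃ + 2)) ≤ ε := by exact_mod_cast hε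
  have c2 : (5 : ℝ) * K + 2 ≤ ε := by exact_mod_cast hε'
  have c3 : (0 : ℝ) ≤ 5 * K₃ + 2 := by positivity
  refine ⟨hm, by omega, ?_, ?_, ?_⟩
  · rw [abs_le] at *
    constructor <;> linarith [key2.1, key2.2]
  · push_cast
    rw [abs_le] at *
    constructor <;> linarith [key2.1, key2.2, key3.1, key3.2]
  · rw [abs_le] at *
    constructor <;> linarith [keyφ.1, keyφ.2]

theorem log_pow_sub_one {d : ℕ} (hd : 0 < d) :
    Real.log (goldenRatio ^ d - 1) =
      d * Real.log goldenRatio + Real.log (1 - 1 / goldenRatio ^ d) := by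
  have h1 : 1 < goldenRatio ^ d := one_lt_pow₀ Real.one_lt_goldenRatio hd.ne'
  have h2 : 1 / goldenRatio ^ d < 1 := by rw [div_lt_one (by linarith)]; exact h1
  rw [← Real.log_pow, ← Real.log_mul (by positivity) (by linarith)]
  congr 1
  field_simp

theorem IsLogApprox.abs_log_pow_sub_one_le {m ε A₂ A₃ A d K : ℕ} (hA : IsLogApprox m ε A₂ A₃ A)
    (hd : 2 ≤ d) (hdm : d ≤ m) (hK : m ≤ d * (K + 1)) (hε : 5 * K + 2 ≤ ε) :
    |Nat.fib m * Real.log (goldenRatio ^ d - 1) -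
      (d * A - negLogOneSub (Nat.fib m) (Nat.fib (m - d)) K)| ≤ (d + 1) * ε := by
  have h1 := abs_fib_mul_log_one_sub_add_le hA.hundred_le hd hdm hK
  have h2 := hA.phi
  have c2 : (5 : ℝ) * K + 2 ≤ ε := by exact_mod_cast hε
  rw [log_pow_sub_one (by omega)]
  have e : Nat.fib m * (d * Real.log goldenRatio + Real.log (1 - 1 / goldenRatio ^ d)) -
      (d * A - negLogOneSub (Nat.fib m) (Nat.fib (m - d)) K) =
      d * (Nat.fib m * Real.log goldenRatio - A) + (Nat.fib m * Real.log (1 - 1 / goldenRatio ^ d) +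
        negLogOneSub (Nat.fib m) (Nat.fib (m - d)) K) := by ring
  rw [e, add_mul, one_mul]
  refine (abs_add_le _ _).trans (add_le_add ?_ (h1.trans c2))
  rw [abs_mul, Nat.abs_cast]
  gcongr

/-- Bound for the distance, in units of `1 / F_m`, between `q * (x log 2 + y log 3 - n log φ)` and
`(p₁ * x + p₂ * y - q * n) * log φ`, when `|x|, |y| ≤ N`. -/
def reductionError (N ε A₂ A₃ A q p₁ p₂ : ℕ) : ℕ :=
  N * ((q * A₂ - p₁ * A) + (p₁ * A - q * A₂) + (q + p₁) * ε) +
    N * ((q * A₃ - p₂ * A) + (p₂ * A - q * A₃) + (q + p₂) * ε)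

theorem abs_natCast_sub_le (a b : ℕ) : |(a : ℝ) - b| ≤ ((a - b) + (b - a) : ℕ) := by
  rcases le_total a b with h | h
  · rw [Nat.sub_eq_zero_of_le h, zero_add, Nat.cast_sub h, abs_sub_comm, abs_of_nonneg]
    simpa using h
  · rw [Nat.sub_eq_zero_of_le h, add_zero, Nat.cast_sub h, abs_of_nonneg]
    simpa using h

theorem abs_mul_sub_mul_le {a b A B ε : ℝ} {p q : ℕ} (ha : |a - A| ≤ ε) (hb : |b - B| ≤ ε) :
    |p * a - q * b| ≤ |q * B - p * A| + (q + p) * ε := by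
  have e : p * a - q * b = -(q * B - p * A) + (p * (a - A) + -(q * (b - B))) := by ring
  rw [e]
  refine (abs_add_le _ _).trans (add_le_add (abs_neg _).le ((abs_add_le _ _).trans ?_))
  rw [abs_neg, abs_mul, abs_mul, Nat.abs_cast, Nat.abs_cast]
  have := mul_le_mul_of_nonneg_left ha (Nat.cast_nonneg (α := ℝ) p)
  have := mul_le_mul_of_nonneg_left hb (Nat.cast_nonneg (α := ℝ) q)
  linarith

namespace IsLogApprox

variable {m ε A₂ A₃ A : ℕ}

theorem abs_sub_le_reductionError (hA : IsLogApprox m ε A₂ A₃ A) {N : ℕ} (q p₁ p₂ : ℕ)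
    {x y n : ℤ} (hx : |x| ≤ N) (hy : |y| ≤ N) :
    |((p₁ * x + p₂ * y - q * n : ℤ) : ℝ) * (Nat.fib m * Real.log goldenRatio) -
      q * (Nat.fib m * (x * Real.log 2 + y * Real.log 3 - n * Real.log goldenRatio))| ≤
      reductionError N ε A₂ A₃ A q p₁ p₂ := by
  have h1 := abs_mul_sub_mul_le (p := p₁) (q := q) hA.phi hA.two
  have h2 := abs_mul_sub_mul_le (p := p₂) (q := q) hA.phi hA.three
  have h3 := abs_natCast_sub_le (q * A₂) (p₁ * A)
  have h4 := abs_natCast_sub_le (q * A₃) (p₂ * A)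
  have hx' : |(x : ℝ)| ≤ N := by exact_mod_cast hx
  have hy' : |(y : ℝ)| ≤ N := by exact_mod_cast hy
  have e : ((p₁ * x + p₂ * y - q * n : ℤ) : ℝ) * (Nat.fib m * Real.log goldenRatio) -
      q * (Nat.fib m * (x * Real.log 2 + y * Real.log 3 - n * Real.log goldenRatio)) =
      x * (p₁ * (Nat.fib m * Real.log goldenRatio) - q * (Nat.fib m * Real.log 2)) +
      y * (p₂ * (Nat.fib m * Real.log goldenRatio) - q * (Nat.fib m * Real.log 3)) := by
    push_cast; ring
  rw [e, reductionError]
  refine (abs_add_le _ _).trans ?_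
  rw [abs_mul, abs_mul]
  push_cast [-Nat.cast_sub] at h3 h4 ⊢
  refine add_le_add (mul_le_mul hx' (h1.trans ?_) (abs_nonneg _) (by positivity))
    (mul_le_mul hy' (h2.trans ?_) (abs_nonneg _) (by positivity)) <;> gcongr

theorem sub_le_mul_log (hA : IsLogApprox m ε A₂ A₃ A) :
    (A : ℝ) - ε ≤ Nat.fib m * Real.log goldenRatio := by
  linarith [(abs_le.1 hA.phi).1]

/-- A homogeneous relation that is small enough is annihilated by every good approximation. -/
theorem reduction_eq_zero (hA : IsLogApprox m ε A₂ A₃ A) {N R q p₁ p₂ : ℕ}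
    {x y n : ℤ} (hx : |x| ≤ N) (hy : |y| ≤ N)
    (hR : |Nat.fib m * (x * Real.log 2 + y * Real.log 3 - n * Real.log goldenRatio)| ≤ R)
    (h : q * R + reductionError N ε A₂ A₃ A q p₁ p₂ + ε < A) :
    p₁ * x + p₂ * y - q * n = 0 := by
  have h1 := hA.abs_sub_le_reductionError q p₁ p₂ (n := n) hx hy
  have h2 := hA.sub_le_mul_log
  have h3 : (q : ℝ) * R + reductionError N ε A₂ A₃ A q p₁ p₂ + ε < A := by exact_mod_cast h
  by_contra h0
  have h4 : (1 : ℝ) ≤ |((p₁ * x + p₂ * y - q * n : ℤ) : ℝ)| := by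
    exact_mod_cast Int.one_le_abs h0
  set G : ℝ := ((p₁ * x + p₂ * y - q * n : ℤ) : ℝ)
  set P := (Nat.fib m : ℝ) * Real.log goldenRatio
  set Y := (Nat.fib m : ℝ) * (x * Real.log 2 + y * Real.log 3 - n * Real.log goldenRatio)
  have h5 : |G * P| ≤ |G * P - q * Y| + |(q : ℝ) * Y| := by
    have := abs_add_le (G * P - q * Y) (q * Y); rwa [sub_add_cancel] at this
  have h6 : |(q : ℝ) * Y| ≤ q * R := by
    rw [abs_mul, Nat.abs_cast]; gcongr
  have h7 : 0 < P := by
    have : (0 : ℝ) ≤ q * R := by positivity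
    have : (0 : ℝ) ≤ reductionError N ε A₂ A₃ A q p₁ p₂ := by positivity
    linarith
  have h8 : P ≤ |G * P| := by
    rw [abs_mul, abs_of_pos h7]; nlinarith
  linarith

/-- An inhomogeneous relation that is small enough is excluded by a good approximation. -/
theorem reduction_false (hA : IsLogApprox m ε A₂ A₃ A) {N R q p₁ p₂ d B : ℕ} {L : ℝ}
    {x y n : ℤ} (hx : |x| ≤ N) (hy : |y| ≤ N)
    (hL : |Nat.fib m * L - B| ≤ (d + 1) * ε) (hL0 : 0 ≤ L) (hLd : L ≤ d * Real.log goldenRatio)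
    (hR : |Nat.fib m * (x * Real.log 2 + y * Real.log 3 - n * Real.log goldenRatio - L)| ≤ R)
    (h1 : q * R + reductionError N ε A₂ A₃ A q p₁ p₂ + (2 * q * d + q + 1) * ε < q * B % A)
    (h2 : q * R + reductionError N ε A₂ A₃ A q p₁ p₂ + (2 * q * d + q + 1) * ε < A - q * B % A) :
    False := by
  have a1 := hA.abs_sub_le_reductionError q p₁ p₂ (n := n) hx hy
  have a2 := hA.sub_le_mul_log
  have a3 := hA.phi
  set X := q * R + reductionError N ε A₂ A₃ A q p₁ p₂ + (2 * q * d + q + 1) * ε with hX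
  have hXA : (X : ℝ) < A := by exact_mod_cast (by omega : X < A)
  rw [hX] at hXA
  set G : ℤ := p₁ * x + p₂ * y - q * n
  set P := (Nat.fib m : ℝ) * Real.log goldenRatio with hP
  set Y := (Nat.fib m : ℝ) * (x * Real.log 2 + y * Real.log 3 - n * Real.log goldenRatio) with hY
  have b1 : |(G : ℝ) * P - q * (Nat.fib m * L)| ≤
      reductionError N ε A₂ A₃ A q p₁ p₂ + q * R := by
    have e : (G : ℝ) * P - q * (Nat.fib m * L) = (G * P - q * Y) + q * (Nat.fib m *
        (x * Real.log 2 + y * Real.log 3 - n * Real.log goldenRatio - L)) := by rw [hY]; ring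
    rw [e]
    refine (abs_add_le _ _).trans (add_le_add a1 ?_)
    rw [abs_mul, Nat.abs_cast]; gcongr
  have b2 : (reductionError N ε A₂ A₃ A q p₁ p₂ : ℝ) + q * R + ε < A := by
    push_cast at hXA
    have : (0 : ℝ) ≤ (2 * q * d + q) * ε := by positivity
    linarith
  have b3 : 0 < P := by
    have : (0 : ℝ) ≤ q * R := by positivity
    have : (0 : ℝ) ≤ reductionError N ε A₂ A₃ A q p₁ p₂ := by positivity
    linarith
  have b4 : |(G : ℝ)| ≤ q * d + 1 := by
    have c1 : |(G : ℝ) * P| ≤ |(G : ℝ) * P - q * (Nat.fib m * L)| + |q * (Nat.fib m * L)| := by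
      have := abs_add_le ((G : ℝ) * P - q * (Nat.fib m * L)) (q * (Nat.fib m * L))
      rwa [sub_add_cancel] at this
    have c2 : |(q : ℝ) * (Nat.fib m * L)| ≤ q * d * P := by
      rw [abs_of_nonneg (by positivity), hP]
      calc (q : ℝ) * (Nat.fib m * L) ≤ q * (Nat.fib m * (d * Real.log goldenRatio)) := by gcongr
        _ = _ := by ring
    rw [abs_mul, abs_of_pos b3] at c1
    by_contra! hlt
    nlinarith
  have b5 : |((G * A - (q * B : ℕ) : ℤ) : ℝ)| ≤ X := by
    have e : ((G * A - (q * B : ℕ) : ℤ) : ℝ) = (G * P - q * (Nat.fib m * L)) +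
        (-(G * (P - A)) + q * (Nat.fib m * L - B)) := by push_cast; ring
    have c1 : |-((G : ℝ) * (P - A))| ≤ (q * d + 1) * ε := by
      rw [abs_neg, abs_mul]; gcongr
    have c2 : |(q : ℝ) * (Nat.fib m * L - B)| ≤ q * ((d + 1) * ε) := by
      rw [abs_mul, Nat.abs_cast]; gcongr
    rw [e]
    refine (abs_add_le _ _).trans ((add_le_add b1 ((abs_add_le _ _).trans (add_le_add c1 c2))).trans
      (le_of_eq ?_))
    rw [hX]; push_cast; ring
  have b6 : |G * A - (q * B : ℕ)| ≤ X := by exact_mod_cast b5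
  have b7 : ((q * B : ℕ) : ℤ) = A * (q * B / A : ℕ) + (q * B % A : ℕ) := by
    exact_mod_cast (Nat.div_add_mod (q * B) A).symm
  rw [b7] at b6
  have b8 : q * B % A < A := by
    by_contra! hge
    omega
  generalize q * B % A = r at *
  generalize q * B / A = k at *
  rw [abs_le] at b6
  rcases le_or_gt G k with hG | hG
  · have : G * A ≤ k * A := mul_le_mul_of_nonneg_right hG (by positivity)
    have : (A : ℤ) * k = k * A := mul_comm _ _
    omega
  · have : (k + 1 : ℤ) * A ≤ G * A := mul_le_mul_of_nonneg_right hG (by positivity)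
    have : (A : ℤ) * k = k * A := mul_comm _ _
    have : (k + 1 : ℤ) * A = k * A + A := by ring
    omega

end IsLogApprox

theorem log_goldenRatio_sq_sub_one :
    Real.log (goldenRatio ^ 2 - 1) = (0 : ℤ) * Real.log 2 + (1 : ℤ) * Real.log goldenRatio := by
  rw [Real.goldenRatio_sq]; simp

theorem log_goldenRatio_pow_three_sub_one :
    Real.log (goldenRatio ^ 3 - 1) = (1 : ℤ) * Real.log 2 + (1 : ℤ) * Real.log goldenRatio := by
  have e : goldenRatio ^ 3 - 1 = 2 * goldenRatio := by
    linear_combination (goldenRatio + 1) * Real.goldenRatio_sq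
  rw [e, Real.log_mul (by norm_num) Real.goldenRatio_pos.ne']; push_cast; ring

theorem log_goldenRatio_pow_six_sub_one :
    Real.log (goldenRatio ^ 6 - 1) = (2 : ℤ) * Real.log 2 + (3 : ℤ) * Real.log goldenRatio := by
  have h := Real.goldenRatio_sq
  have e : goldenRatio ^ 6 - 1 = 2 ^ 2 * goldenRatio ^ 3 := by
    have h3 : goldenRatio ^ 3 = 2 * goldenRatio + 1 := by
      linear_combination (goldenRatio + 1) * h
    have h6 : goldenRatio ^ 6 = (goldenRatio ^ 3) ^ 2 := by ring
    rw [h6, h3]; linear_combination 4 * h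
  rw [e, Real.log_mul (by norm_num) (by positivity), Real.log_pow, Real.log_pow]; push_cast; ring

/-- Sequential evaluation of the Fibonacci recursion. -/
def fibIter : ℕ → ℕ → ℕ → ℕ
  | 0, a, _ => a
  | j + 1, a, b => force (a + b) fun c ↦ fibIter j b c

theorem fibIter_eq (j n : ℕ) : fibIter j (Nat.fib n) (Nat.fib (n + 1)) = Nat.fib (n + j) := by
  induction j generalizing n with
  | zero => rfl
  | succ j ih =>
    rw [fibIter, force_eq, ← Nat.fib_add_two, ih (n + 1)]
    congr 1; ring

theorem fibIter_zero_one (j : ℕ) : fibIter j 0 1 = Nat.fib j := by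
  simpa using fibIter_eq j 0

/-- Pass `F_m` and the approximate logarithms to `k`, after checking the number of terms. -/
def withLogs (m ε K₂ K₃ : ℕ) (k : ℕ → ℕ → ℕ → ℕ → Bool) : Bool :=
  force (fibIter m 0 1) fun E ↦ force (fibIter (m - 2) 0 1) fun E' ↦
    force (negLogOneSub E (E / 2) K₂) fun A₂ ↦ force (A₂ + negLogOneSub E (E / 3) K₃) fun A₃ ↦
    force (negLogOneSub E E' (m / 2)) fun A ↦
      Nat.ble 100 E && Nat.ble 2 m && Nat.ble E (2 ^ (K₂ + 1)) && Nat.ble E (3 ^ (K₃ + 1)) &&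
        Nat.ble (5 * K₂ + 2 + (5 * K₃ + 2)) ε && Nat.ble (5 * (m / 2) + 2) ε && k E A₂ A₃ A

theorem exists_isLogApprox_of_withLogs {m ε K₂ K₃ : ℕ} {k : ℕ → ℕ → ℕ → ℕ → Bool}
    (h : withLogs m ε K₂ K₃ k = true) :
    ∃ A₂ A₃ A, IsLogApprox m ε A₂ A₃ A ∧ k (Nat.fib m) A₂ A₃ A = true := by
  simp only [withLogs, force_eq, fibIter_zero_one, Bool.and_eq_true, Nat.ble_eq] at h
  obtain ⟨⟨⟨⟨⟨⟨h1, h2⟩, h3⟩, h4⟩, h5⟩, h6⟩, h7⟩ := h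
  exact ⟨_, _, _, .of_series h1 h2 h3 h4 (by omega) h5 h6, h7⟩

/-- Certificate that every vector of `l` annihilates relations of size `R` with coefficients at
most `N`. -/
def annihilates (N R ε A₂ A₃ A : ℕ) : List (ℕ × ℕ × ℕ) → Bool
  | [] => true
  | (q, p₁, p₂) :: l =>
    Nat.blt (q * R + reductionError N ε A₂ A₃ A q p₁ p₂ + ε) A && annihilates N R ε A₂ A₃ A l

theorem IsLogApprox.eq_zero_of_annihilates {m ε A₂ A₃ A : ℕ} (hA : IsLogApprox m ε A₂ A₃ A)
    {N R : ℕ} {x y n : ℤ} (hx : |x| ≤ N) (hy : |y| ≤ N)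
    (hR : |Nat.fib m * (x * Real.log 2 + y * Real.log 3 - n * Real.log goldenRatio)| ≤ R)
    {v₁ v₂ v₃ : ℕ × ℕ × ℕ} (hdet : (v₁.1 * (v₂.2.1 * v₃.2.2 - v₂.2.2 * v₃.2.1) -
      v₂.1 * (v₁.2.1 * v₃.2.2 - v₁.2.2 * v₃.2.1) +
      v₃.1 * (v₁.2.1 * v₂.2.2 - v₁.2.2 * v₂.2.1) : ℤ) ≠ 0)
    (h : annihilates N R ε A₂ A₃ A [v₁, v₂, v₃] = true) : n = 0 := by
  obtain ⟨q₁, a₁, b₁⟩ := v₁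
  obtain ⟨q₂, a₂, b₂⟩ := v₂
  obtain ⟨q₃, a₃, b₃⟩ := v₃
  simp only [annihilates, Bool.and_eq_true, Nat.blt_eq, and_true] at h hdet
  have h1 := hA.reduction_eq_zero hx hy hR h.1
  have h2 := hA.reduction_eq_zero hx hy hR h.2.1
  have h3 := hA.reduction_eq_zero hx hy hR h.2.2
  have key : n * (q₁ * (a₂ * b₃ - b₂ * a₃) - q₂ * (a₁ * b₃ - b₁ * a₃) +
      q₃ * (a₁ * b₂ - b₁ * a₂) : ℤ) = 0 := by
    linear_combination (-((a₂ : ℤ) * b₃ - b₂ * a₃)) * h1 + ((a₁ : ℤ) * b₃ - b₁ * a₃) * h2 -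
      ((a₁ : ℤ) * b₂ - b₁ * a₂) * h3
  exact (mul_eq_zero.1 key).resolve_right hdet

/-- Certificate that some vector of `l` excludes inhomogeneous relations of size `R`. -/
def excludes (N R ε A₂ A₃ A d B : ℕ) : List (ℕ × ℕ × ℕ) → Bool
  | [] => false
  | (q, p₁, p₂) :: l =>
    force (q * R + reductionError N ε A₂ A₃ A q p₁ p₂ + (2 * q * d + q + 1) * ε) (fun X ↦
      force (q * B % A) fun r ↦ Nat.blt X r && Nat.blt X (A - r)) ||
      excludes N R ε A₂ A₃ A d B l

theorem IsLogApprox.false_of_excludes {m ε A₂ A₃ A : ℕ} (hA : IsLogApprox m ε A₂ A₃ A)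
    {N R d B : ℕ} {L : ℝ} {x y n : ℤ} (hx : |x| ≤ N) (hy : |y| ≤ N)
    (hL : |Nat.fib m * L - B| ≤ (d + 1) * ε) (hL0 : 0 ≤ L) (hLd : L ≤ d * Real.log goldenRatio)
    (hR : |Nat.fib m * (x * Real.log 2 + y * Real.log 3 - n * Real.log goldenRatio - L)| ≤ R)
    {l : List (ℕ × ℕ × ℕ)} (h : excludes N R ε A₂ A₃ A d B l = true) : False := by
  induction l with
  | nil => simp [excludes] at h
  | cons v l ih =>
    obtain ⟨q, p₁, p₂⟩ := v
    simp only [excludes, force_eq, Bool.or_eq_true, Bool.and_eq_true, Nat.blt_eq] at h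
    rcases h with h | h
    · exact hA.reduction_false hx hy hL hL0 hLd hR h.1 h.2
    · exact ih h

/-- Check the gaps `d, d + 1, …`, other than `6`, starting with `a = F_{m-d}`, `b = F_{m-d-1}`. -/
def excludesGaps (m N R ε E A₂ A₃ A : ℕ) (l : List (ℕ × ℕ × ℕ)) : ℕ → ℕ → ℕ → ℕ → Bool
  | 0, _, _, _ => true
  | j + 1, d, a, b =>
    (Nat.beq d 6 || force (negLogOneSub E a (m / d)) fun S ↦
      Nat.ble S (d * A) && Nat.ble (5 * (m / d) + 2) ε &&
        force (d * A - S) fun B ↦ excludes N R ε A₂ A₃ A d B l) &&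
    force (d + 1) fun d' ↦ force (a - b) fun b' ↦ excludesGaps m N R ε E A₂ A₃ A l j d' b b'

theorem excludes_of_excludesGaps {m N R ε A₂ A₃ A d : ℕ} {l : List (ℕ × ℕ × ℕ)} (hd6 : d ≠ 6)
    (j d₀ : ℕ) (h₀ : d₀ ≤ d) (hd : d < d₀ + j) (hm : d₀ + j < m)
    (h : excludesGaps m N R ε (Nat.fib m) A₂ A₃ A l j d₀ (Nat.fib (m - d₀)) (Nat.fib (m - d₀ - 1))
      = true) :
    negLogOneSub (Nat.fib m) (Nat.fib (m - d)) (m / d) ≤ d * A ∧ 5 * (m / d) + 2 ≤ ε ∧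
      excludes N R ε A₂ A₃ A d (d * A - negLogOneSub (Nat.fib m) (Nat.fib (m - d)) (m / d)) l
        = true := by
  induction j generalizing d₀ with
  | zero => omega
  | succ j ih =>
    simp only [excludesGaps, force_eq, Bool.and_eq_true, Bool.or_eq_true, Nat.ble_eq,
      Nat.beq_eq] at h
    obtain ⟨h1, h2⟩ := h
    rcases h₀.eq_or_lt with rfl | hlt
    · obtain ⟨⟨h3, h4⟩, h5⟩ := h1.resolve_left hd6
      exact ⟨h3, h4, h5⟩
    · have e : Nat.fib (m - d₀) - Nat.fib (m - d₀ - 1) = Nat.fib (m - (d₀ + 1) - 1) := by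
        obtain ⟨k, rfl⟩ : ∃ k, m = d₀ + 2 + k := ⟨m - d₀ - 2, by omega⟩
        rw [show d₀ + 2 + k - d₀ = k + 2 by omega, show k + 2 - 1 = k + 1 by omega,
          show d₀ + 2 + k - (d₀ + 1) - 1 = k by omega, Nat.fib_add_two]
        omega
      rw [e, Nat.sub_sub m d₀ 1] at h2
      exact ih (d₀ + 1) (by omega) (by omega) (by omega) h2

theorem fib_mul_goldenRatio_div_le {m D n : ℕ} (hD : 1 ≤ D) (hDm : D ≤ m + 1) (hn : D ≤ n) :
    Nat.fib m * (goldenRatio / goldenRatio ^ n) ≤ Nat.fib (m + 1 - D) + 1 := by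
  have hφ := Real.goldenRatio_pos
  have h1 := (abs_le.1 (abs_fib_div_pow_sub_le (m := m) (d := D - 1) (by omega))).2
  rw [show m - (D - 1) = m + 1 - D by omega] at h1
  have h2 : goldenRatio / goldenRatio ^ n ≤ 1 / goldenRatio ^ (D - 1) := by
    rw [div_le_div_iff₀ (by positivity) (by positivity), ← pow_succ', one_mul]
    exact pow_le_pow_right₀ Real.one_lt_goldenRatio.le (by omega)
  have h3 := mul_le_mul_of_nonneg_left h2 (Nat.cast_nonneg (α := ℝ) (Nat.fib m))
  linarith

namespace PillaiTriple

variable (T : PillaiTriple)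

theorem abs_exponents_le {N : ℕ} (hN : T.n₁ ≤ N) : |(T.x₁ : ℤ)| ≤ N ∧ |(T.y₁ : ℤ)| ≤ N := by
  obtain ⟨hx, hy⟩ := exponents_le T.c_pos T.eq₁
  rw [Nat.abs_cast, Nat.abs_cast]
  omega

/-- Reduction of the bound for `n₁ - n₃`. -/
theorem sub_lt_of_withLogs {m ε K₂ K₃ N D : ℕ} {v₁ v₂ v₃ : ℕ × ℕ × ℕ} (hN : T.n₁ ≤ N)
    (hD : 1 ≤ D) (hDm : D ≤ m + 1) (hdet : (v₁.1 * (v₂.2.1 * v₃.2.2 - v₂.2.2 * v₃.2.1) -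
      v₂.1 * (v₁.2.1 * v₃.2.2 - v₁.2.2 * v₃.2.1) +
      v₃.1 * (v₁.2.1 * v₂.2.2 - v₁.2.2 * v₂.2.1) : ℤ) ≠ 0)
    (h : withLogs m ε K₂ K₃ (fun _ A₂ A₃ A ↦ force (fibIter (m + 1 - D) 0 1 + 1) fun R ↦
      annihilates N R ε A₂ A₃ A [v₁, v₂, v₃]) = true) : T.n₁ - T.n₃ < D := by
  obtain ⟨A₂, A₃, A, hA, h⟩ := exists_isLogApprox_of_withLogs h
  rw [force_eq, fibIter_zero_one] at h
  by_contra! hle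
  obtain ⟨hx, hy⟩ := T.abs_exponents_le hN
  obtain ⟨h1, h2⟩ := T.form₁
  have h3 := (mul_le_mul_of_nonneg_left h2 (Nat.cast_nonneg (α := ℝ) (Nat.fib m))).trans
    (fib_mul_goldenRatio_div_le hD hDm hle)
  have := hA.eq_zero_of_annihilates (n := T.n₁) hx hy (by
    push_cast
    rw [abs_mul, Nat.abs_cast, ← neg_sub, abs_neg, abs_of_pos h1]
    exact h3) hdet h
  have := T.lt₂₁
  omega

/-- Reduction of the bound for `n₃`. -/
theorem lt_of_withLogs {m ε K₂ K₃ N D n U : ℕ} {v₁ v₂ v₃ : ℕ × ℕ × ℕ} (hN : T.n₁ ≤ N)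
    (hU : (2 : ℤ) ^ T.x₃ * 3 ^ T.y₃ ≤ U) (hD : T.n₁ - T.n₃ < D) (hDm : D < m)
    (hn : 1 ≤ n) (hnm : n ≤ m + 1)
    (hdet : (v₁.1 * (v₂.2.1 * v₃.2.2 - v₂.2.2 * v₃.2.1) -
      v₂.1 * (v₁.2.1 * v₃.2.2 - v₁.2.2 * v₃.2.1) +
      v₃.1 * (v₁.2.1 * v₂.2.2 - v₁.2.2 * v₂.2.1) : ℤ) ≠ 0)
    (h : withLogs m ε K₂ K₃ (fun E A₂ A₃ A ↦
      force (2 * U * (fibIter (m + 1 - n) 0 1 + 1)) fun R ↦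
        annihilates N R ε A₂ A₃ A [v₁, v₂, v₃] &&
        force (fibIter (m - 4) 0 1) fun a ↦ force (fibIter (m - 5) 0 1) fun b ↦
          excludesGaps m N R ε E A₂ A₃ A [v₁, v₂, v₃] (D - 4) 4 a b) = true) : T.n₃ < n := by
  obtain ⟨A₂, A₃, A, hA, h⟩ := exists_isLogApprox_of_withLogs h
  simp only [force_eq, fibIter_zero_one, Bool.and_eq_true] at h
  obtain ⟨hann, hex⟩ := h
  by_contra! hle
  have hlt := T.lt₃₂
  have hlt' := T.lt₂₁
  have h2le := T.two_le
  obtain ⟨hx, hy⟩ := T.abs_exponents_le hN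
  obtain ⟨h1, h2⟩ := T.form₂
  set R := 2 * U * (Nat.fib (m + 1 - n) + 1) with hR
  have h3 : |Nat.fib m * (T.x₁ * Real.log 2 + T.y₁ * Real.log 3 - T.n₃ * Real.log goldenRatio -
      Real.log (goldenRatio ^ (T.n₁ - T.n₃) - 1))| ≤ R := by
    rw [abs_mul, Nat.abs_cast, abs_of_nonneg h1]
    have hU' : (2 : ℝ) ^ T.x₃ * 3 ^ T.y₃ ≤ U := by exact_mod_cast hU
    have h4 := fib_mul_goldenRatio_div_le hn hnm hle
    calc _ ≤ Nat.fib m * (2 * (2 ^ T.x₃ * 3 ^ T.y₃) * goldenRatio / goldenRatio ^ T.n₃) := by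
          gcongr
      _ = 2 * (2 ^ T.x₃ * 3 ^ T.y₃) * (Nat.fib m * (goldenRatio / goldenRatio ^ T.n₃)) := by ring
      _ ≤ 2 * U * (Nat.fib (m + 1 - n) + 1) := by
          have := Real.goldenRatio_pos
          gcongr
      _ = R := by rw [hR]; push_cast; ring
  have hom : ∀ a k : ℤ, 0 ≤ a → a ≤ 2 → 0 ≤ k →
      Real.log (goldenRatio ^ (T.n₁ - T.n₃) - 1) = a * Real.log 2 + k * Real.log goldenRatio →
      False := by
    intro a k ha0 ha2 hk e
    have := hA.eq_zero_of_annihilates (x := T.x₁ - a) (n := T.n₃ + k)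
      (by rw [abs_le] at hx ⊢; omega) hy (by
        rw [e] at h3
        convert h3 using 3
        push_cast; ring) hdet hann
    omega
  rcases (by omega : T.n₁ - T.n₃ = 2 ∨ T.n₁ - T.n₃ = 3 ∨ T.n₁ - T.n₃ = 6 ∨
    4 ≤ T.n₁ - T.n₃ ∧ T.n₁ - T.n₃ ≠ 6) with hd | hd | hd | ⟨hd, hd6⟩
  · exact hom 0 1 (by norm_num) (by norm_num) (by norm_num) (hd ▸ log_goldenRatio_sq_sub_one)
  · exact hom 1 1 (by norm_num) (by norm_num) (by norm_num) (hd ▸ log_goldenRatio_pow_three_sub_one)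
  · exact hom 2 3 (by norm_num) (by norm_num) (by norm_num) (hd ▸ log_goldenRatio_pow_six_sub_one)
  · generalize T.n₁ - T.n₃ = d at *
    obtain ⟨e1, e2, e3⟩ := excludes_of_excludesGaps hd6 (D - 4) 4 hd (by omega) (by omega) hex
    have hφd : 2 ≤ goldenRatio ^ d := by
      have hg := goldenRatio_bounds
      calc (2 : ℝ) ≤ goldenRatio ^ 2 := by nlinarith [hg.1]
        _ ≤ goldenRatio ^ d := pow_le_pow_right₀ (by linarith [hg.1]) (by omega)
    have hL := hA.abs_log_pow_sub_one_le (by omega : 2 ≤ d) (by omega)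
      (by rw [mul_add, mul_one]; have := Nat.div_add_mod m d; have :=
          Nat.mod_lt m (by omega : 0 < d); omega) e2
    refine hA.false_of_excludes (n := T.n₃) hx hy (L := Real.log (goldenRatio ^ d - 1)) ?_
      (Real.log_nonneg (by linarith)) ?_ (by push_cast; exact h3) e3
    · rw [Nat.cast_sub e1]; push_cast; exact hL
    · rw [← Real.log_pow]
      exact Real.log_le_log (by linarith) (by linarith)

end PillaiTriple

/-- Simultaneous approximation vector used to reduce the bounds for `n ≤ 2 ^ 320`. -/
def largeApprox₁ : ℕ × ℕ × ℕ :=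
  (3365507104324556571901419186437602048581774540142053512534405843816863487946213314312679990013438051627229923386116979716813097565695549936551628473291795186971555334073136721854064255872638446,
    4847744047495278927577028124750642510758936865384467577936975995409652396415803918058306173520955594610821991701329111362887042903251737390280535468206633904190590399946996670875468824278283669,
    7683492528374216613206593670756136912780647885977144017062405434130706497136828280913577638113996651858469564511512787037370029647535327290840922286089207068072686027466045772976459301332774518)

def largeApprox₂ : ℕ × ℕ × ℕ :=
  (10737480884932015876631890861031033418568942848072321856045037529066390055366428895925656927163320361684945153640382928885663456416434304729512994866845731798724150959965369723956288235027703847,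
    15466483187076871260305352646678429655876727121718695062898616494931132373694831977635781459087154336756564066063603940731874826459709152566016239063162597464556620234671729700822256607833575958,
    24513795869551075520622533273662444494554971950895103132720206672982787471421578639254567419175775821299923591542787367727606108029601134915479943912656773473665963635515535880232798918146157792)

def largeApprox₃ : ℕ × ℕ × ℕ :=
  (19680703670153426021600536893925224969560784434557754245519223579605158111029216563039978845371930949112922589490756563852128084417142260486056891617476496382732974044236806162383404303422446575,
    28348480959945130034588487988410155930654474658567844304786814109684649900141444979895617536536825422177544276124276329659210451129043078198137279987393582245701816469803120817157625284989435934,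
    44931279273920715441534510151913050565517182373976904896096195610123921536917374510591100192430576324610365703870777790973747715269030899521033510183682872590405375468537529828575915651660666737)

/-- Simultaneous approximation vector used to reduce the bounds for `n ≤ 2 ^ 101`. -/
def midApprox₁ : ℕ × ℕ × ℕ :=
  (107365159327530876436341455952687426693527519922164799936477886,
    154650932505720556615538404950150247273431369777625161272936231,
    245115928723125593658840637213549166402925623035149630051841515)

def midApprox₂ : ℕ × ℕ × ℕ :=
  (974914618324629164910053346541708412696458664213743555810286728,
    1404286602671685333215112984108137905985489071427572860550563029,
    2225741605499731028995315024905935361082549758951396965690573680)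

def midApprox₃ : ℕ × ℕ × ℕ :=
  (914860759902994944933693094360168383146311884301045647035805147,
    1317783818494372103747836405297685727252362336949015058810922446,
    2088637936370714192013358553018516211486211893299691371676110594)

/-- Simultaneous approximation vector used to reduce the bounds for `n ≤ 2 ^ 10`. -/
def smallApprox₁ : ℕ × ℕ × ℕ := (8301070, 11957028, 18951441)

def smallApprox₂ : ℕ × ℕ × ℕ := (30690060, 44206579, 70065770)

def smallApprox₃ : ℕ × ℕ × ℕ := (74417409, 107192331, 169895825)

namespace PillaiTriple

variable (T : PillaiTriple)

theorem sub_lt_931 (hN : T.n₁ ≤ 2 ^ 320) : T.n₁ - T.n₃ < 931 :=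
  T.sub_lt_of_withLogs (m := 1500) (ε := 8484) (K₂ := 1040) (K₃ := 656) (v₁ := largeApprox₁)
    (v₂ := largeApprox₂) (v₃ := largeApprox₃) hN (by norm_num) (by norm_num) (by decide +kernel)
    (by decide +kernel)

set_option exponentiation.threshold 400 in
theorem le_two_pow_101 : T.n₁ ≤ 2 ^ 101 := by
  have h0 : T.n₁ ≤ 2 ^ 320 := T.lt_two_pow_320.le
  have hD : T.n₁ - T.n₃ ≤ 930 := Nat.le_of_lt_succ (T.sub_lt_931 h0)
  have h1 : T.n₁ ≤ 2 ^ 213 :=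
    (T.descent h0 hD (ℓ := 347) (u := 159 * 2 ^ 162) (by norm_num) (by norm_num)
        (by norm_num)).trans (by norm_num)
  have h2 : T.n₁ ≤ 2 ^ 158 :=
    (T.descent h1 hD (ℓ := 239) (u := 225 * 2 ^ 108) (by norm_num) (by norm_num)
        (by norm_num)).trans (by norm_num)
  have h3 : T.n₁ ≤ 2 ^ 130 :=
    (T.descent h2 hD (ℓ := 184) (u := 159 * 2 ^ 81) (by norm_num) (by norm_num)
        (by norm_num)).trans (by norm_num)
  have h4 : T.n₁ ≤ 2 ^ 116 :=
    (T.descent h3 hD (ℓ := 156) (u := 2 ^ 75) (by norm_num) (by norm_num) (by norm_num)).trans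
        (by norm_num)
  have h5 : T.n₁ ≤ 2 ^ 108 :=
    (T.descent h4 hD (ℓ := 142) (u := 159 * 2 ^ 60) (by norm_num) (by norm_num)
        (by norm_num)).trans (by norm_num)
  have h6 : T.n₁ ≤ 2 ^ 104 :=
    (T.descent h5 hD (ℓ := 134) (u := 159 * 2 ^ 56) (by norm_num) (by norm_num)
        (by norm_num)).trans (by norm_num)
  have h7 : T.n₁ ≤ 2 ^ 102 :=
    (T.descent h6 hD (ℓ := 130) (u := 159 * 2 ^ 54) (by norm_num) (by norm_num)
        (by norm_num)).trans (by norm_num)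
  have h8 : T.n₁ ≤ 2 ^ 101 :=
    (T.descent h7 hD (ℓ := 127) (u := 159 * 2 ^ 53) (by norm_num) (by norm_num)
        (by norm_num)).trans (by norm_num)
  exact h8

theorem le_two_pow_ten : T.n₁ ≤ 2 ^ 10 := by
  have hN := T.le_two_pow_101
  have hD : T.n₁ - T.n₃ < 305 :=
    T.sub_lt_of_withLogs (m := 700) (ε := 3949) (K₂ := 484) (K₃ := 305) (v₁ := midApprox₁)
      (v₂ := midApprox₂) (v₃ := midApprox₃) hN (by norm_num) (by norm_num) (by decide +kernel)
      (by decide +kernel)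
  have hU := T.two_pow_mul_three_pow_le_of_checkRows hN (Nat.le_of_lt_succ hD)
    (by decide +kernel) checkRows_lucasDiffZeros (by norm_num) (by norm_num) (by norm_num)
  have hn : T.n₃ < 646 :=
    T.lt_of_withLogs (m := 700) (ε := 3949) (K₂ := 484) (K₃ := 305) (U := 2 ^ 115 * 3 ^ 72)
      (v₁ := midApprox₁) (v₂ := midApprox₂) (v₃ := midApprox₃) hN (by exact_mod_cast hU) hD
      (by norm_num) (by norm_num) (by norm_num) (by decide +kernel) (by decide +kernel)
  omega

/-- The bounds within which the solutions are enumerated. -/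
theorem sub_lt_and_lt : T.n₁ - T.n₃ < 41 ∧ T.n₃ < 106 := by
  have hN := T.le_two_pow_ten
  have hD : T.n₁ - T.n₃ < 41 :=
    T.sub_lt_of_withLogs (m := 200) (ε := 1119) (K₂ := 137) (K₃ := 86) (v₁ := smallApprox₁)
      (v₂ := smallApprox₂) (v₃ := smallApprox₃) hN (by norm_num) (by norm_num) (by decide +kernel)
      (by decide +kernel)
  have hU := T.two_pow_mul_three_pow_le_of_checkRows hN (Nat.le_of_lt_succ hD)
    (by decide +kernel) checkRows_lucasDiffZerosSmall (by norm_num) (by norm_num) (by norm_num)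
  exact ⟨hD, T.lt_of_withLogs (m := 200) (ε := 1119) (K₂ := 137) (K₃ := 86) (U := 2 ^ 21 * 3 ^ 13)
    (v₁ := smallApprox₁) (v₂ := smallApprox₂) (v₃ := smallApprox₃) hN (by exact_mod_cast hU) hD
    (by norm_num) (by norm_num) (by norm_num) (by decide +kernel) (by decide +kernel)⟩

end PillaiTriple

/-- Decide whether `L_m - c` divides `6 ^ 200` for some `1 ≤ m ≤ k`, where `a` and `b` are
`L_k` and `L_{k+1}`. -/
def hasSmooth (c : ℕ) : ℕ → ℕ → ℕ → Bool
  | 0, _, _ => false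
  | k + 1, a, b =>
    if a ≤ c then false
    else if Nat.beq (6 ^ 200 % (a - c)) 0 then true
    else force (b - a) fun p ↦ hasSmooth c k p a

/-- Decide whether `L_m - c` divides `6 ^ 200` for two values of `m` with `1 ≤ m ≤ k`, where
`a` and `b` are `L_k` and `L_{k+1}`. -/
def hasTwoSmooth (c : ℕ) : ℕ → ℕ → ℕ → Bool
  | 0, _, _ => false
  | k + 1, a, b =>
    if a ≤ c then false
    else if Nat.beq (6 ^ 200 % (a - c)) 0 then force (b - a) fun p ↦ hasSmooth c k p a
    else force (b - a) fun p ↦ hasTwoSmooth c k p a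

theorem toNat_lucas_add_two (k : ℕ) :
    (lucas (k + 2)).toNat = (lucas (k + 1)).toNat + (lucas k).toNat := by
  have e : lucas (k + 2) = lucas (k + 1) + lucas k := rfl
  have h1 := (lucas_pos_le k).1
  have h2 := (lucas_pos_le (k + 1)).1
  omega

theorem toNat_lucas_lt_succ {k : ℕ} (hk : 0 < k) :
    (lucas k).toNat < (lucas (k + 1)).toNat := by
  obtain ⟨j, rfl⟩ := Nat.exists_eq_succ_of_ne_zero hk.ne'
  have := toNat_lucas_add_two j
  have h1 := (lucas_pos_le j).1
  change (lucas (j + 1)).toNat < (lucas (j + 2)).toNat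
  omega

theorem toNat_lucas_mono {m n : ℕ} (hm : 0 < m) (h : m ≤ n) :
    (lucas m).toNat ≤ (lucas n).toNat := by
  induction n, h using Nat.le_induction with
  | base => exact le_rfl
  | succ n hn ih => exact ih.trans (toNat_lucas_lt_succ (hm.trans_le hn)).le

theorem hasSmooth_eq_true {c k m : ℕ} (hm : 0 < m) (hmk : m ≤ k) (hc : c < (lucas m).toNat)
    (hs : (lucas m).toNat - c ∣ 6 ^ 200) :
    hasSmooth c k (lucas k).toNat (lucas (k + 1)).toNat = true := by
  induction k with
  | zero => omega
  | succ k ih =>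
    have hle := toNat_lucas_mono hm hmk
    rw [hasSmooth, if_neg (by omega), force_eq]
    split_ifs with h
    · rfl
    · rcases hmk.eq_or_lt with rfl | hlt
      · exact absurd (Nat.beq_eq ▸ Nat.mod_eq_zero_of_dvd hs) h
      · rw [toNat_lucas_add_two, Nat.add_sub_cancel_left]
        exact ih (by omega)

theorem hasTwoSmooth_eq_true {c k m m' : ℕ} (hm : 0 < m) (hmm : m < m') (hmk : m' ≤ k)
    (hc : c < (lucas m).toNat) (hs : (lucas m).toNat - c ∣ 6 ^ 200)
    (hs' : (lucas m').toNat - c ∣ 6 ^ 200) :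
    hasTwoSmooth c k (lucas k).toNat (lucas (k + 1)).toNat = true := by
  induction k with
  | zero => omega
  | succ k ih =>
    have hle := toNat_lucas_mono hm (hmm.le.trans hmk)
    rw [hasTwoSmooth, if_neg (by omega), force_eq, force_eq, toNat_lucas_add_two,
      Nat.add_sub_cancel_left]
    split_ifs with h
    · exact hasSmooth_eq_true hm (by omega) hc hs
    · rcases hmk.eq_or_lt with rfl | hlt
      · exact absurd (Nat.beq_eq ▸ Nat.mod_eq_zero_of_dvd hs') h
      · exact ih (by omega)

/-- Decide whether `c = a - u`, if between `0` and `a - p`, is one of the exceptional values or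
admits at most one smaller solution, where `a` and `p` are `L_{k+1}` and `L_k`, and
`u = 2 ^ x * 3 ^ y` is the largest number of this form below `a`. -/
def checkExponent (k a p y : ℕ) : Bool :=
  force (3 ^ y) fun t ↦ force (2 ^ Nat.log2 ((a - 1) / t) * t) fun u ↦
    if u ≤ p then true
    else if a ≤ u then true
    else force (a - u) fun c ↦
      if hasTwoSmooth c k p a then decide (c ∈ [1, 2, 3, 5, 9, 15, 20, 75]) else true

/-- Run `checkExponent` on all exponents of `3` below the last argument. -/
def checkExponents (k a p : ℕ) : ℕ → Bool
  | 0 => true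
  | y + 1 => if checkExponent k a p y then checkExponents k a p y else false

/-- Run `checkExponents` on the indices `k, k + 1, …` with `a` and `p` equal to `L_{k+1}`
and `L_k`. -/
def checkIndices : ℕ → ℕ → ℕ → ℕ → Bool
  | 0, _, _, _ => true
  | j + 1, k, a, p =>
    if checkExponents k a p (k + 2) then force (k + 1) fun k' ↦ force (a + p) fun a' ↦
      checkIndices j k' a' a
    else false

theorem checkIndices_eq_true : checkIndices 146 0 1 2 = true := by decide +kernel

theorem checkExponent_of_checkExponents {k a p y z : ℕ} (h : checkExponents k a p z = true)
    (hy : y < z) : checkExponent k a p y = true := by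
  induction z with
  | zero => omega
  | succ z ih =>
    rw [checkExponents] at h
    split_ifs at h with hz
    rcases (Nat.lt_succ_iff.1 hy).eq_or_lt with rfl | hlt
    · exact hz
    · exact ih h hlt

theorem checkExponents_of_checkIndices {i j k : ℕ}
    (h : checkIndices j k (lucas (k + 1)).toNat (lucas k).toNat = true) (hi : i < j) :
    checkExponents (k + i) (lucas (k + i + 1)).toNat (lucas (k + i)).toNat (k + i + 2) = true := by
  induction j generalizing i k with
  | zero => omega
  | succ j ih =>
    rw [checkIndices] at h
    split_ifs at h with hk
    simp only [force_eq, ← toNat_lucas_add_two] at h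
    cases i with
    | zero => exact hk
    | succ i =>
      simpa only [Nat.add_right_comm, Nat.add_assoc, Nat.add_comm i 1] using
        ih h (Nat.lt_of_succ_lt_succ hi)

namespace PillaiTriple

theorem toNat_lucas_eq {c : ℤ} (hc : 0 < c) {n x y : ℕ} (h : lucas n - 2 ^ x * 3 ^ y = c) :
    (lucas n).toNat = c.toNat + 2 ^ x * 3 ^ y := by
  have h1 := (lucas_pos_le n).1
  zify
  rw [Int.toNat_of_nonneg h1.le, Int.toNat_of_nonneg hc.le]
  linarith

theorem two_pow_mul_three_pow_dvd {x y N : ℕ} (hx : x ≤ N) (hy : y ≤ N) :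
    2 ^ x * 3 ^ y ∣ 6 ^ N := by
  rw [show 6 = 2 * 3 from rfl, mul_pow]
  exact mul_dvd_mul (pow_dvd_pow _ hx) (pow_dvd_pow _ hy)

theorem mem (T : PillaiTriple) : T.c ∈ ({1, 2, 3, 5, 9, 15, 20, 75} : Set ℤ) := by
  obtain ⟨hD, hn⟩ := T.sub_lt_and_lt
  have hc := T.c_pos
  have l1 := T.lt₂₁
  have l2 := T.lt₃₂
  have l3 := T.two_le
  have b1 := exponents_le hc T.eq₁
  have b2 := exponents_le hc T.eq₂
  have b3 := exponents_le hc T.eq₃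
  have e1 := toNat_lucas_eq hc T.eq₁
  have e2 := toNat_lucas_eq hc T.eq₂
  have e3 := toNat_lucas_eq hc T.eq₃
  obtain ⟨k, hk⟩ : ∃ k, T.n₁ = k + 2 := ⟨T.n₁ - 2, by omega⟩
  rw [hk] at e1
  have hmono := toNat_lucas_mono (m := T.n₃) (n := k) (by omega) (by omega)
  have hmono' := toNat_lucas_mono (m := k) (n := k + 1) (by omega) (by omega)
  have hrec := toNat_lucas_add_two k
  have hck := checkExponent_of_checkExponents
    (checkExponents_of_checkIndices (k := 0) (i := k + 1) checkIndices_eq_true (by omega))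
    (y := T.y₁) (by omega)
  rw [zero_add, checkExponent] at hck
  have h3 : 0 < 3 ^ T.y₁ := by positivity
  have hu3 : 0 < 2 ^ T.x₃ * 3 ^ T.y₃ := by positivity
  have hlog : Nat.log2 (((lucas (k + 2)).toNat - 1) / 3 ^ T.y₁) = T.x₁ := by
    have hle : 2 ^ T.x₁ ≤ ((lucas (k + 2)).toNat - 1) / 3 ^ T.y₁ := by
      rw [Nat.le_div_iff_mul_le h3]; omega
    rw [Nat.log2_eq_iff (by have := Nat.one_le_two_pow (n := T.x₁); omega)]
    refine ⟨hle, ?_⟩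
    rw [Nat.div_lt_iff_lt_mul h3, pow_succ, mul_right_comm]
    omega
  simp only [force_eq] at hck
  have hsub : (lucas (k + 2)).toNat - 2 ^ T.x₁ * 3 ^ T.y₁ = T.c.toNat := by omega
  rw [show k + 1 + 1 = k + 2 from rfl, hlog, if_neg (by omega), if_neg (by omega), hsub,
    if_pos] at hck
  · have := of_decide_eq_true hck
    simp only [List.mem_cons, List.not_mem_nil, or_false] at this
    simp only [Set.mem_insert_iff, Set.mem_singleton_iff]
    omega
  · refine hasTwoSmooth_eq_true (m := T.n₃) (m' := T.n₂) (by omega) l2 (by omega) (by omega) ?_ ?_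
    · rw [e3, Nat.add_sub_cancel_left]
      exact two_pow_mul_three_pow_dvd (by omega) (by omega)
    · rw [e2, Nat.add_sub_cancel_left]
      exact two_pow_mul_three_pow_dvd (by omega) (by omega)

end PillaiTriple

theorem two_pow_mul_three_pow_inj {x y x' y' : ℕ}
    (h : (2 : ℤ) ^ x * 3 ^ y = 2 ^ x' * 3 ^ y') : x = x' ∧ y = y' := by
  have h' : 2 ^ x * 3 ^ y = 2 ^ x' * 3 ^ y' := by exact_mod_cast h
  constructor
  · simpa [Nat.factorization_mul, Nat.Prime.factorization Nat.prime_two,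
      Nat.Prime.factorization Nat.prime_three] using congrArg (fun n ↦ n.factorization 2) h'
  · simpa [Nat.factorization_mul, Nat.Prime.factorization Nat.prime_two,
      Nat.Prime.factorization Nat.prime_three] using congrArg (fun n ↦ n.factorization 3) h'

theorem solution_ext {c : ℤ} {s t : ℕ × ℕ × ℕ} (hst : s ≠ t)
    (hs : lucas s.1 - 2 ^ s.2.1 * 3 ^ s.2.2 = c) (ht : lucas t.1 - 2 ^ t.2.1 * 3 ^ t.2.2 = c) :
    s.1 ≠ t.1 := by
  intro h
  rw [h] at hs
  obtain ⟨h1, h2⟩ := two_pow_mul_three_pow_inj (by linarith : (2 : ℤ) ^ s.2.1 * 3 ^ s.2.2 = _)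
  exact hst (Prod.ext h (Prod.ext h1 h2))

theorem mem_of_lt {c : ℤ} (hc : 0 < c) {s₁ s₂ s₃ : ℕ × ℕ × ℕ} (h₃₂ : s₃.1 < s₂.1)
    (h₂₁ : s₂.1 < s₁.1) (h₁ : lucas s₁.1 - 2 ^ s₁.2.1 * 3 ^ s₁.2.2 = c)
    (h₂ : lucas s₂.1 - 2 ^ s₂.2.1 * 3 ^ s₂.2.2 = c)
    (h₃ : lucas s₃.1 - 2 ^ s₃.2.1 * 3 ^ s₃.2.2 = c) :
    c ∈ ({1, 2, 3, 5, 9, 15, 20, 75} : Set ℤ) := by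
  by_cases hn : 2 ≤ s₃.1
  · exact (PillaiTriple.mk c _ _ _ _ _ _ _ _ _ hc hn h₃₂ h₂₁ h₁ h₂ h₃).mem
  · have hu : (0 : ℤ) < 2 ^ s₃.2.1 * 3 ^ s₃.2.2 := by positivity
    have hl : lucas s₃.1 ≤ 2 := by
      have : s₃.1 = 0 ∨ s₃.1 = 1 := by omega
      rcases this with h | h <;> rw [h] <;> decide
    left
    omega

theorem lucas_pillai_pos (c : ℤ) (hc : 0 < c) :
    (∃ s₁ s₂ s₃ : ℕ × ℕ × ℕ,
        s₁ ≠ s₂ ∧ s₁ ≠ s₃ ∧ s₂ ≠ s₃ ∧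
        lucas s₁.1 - 2 ^ s₁.2.1 * 3 ^ s₁.2.2 = c ∧
        lucas s₂.1 - 2 ^ s₂.2.1 * 3 ^ s₂.2.2 = c ∧
        lucas s₃.1 - 2 ^ s₃.2.1 * 3 ^ s₃.2.2 = c) ↔
      c ∈ ({1, 2, 3, 5, 9, 15, 20, 75} : Set ℤ) := by
  constructor
  · rintro ⟨s₁, s₂, s₃, h12, h13, h23, e1, e2, e3⟩
    have n12 := solution_ext h12 e1 e2
    have n13 := solution_ext h13 e1 e3
    have n23 := solution_ext h23 e2 e3
    rcases lt_or_gt_of_ne n12 with a | a <;> rcases lt_or_gt_of_ne n13 with b | b <;>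
      rcases lt_or_gt_of_ne n23 with d | d
    · exact mem_of_lt hc a d e3 e2 e1
    · exact mem_of_lt hc b d e2 e3 e1
    · omega
    · exact mem_of_lt hc b a e2 e1 e3
    · exact mem_of_lt hc a b e3 e1 e2
    · omega
    · exact mem_of_lt hc d b e1 e3 e2
    · exact mem_of_lt hc d a e1 e2 e3
  · intro h
    simp only [Set.mem_insert_iff, Set.mem_singleton_iff] at h
    rcases h with rfl | rfl | rfl | rfl | rfl | rfl | rfl | rfl
    · exact ⟨(0, 0, 0), (2, 1, 0), (3, 0, 1), by decide⟩
    · exact ⟨(2, 0, 0), (3, 1, 0), (5, 0, 2), by decide⟩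
    · exact ⟨(3, 0, 0), (4, 2, 0), (5, 3, 0), by decide⟩
    · exact ⟨(4, 1, 0), (5, 1, 1), (7, 3, 1), by decide⟩
    · exact ⟨(5, 1, 0), (6, 0, 2), (13, 9, 0), by decide⟩
    · exact ⟨(6, 0, 1), (8, 5, 0), (10, 2, 3), by decide⟩
    · exact ⟨(7, 0, 2), (8, 0, 3), (16, 0, 7), by decide⟩
    · exact ⟨(9, 0, 0), (10, 4, 1), (14, 8, 1), by decide⟩
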